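/- Let g_1, ..., g_s be irreducible polynomials in ℝ[x,y], and for each i let C_i be the plane affine curve g_i = 0. Assume: (1) the set K_S = {(a,b) ∈ ℝ² : g_1(a,b) ≥ 0, ..., g_s(a,b) ≥ 0} is compact; (2) each C_i has no real singular points (i.e., at every real zero of g_i the gradient of g_i is nonzero); (3) at every real point of intersection of two of the curves C_i, C_j (i ≠ j) the gradients of g_i and g_j are linearly independent (transversal intersection), and no three of the curves C_i pass through a common real point. Then the preordering T_S of ℝ[x,y] generated by g_1, ..., g_s is saturated, i.e., T_S equals the set of all polynomials nonnegative on K_S. -/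

import Mathlib

noncomputable section

open MvPolynomial

/-- The preordering of a commutative ring `A` generated by a subset `S`:
the smallest subsemiring of `A` containing `S` together with all squares. -/
def preorderingGen {A : Type*} [CommRing A] (S : Set A) : Set A :=
  (Subsemiring.closure (S ∪ {a | ∃ b, a = b ^ 2}) : Set A)


set_option linter.all false
namespace Sch

universe u

structure IsPre {A : Type*} [CommRing A] (T : Set A) : Prop where
  add : ∀ {a b}, a ∈ T → b ∈ T → a + b ∈ T
  mul : ∀ {a b}, a ∈ T → b ∈ T → a * b ∈ T
  sq : ∀ a, a ^ 2 ∈ T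

namespace IsPre
variable {A : Type*} [CommRing A] {T : Set A} (hT : IsPre T)
include hT
theorem zero : (0 : A) ∈ T := by simpa using hT.sq 0
theorem one : (1 : A) ∈ T := by simpa using hT.sq 1
theorem even_pow (a : A) (k : ℕ) : a ^ (2 * k) ∈ T := by
  have := hT.sq (a ^ k); rwa [← pow_mul, mul_comm] at this
theorem pow {a : A} (ha : a ∈ T) (k : ℕ) : a ^ k ∈ T := by
  induction k with
  | zero => simpa using hT.one
  | succ k ih => rw [pow_succ]; exact hT.mul ih ha
theorem sum {ι : Type*} (s : Finset ι) (f : ι → A) (h : ∀ i ∈ s, f i ∈ T) : ∑ i ∈ s, f i ∈ T := by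
  classical
  induction s using Finset.induction_on with
  | empty => simpa using hT.zero
  | insert a s ha ih =>
    rw [Finset.sum_insert ha]
    exact hT.add (h _ (Finset.mem_insert_self _ _)) (ih fun i hi => h i (Finset.mem_insert_of_mem hi))
/-- `T + aT` is a preordering. -/
theorem ext (a : A) : IsPre {z | ∃ x ∈ T, ∃ y ∈ T, z = x + a * y} where
  add := by
    rintro _ _ ⟨x, hx, y, hy, rfl⟩ ⟨x', hx', y', hy', rfl⟩
    exact ⟨x + x', hT.add hx hx', y + y', hT.add hy hy', by ring⟩
  mul := by
    rintro _ _ ⟨x, hx, y, hy, rfl⟩ ⟨x', hx', y', hy', rfl⟩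
    exact ⟨x * x' + a ^ 2 * (y * y'), hT.add (hT.mul hx hx') (hT.mul (hT.sq a) (hT.mul hy hy')),
      x * y' + x' * y, hT.add (hT.mul hx hy') (hT.mul hx' hy), by ring⟩
  sq := fun b => ⟨b ^ 2, hT.sq b, 0, hT.zero, by ring⟩
end IsPre

theorem exists_max {A : Type u} [CommRing A] (T : Set A) (hT : IsPre T) (D : A)
    (hD : ∀ k, -(D ^ (2 * k)) ∉ T) :
    ∃ M : Set A, IsPre M ∧ T ⊆ M ∧ (∀ k, -(D ^ (2 * k)) ∉ M) ∧
      ∀ a, a ∉ M → ∃ k, ∃ x ∈ M, ∃ y ∈ M, -(D ^ (2 * k)) = x + a * y := by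
  obtain ⟨M, hTM, hM⟩ := zorn_subset_nonempty {P : Set A | IsPre P ∧ ∀ k, -(D ^ (2 * k)) ∉ P}
    (by
      intro c hc hchain hne
      refine ⟨⋃₀ c, ⟨⟨?_, ?_, ?_⟩, ?_⟩, fun s hs => Set.subset_sUnion_of_mem hs⟩
      · rintro a b ⟨P, hP, ha⟩ ⟨Q, hQ, hb⟩
        rcases hchain.total hP hQ with h | h
        · exact ⟨Q, hQ, (hc hQ).1.add (h ha) hb⟩
        · exact ⟨P, hP, (hc hP).1.add ha (h hb)⟩
      · rintro a b ⟨P, hP, ha⟩ ⟨Q, hQ, hb⟩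
        rcases hchain.total hP hQ with h | h
        · exact ⟨Q, hQ, (hc hQ).1.mul (h ha) hb⟩
        · exact ⟨P, hP, (hc hP).1.mul ha (h hb)⟩
      · intro a
        obtain ⟨P, hP⟩ := hne
        exact ⟨P, hP, (hc hP).1.sq a⟩
      · rintro k ⟨P, hP, h⟩
        exact (hc hP).2 k h) T ⟨hT, hD⟩
  refine ⟨M, hM.prop.1, hTM, hM.prop.2, ?_⟩
  intro a ha
  by_contra hcon
  push Not at hcon
  have hpre := hM.prop.1.ext a
  have hsub : M ⊆ {z | ∃ x ∈ M, ∃ y ∈ M, z = x + a * y} :=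
    fun x hx => ⟨x, hx, 0, hM.prop.1.zero, by ring⟩
  have := hM.le_of_ge ⟨hpre, fun k ⟨x, hx, y, hy, h⟩ => hcon k x hx y hy h⟩ hsub
  exact ha (this ⟨0, hM.prop.1.zero, 1, hM.prop.1.one, by ring⟩)

/-- A total preordering with prime support gives an ordered field. -/
theorem field_of_cone {A : Type u} [CommRing A] (M : Set A) (hM : IsPre M)
    (htot : ∀ a, a ∈ M ∨ -a ∈ M) (I : Ideal A) (hI : I.IsPrime) (hIM : ∀ a, a ∈ I ↔ a ∈ M ∧ -a ∈ M) :
    ∃ (F : Type u) (_ : Field F) (_ : LinearOrder F) (_ : IsStrictOrderedRing F) (φ : A →+* F),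
      (∀ t ∈ M, 0 ≤ φ t) ∧ ∀ t, φ t = 0 ↔ t ∈ I := by
  classical
  let F := FractionRing (A ⧸ I)
  let φ : A →+* F := (algebraMap (A ⧸ I) F).comp (Ideal.Quotient.mk I)
  have hφ : ∀ t, φ t = 0 ↔ t ∈ I := by
    intro t
    show algebraMap (A ⧸ I) F (Ideal.Quotient.mk I t) = 0 ↔ _
    rw [IsFractionRing.to_map_eq_zero_iff, Ideal.Quotient.eq_zero_iff_mem]
  have hrep : ∀ x : F, ∃ a b, b ∉ I ∧ x * φ b ^ 2 = φ a := by
    intro x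
    obtain ⟨a, b, hb, rfl⟩ := IsFractionRing.div_surjective (A := A ⧸ I) x
    obtain ⟨a, rfl⟩ := Ideal.Quotient.mk_surjective a
    obtain ⟨b, rfl⟩ := Ideal.Quotient.mk_surjective b
    have hbI : b ∉ I := by
      intro h
      rw [Ideal.Quotient.eq_zero_iff_mem.2 h] at hb
      exact zero_notMem_nonZeroDivisors hb
    have : φ b ≠ 0 := fun h => hbI ((hφ b).1 h)
    refine ⟨a * b, b, hbI, ?_⟩
    rw [map_mul]
    show φ a / φ b * φ b ^ 2 = _
    rw [sq, ← mul_assoc, div_mul_cancel₀ _ this]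
  have key : ∀ a b, a ∈ M → φ a = φ b → b ∈ M := by
    intro a b ha hab
    have : b - a ∈ I := by rw [← hφ, map_sub, hab, sub_self]
    have := hM.add ha ((hIM _).1 this).1
    simpa using this
  have key2 : ∀ a b, b ∉ I → a * b ^ 2 ∈ M → a ∈ M := by
    intro a b hb hab
    rcases htot a with h | h
    · exact h
    have h1 : a * b ^ 2 ∈ I := (hIM _).2 ⟨hab, by
      have := hM.mul h (hM.sq b); rwa [neg_mul] at this⟩
    rcases hI.mem_or_mem h1 with h2 | h2
    · exact ((hIM _).1 h2).1
    · exact absurd (hI.mem_of_pow_mem _ h2) hb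
  have hb0 : ∀ b, b ∉ I → φ b ≠ 0 := fun b hb h => hb ((hφ b).1 h)
  let N : RingCone F :=
    { carrier := {x | ∃ a ∈ M, ∃ b, b ∉ I ∧ x * φ b ^ 2 = φ a}
      add_mem' := by
        rintro x y ⟨a, ha, b, hb, h⟩ ⟨a', ha', b', hb', h'⟩
        refine ⟨a * b' ^ 2 + a' * b ^ 2, hM.add (hM.mul ha (hM.sq _)) (hM.mul ha' (hM.sq _)),
          b * b', fun h => (hI.mem_or_mem h).elim hb hb', ?_⟩
        simp only [map_add, map_mul, map_pow, ← h, ← h']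
        ring
      mul_mem' := by
        rintro x y ⟨a, ha, b, hb, h⟩ ⟨a', ha', b', hb', h'⟩
        refine ⟨a * a', hM.mul ha ha',
          b * b', fun h => (hI.mem_or_mem h).elim hb hb', ?_⟩
        simp only [map_mul, ← h, ← h']
        ring
      one_mem' := ⟨1, hM.one, 1, fun h => hI.ne_top ((Ideal.eq_top_iff_one _).2 h), by simp⟩
      zero_mem' := ⟨0, hM.zero, 1, fun h => hI.ne_top ((Ideal.eq_top_iff_one _).2 h), by simp⟩
      eq_zero_of_mem_of_neg_mem' := by
        rintro x ⟨a, ha, b, hb, h⟩ ⟨a', ha', b', hb', h'⟩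
        have h1 : φ (a * b' ^ 2) = φ (-(a' * b ^ 2)) := by
          simp only [map_neg, map_mul, map_pow, ← h, ← h']
          ring
        have h2 : a * b' ^ 2 ∈ I := (hIM _).2 ⟨hM.mul ha (hM.sq _), by
          have : φ (a' * b ^ 2) = φ (- (a * b' ^ 2)) := by rw [map_neg, h1, map_neg, neg_neg]
          exact key _ _ (hM.mul ha' (hM.sq _)) this⟩
        have h3 : a ∈ I := (hI.mem_or_mem h2).elim id fun h => absurd (hI.mem_of_pow_mem _ h) hb'
        rw [(hφ a).2 h3] at h
        exact (mul_eq_zero.1 h).resolve_right (pow_ne_zero _ (hb0 b hb)) }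
  have hmem : ∀ x, x ∈ N ↔ ∃ a ∈ M, ∃ b, b ∉ I ∧ x * φ b ^ 2 = φ a := fun x => Iff.rfl
  haveI : HasMemOrNegMem N := ⟨by
    intro x
    obtain ⟨a, b, hb, h⟩ := hrep x
    rcases htot a with h1 | h1
    · exact Or.inl ⟨a, h1, b, hb, h⟩
    · exact Or.inr ⟨-a, h1, b, hb, by rw [map_neg, ← h]; ring⟩⟩
  letI lo : LinearOrder F := LinearOrder.mkOfAddGroupCone N
  haveI : IsOrderedRing F := IsOrderedRing.mkOfCone N
  haveI : IsStrictOrderedRing F := IsOrderedRing.toIsStrictOrderedRing F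
  refine ⟨F, inferInstance, lo, this, φ, ?_, hφ⟩
  intro t ht
  show φ t - 0 ∈ N
  rw [sub_zero]
  exact ⟨t, ht, 1, fun h => hI.ne_top ((Ideal.eq_top_iff_one _).2 h), by simp⟩

/-- Abstract Positivstellensatz. -/
theorem ps {A : Type u} [CommRing A] (T : Set A) (hT : IsPre T) (D : A)
    (hD : ∀ k, -(D ^ (2 * k)) ∉ T) :
    ∃ (F : Type u) (_ : Field F) (_ : LinearOrder F) (_ : IsStrictOrderedRing F) (φ : A →+* F),
      (∀ t ∈ T, 0 ≤ φ t) ∧ φ D ≠ 0 := by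
  obtain ⟨M, hM, hTM, hMD, hmax⟩ := exists_max T hT D hD
  have hneg1 : (-1 : A) ∉ M := by simpa using hMD 0
  have htot : ∀ a, a ∈ M ∨ -a ∈ M := by
    intro a
    by_contra hcon
    push Not at hcon
    obtain ⟨k, x, hx, y, hy, h⟩ := hmax _ hcon.1
    obtain ⟨l, x', hx', y', hy', h'⟩ := hmax _ hcon.2
    apply hMD (k + l)
    have : -(D ^ (2 * (k + l))) = a ^ 2 * (y * y') + x * D ^ (2 * l) + x' * D ^ (2 * k) + x * x' := by
      have e1 : a * y = -(D ^ (2 * k) + x) := by linear_combination -h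
      have e2 : -a * y' = -(D ^ (2 * l) + x') := by linear_combination -h'
      have e3 : D ^ (2 * (k + l)) = D ^ (2 * k) * D ^ (2 * l) := by rw [← pow_add]; ring_nf
      rw [e3]
      linear_combination (a * y) * e2 - (D ^ (2 * l) + x') * e1
    rw [this]
    exact hM.add (hM.add (hM.add (hM.mul (hM.sq a) (hM.mul hy hy')) (hM.mul hx (hM.even_pow _ _)))
      (hM.mul hx' (hM.even_pow _ _))) (hM.mul hx hx')
  have hmulI : ∀ a b, a ∈ M → -a ∈ M → b * a ∈ M := by
    intro a b h1 h2
    rcases htot b with h | h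
    · exact hM.mul h h1
    · have := hM.mul h h2; simpa using this
  let I : Ideal A :=
    { carrier := {a | a ∈ M ∧ -a ∈ M}
      add_mem' := by
        rintro a b ⟨h1, h2⟩ ⟨h3, h4⟩
        exact ⟨hM.add h1 h3, by rw [neg_add]; exact hM.add h2 h4⟩
      zero_mem' := ⟨hM.zero, by simpa using hM.zero⟩
      smul_mem' := by
        rintro b a ⟨h1, h2⟩
        refine ⟨hmulI a b h1 h2, ?_⟩
        have := hmulI a (-b) h1 h2
        simpa using this }
  have hIM : ∀ a, a ∈ I ↔ a ∈ M ∧ -a ∈ M := fun a => Iff.rfl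
  have hcore : ∀ a b, -a ∉ M → -b ∉ M → -(a * b) ∉ M := by
    intro a b ha hb hab
    obtain ⟨k, x, hx, y, hy, h⟩ := hmax _ ha
    obtain ⟨l, x', hx', y', hy', h'⟩ := hmax _ hb
    apply hMD (k + l)
    have : -(D ^ (2 * (k + l))) = -(a * b) * (y * y') + x * D ^ (2 * l) + x' * D ^ (2 * k) + x * x' := by
      have e1 : a * y = (D ^ (2 * k) + x) := by linear_combination h
      have e2 : b * y' = (D ^ (2 * l) + x') := by linear_combination h'
      have e3 : D ^ (2 * (k + l)) = D ^ (2 * k) * D ^ (2 * l) := by rw [← pow_add]; ring_nf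
      rw [e3]
      linear_combination ((a * y)) * e2 + (D ^ (2 * l) + x') * e1
    rw [this]
    exact hM.add (hM.add (hM.add (hM.mul hab (hM.mul hy hy')) (hM.mul hx (hM.even_pow _ _)))
      (hM.mul hx' (hM.even_pow _ _))) (hM.mul hx hx')
  have hI : I.IsPrime := by
    refine ⟨fun h => hneg1 ?_, ?_⟩
    · exact ((hIM 1).1 ((Ideal.eq_top_iff_one _).1 h)).2
    · intro a b hab
      by_contra hcon
      push Not at hcon
      have main : ∀ a b, a ∉ I → b ∉ I → a * b ∈ I → -a ∉ M → False := by
        intro a b ha hb hab h1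
        by_cases h2 : -b ∈ M
        · have h3 : b ∉ M := fun h => hb ⟨h, h2⟩
          refine hcore a (-b) h1 (by simpa using h3) ?_
          have := hab.1
          simpa using this
        · exact hcore a b h1 h2 hab.2
      by_cases h1 : -a ∈ M
      · have h3 : a ∉ M := fun h => hcon.1 ⟨h, h1⟩
        refine main (-a) b (fun h => hcon.1 (by simpa using h)) hcon.2 ?_ (by simpa using h3)
        rw [neg_mul]; exact I.neg_mem hab
      · exact main a b hcon.1 hcon.2 hab h1
  obtain ⟨F, i1, i2, i3, φ, h1, h2⟩ := field_of_cone M hM htot I hI hIM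
  refine ⟨F, i1, i2, i3, φ, fun t ht => h1 t (hTM ht), fun h => ?_⟩
  have h3 := (h2 D).1 h
  apply hMD 1
  have := (hIM _).1 (I.mul_mem_left D h3)
  simpa [sq] using this.2

end Sch

namespace Sch
universe u

theorem exists_irr_sign {F : Type u} [Field F] [LinearOrder F] [IsStrictOrderedRing F]
    (a b : F) (p : Polynomial F) (h : p.eval a * p.eval b < 0) :
    ∃ g, Irreducible g ∧ g ∣ p ∧ g.eval a * g.eval b < 0 := by
  induction p using WfDvdMonoid.induction_on_irreducible with
  | zero => simp at h
  | unit q hq =>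
    obtain ⟨c, hc, rfl⟩ := Polynomial.isUnit_iff.1 hq
    simp only [Polynomial.eval_C] at h
    exact absurd h (not_lt.2 (mul_self_nonneg c))
  | mul q i hq hi ih =>
    by_cases h1 : i.eval a * i.eval b < 0
    · exact ⟨i, hi, dvd_mul_right _ _, h1⟩
    · have h2 : q.eval a * q.eval b < 0 := by
        by_contra h3
        rw [Polynomial.eval_mul, Polynomial.eval_mul] at h
        push Not at h1 h3
        have := mul_nonneg h1 h3
        nlinarith
      obtain ⟨g, h3, h4, h5⟩ := ih h2
      exact ⟨g, h3, h4.mul_left _, h5⟩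

/-- weighted squares -/
def wsq {F L : Type*} [Field F] [LinearOrder F] [IsStrictOrderedRing F] [CommRing L] (ι : F →+* L) :
    Submonoid L where
  carrier := {z | ∃ c, 0 ≤ c ∧ ∃ h : L, z = ι c * h ^ 2}
  mul_mem' := by
    rintro _ _ ⟨c, hc, h, rfl⟩ ⟨c', hc', h', rfl⟩
    exact ⟨c * c', mul_nonneg hc hc', h * h', by rw [map_mul]; ring⟩
  one_mem' := ⟨1, zero_le_one, 1, by simp⟩

theorem root_ext (n : ℕ) : ∀ (F : Type u) [Field F] [LinearOrder F] [IsStrictOrderedRing F]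
    (p : Polynomial F) (a b : F), p.natDegree < n → p.eval a * p.eval b < 0 →
    ∃ (F' : Type u) (_ : Field F') (_ : LinearOrder F') (_ : IsStrictOrderedRing F')
      (ι : F →+* F'), (∀ c, 0 ≤ c → 0 ≤ ι c) ∧ ∃ r, Polynomial.eval₂ ι r p = 0 := by
  induction n with
  | zero => intro F _ _ _ p a b h; omega
  | succ n ih =>
    intro F _ _ _ p a b hn hab
    obtain ⟨g, hg, hgp, hgab⟩ := exists_irr_sign a b p hab
    have hp0 : p ≠ 0 := by rintro rfl; simp at hab
    have hgn : g.natDegree ≤ p.natDegree := Polynomial.natDegree_le_of_dvd hgp hp0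
    haveI : Fact (Irreducible g) := ⟨hg⟩
    let T : Set (AdjoinRoot g) := (wsq (AdjoinRoot.of g)).subsemiringClosure
    have hTc : T = AddSubmonoid.closure (wsq (AdjoinRoot.of g) : Set (AdjoinRoot g)) :=
      Submonoid.subsemiringClosure_coe _
    have hgen : ∀ z, z ∈ wsq (AdjoinRoot.of g) → z ∈ T := by
      intro z hz
      rw [hTc]; exact AddSubmonoid.subset_closure hz
    have hT : IsPre T :=
      ⟨fun h1 h2 => add_mem (S := Subsemiring _) h1 h2, fun h1 h2 => mul_mem (S := Subsemiring _) h1 h2,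
        fun z => hgen _ ⟨1, zero_le_one, z, by simp⟩⟩
    by_cases hneg : (-1 : AdjoinRoot g) ∈ T
    · exfalso
      have hrep : ∀ t ∈ T, ∃ H : Polynomial F, AdjoinRoot.mk g H = t ∧
          H.natDegree ≤ 2 * (g.natDegree - 1) ∧
          ∀ (F' : Type u) [Field F'] [LinearOrder F'] [IsStrictOrderedRing F']
            (ι : F →+* F'), (∀ c, 0 ≤ c → 0 ≤ ι c) → ∀ r, 0 ≤ Polynomial.eval₂ ι r H := by
        intro t ht
        rw [hTc] at ht
        refine AddSubmonoid.closure_induction (motive := fun t _ => ∃ H : Polynomial F, AdjoinRoot.mk g H = t ∧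
          H.natDegree ≤ 2 * (g.natDegree - 1) ∧
          ∀ (F' : Type u) [Field F'] [LinearOrder F'] [IsStrictOrderedRing F']
            (ι : F →+* F'), (∀ c, 0 ≤ c → 0 ≤ ι c) → ∀ r, 0 ≤ Polynomial.eval₂ ι r H) ?_ ?_ ?_ ht
        · rintro _ ⟨c, hc, z, rfl⟩
          obtain ⟨h, rfl⟩ := AdjoinRoot.mk_surjective z
          refine ⟨Polynomial.C c * (h % g) ^ 2, ?_, ?_, ?_⟩
          · have : AdjoinRoot.mk g (h % g) = AdjoinRoot.mk g h := by
              rw [AdjoinRoot.mk_eq_mk]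
              exact ⟨-(h / g), by linear_combination EuclideanDomain.mod_add_div h g⟩
            rw [map_mul, map_pow, this]; rfl
          · have h1 : (h % g).natDegree ≤ g.natDegree - 1 := by
              have hgpos := hg.natDegree_pos
              have := Polynomial.natDegree_mod_lt h hgpos.ne'
              omega
            refine (Polynomial.natDegree_C_mul_le _ _).trans (Polynomial.natDegree_pow_le.trans ?_)
            omega
          · intro F' _ _ _ ι hι r
            rw [Polynomial.eval₂_mul, Polynomial.eval₂_pow, Polynomial.eval₂_C]
            exact mul_nonneg (hι c hc) (sq_nonneg _)
        · exact ⟨0, by simp, by simp, by intros; simp⟩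
        · rintro x y _ _ ⟨H, h1, h2, h3⟩ ⟨H', h1', h2', h3'⟩
          refine ⟨H + H', by rw [map_add, h1, h1'], (Polynomial.natDegree_add_le _ _).trans (max_le h2 h2'), ?_⟩
          intro F' _ _ _ ι hι r
          rw [Polynomial.eval₂_add]
          exact add_nonneg (h3 F' ι hι r) (h3' F' ι hι r)
      obtain ⟨H, h1, h2, h3⟩ := hrep _ hneg
      have hdvd : g ∣ 1 + H := by
        rw [← AdjoinRoot.mk_eq_zero, map_add, h1, map_one]; ring
      obtain ⟨k, hk⟩ := hdvd
      have hpos : ∀ x, 0 < g.eval x * k.eval x := by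
        intro x
        rw [← Polynomial.eval_mul, ← hk, Polynomial.eval_add, Polynomial.eval_one]
        have := h3 F (RingHom.id F) (fun c hc => hc) x
        rw [Polynomial.eval₂_id] at this
        linarith
      have hk0 : k ≠ 0 := by rintro rfl; have := hpos 0; simp at this
      have hdeg : g.natDegree + k.natDegree ≤ 2 * (g.natDegree - 1) := by
        rw [← Polynomial.natDegree_mul hg.ne_zero hk0, ← hk]
        exact (Polynomial.natDegree_add_le _ _).trans (max_le (by simp) h2)
      have hkab : k.eval a * k.eval b < 0 := by
        have e := mul_pos (hpos a) (hpos b)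
        by_contra h
        push Not at h
        nlinarith [mul_nonneg h (neg_nonneg.2 hgab.le)]
      have hgpos := hg.natDegree_pos
      have hkn : k.natDegree < n := by omega
      obtain ⟨F', i1, i2, i3, ι, hι, r, hr⟩ := ih F k a b hkn hkab
      have e1 := h3 F' ι hι r
      have e2 : Polynomial.eval₂ ι r (1 + H) = 0 := by rw [hk, Polynomial.eval₂_mul, hr, mul_zero]
      rw [Polynomial.eval₂_add, Polynomial.eval₂_one] at e2
      linarith
    · obtain ⟨F', i1, i2, i3, φ, h1, -⟩ := ps T hT 1 (by simpa using hneg)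
      refine ⟨F', i1, i2, i3, φ.comp (AdjoinRoot.of g), ?_, φ (AdjoinRoot.root g), ?_⟩
      · intro c hc
        exact h1 _ (hgen _ ⟨c, hc, 1, by simp⟩)
      · obtain ⟨k, rfl⟩ := hgp
        rw [Polynomial.eval₂_mul, ← Polynomial.hom_eval₂, AdjoinRoot.eval₂_root, map_zero, zero_mul]

theorem exists_qth_root (F : Type u) [Field F] [LinearOrder F] [IsStrictOrderedRing F]
    (u : F) (hu : 0 < u) (q : ℕ) (hq : q ≠ 0) :
    ∃ (F' : Type u) (_ : Field F') (_ : LinearOrder F') (_ : IsStrictOrderedRing F')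
      (ι : F →+* F'), (∀ c, 0 ≤ c → 0 ≤ ι c) ∧ ∃ w, 0 < w ∧ w ^ q = ι u := by
  obtain ⟨F', i1, i2, i3, ι, hι, r, hr⟩ := root_ext _ F (Polynomial.X ^ q - Polynomial.C u) 0 (1 + u)
    (Nat.lt_succ_self _) (by
      simp only [Polynomial.eval_sub, Polynomial.eval_pow, Polynomial.eval_X, Polynomial.eval_C,
        zero_pow hq, zero_sub]
      have : (1 + u) ^ 1 ≤ (1 + u) ^ q := pow_le_pow_right₀ (by linarith) (by omega)
      have h2 : 0 < (1 + u) ^ q - u := by linarith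
      nlinarith)
  refine ⟨F', i1, i2, i3, ι, hι, |r|, ?_, ?_⟩
  · rw [abs_pos]
    rintro rfl
    simp [hq, hu.ne'] at hr
  · simp only [Polynomial.eval₂_sub, Polynomial.eval₂_pow, Polynomial.eval₂_X, Polynomial.eval₂_C] at hr
    rw [← abs_pow, sub_eq_zero.1 hr, abs_of_nonneg (hι u hu.le)]

end Sch

namespace Sch

theorem maxIdeal_ps : IsLocalRing.maximalIdeal (PowerSeries ℂ) = Ideal.span {PowerSeries.X} :=
  PowerSeries.maximalIdeal_eq_span_X

theorem residue_eq_zero (a : PowerSeries ℂ) :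
    IsLocalRing.residue (PowerSeries ℂ) a = 0 ↔ PowerSeries.constantCoeff a = 0 := by
  rw [IsLocalRing.residue_eq_zero_iff, maxIdeal_ps, Ideal.mem_span_singleton, PowerSeries.X_dvd_iff]

theorem dvd_of_dist {A : Type*} [CommRing A] {f P : Polynomial A} {I : Ideal A}
    (H : f.IsDistinguishedAt I) [IsAdicComplete I A] (h : PowerSeries A)
    (hP : (P : PowerSeries A) = f * h) : f ∣ P := by
  have e2 : H.algEquivQuotient (Ideal.Quotient.mk _ P) = 0 := by
    show Ideal.Quotient.mk _ (Polynomial.coeToPowerSeries.algHom A P) = 0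
    rw [Ideal.Quotient.eq_zero_iff_mem, Ideal.mem_span_singleton]
    refine ⟨h, ?_⟩
    simpa using hP
  rw [EmbeddingLike.map_eq_zero_iff, Ideal.Quotient.eq_zero_iff_mem, Ideal.mem_span_singleton] at e2
  exact e2

theorem order_coe_toNat {k : Type*} [Field k] {a : PowerSeries k} (ha : a ≠ 0) :
    ((a.order.toNat : ℕ) : ℕ∞) = a.order := by
  rw [ENat.natCast_toNat]
  intro h
  exact ha (PowerSeries.order_eq_top.1 h)

theorem hensel_factor (P : Polynomial (PowerSeries ℂ)) (hP : P.Monic)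
    (h0 : PowerSeries.constantCoeff (P.coeff 0) = 0) (j : ℕ) (hj : j < P.natDegree)
    (hj0 : PowerSeries.constantCoeff (P.coeff j) ≠ 0) :
    ∃ f k : Polynomial (PowerSeries ℂ), f.Monic ∧ k.Monic ∧ P = f * k ∧
      f.natDegree < P.natDegree ∧ k.natDegree < P.natDegree := by
  haveI : IsAdicComplete (IsLocalRing.maximalIdeal (PowerSeries ℂ)) (PowerSeries ℂ) := by
    rw [maxIdeal_ps]; infer_instance
  have hco : ∀ i, PowerSeries.coeff i ((P : PowerSeries (PowerSeries ℂ)).map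
      (IsLocalRing.residue (PowerSeries ℂ))) = IsLocalRing.residue (PowerSeries ℂ) (P.coeff i) := by
    intro i; simp
  have hne : (P : PowerSeries (PowerSeries ℂ)).map (IsLocalRing.residue (PowerSeries ℂ)) ≠ 0 := by
    intro h
    have := hco j
    rw [h, map_zero] at this
    exact hj0 ((residue_eq_zero _).1 this.symm)
  obtain ⟨f, h, H⟩ := PowerSeries.exists_isWeierstrassFactorization hne
  have hdeg := H.degree_eq_coe_lift_order_map
  have hdvd : f ∣ P := by
    exact dvd_of_dist H.isDistinguishedAt h H.eq_mul
  have hfm := H.isDistinguishedAt.monic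
  have hnat := H.natDegree_eq_toNat_order_map
  set Q := (P : PowerSeries (PowerSeries ℂ)).map (IsLocalRing.residue (PowerSeries ℂ)) with hQ
  have hfin : Q.order = (f.natDegree : ℕ∞) := by
    rw [hnat, order_coe_toNat hne]
  have hlt : f.natDegree < P.natDegree := by
    refine lt_of_le_of_lt ?_ hj
    have : Q.order ≤ j := PowerSeries.order_le _ (by
      rw [hco]; intro h; exact hj0 ((residue_eq_zero _).1 h))
    rw [hfin] at this
    exact_mod_cast this
  have hpos : 0 < f.natDegree := by
    rw [Nat.pos_iff_ne_zero]
    intro h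
    rw [h] at hfin
    have := PowerSeries.coeff_order hne
    rw [hfin] at this
    simp only [Nat.cast_zero, ENat.toNat_zero] at this
    exact this (by rw [hco]; exact (residue_eq_zero _).2 h0)
  obtain ⟨k, rfl⟩ := hdvd
  have hk : k.Monic := hfm.of_mul_monic_left hP
  refine ⟨f, k, hfm, hk, rfl, hlt, ?_⟩
  rw [hfm.natDegree_mul hk]
  omega

theorem taylor_coeff_pred {R : Type*} [CommRing R] (P : Polynomial R) (hP : P.Monic) (r : R)
    (hd : 0 < P.natDegree) :
    (Polynomial.taylor r P).coeff (P.natDegree - 1) = P.coeff (P.natDegree - 1) + P.natDegree * r := by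
  obtain ⟨d, hd'⟩ : ∃ d, P.natDegree = d + 1 := ⟨P.natDegree - 1, by omega⟩
  rw [hd', Nat.add_sub_cancel, Polynomial.taylor_coeff]
  have hdeg : (Polynomial.hasseDeriv d P).natDegree < 2 := by
    have := Polynomial.natDegree_hasseDeriv_le P d
    omega
  rw [Polynomial.eval_eq_sum_range' hdeg]
  simp only [Finset.sum_range_succ, Finset.range_zero, Finset.sum_empty, Polynomial.hasseDeriv_coeff]
  have h1 : P.coeff (1 + d) = 1 := by
    have := hP.coeff_natDegree; rwa [hd', add_comm] at this
  rw [h1]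
  simp [add_comm 1 d]

def spl (P : Polynomial (PowerSeries ℂ)) : Prop :=
  ∃ (q : ℕ) (hq : q ≠ 0), (P.map (PowerSeries.expand q hq : PowerSeries ℂ →ₐ[ℂ] PowerSeries ℂ).toRingHom).Splits

theorem spl.mono_left {P : Polynomial (PowerSeries ℂ)} {q : ℕ} {hq : q ≠ 0}
    (h : (P.map (PowerSeries.expand q hq : PowerSeries ℂ →ₐ[ℂ] PowerSeries ℂ).toRingHom).Splits)
    (r : ℕ) (hr : r ≠ 0) :
    (P.map (PowerSeries.expand (r * q) (mul_ne_zero hr hq) : PowerSeries ℂ →ₐ[ℂ] PowerSeries ℂ).toRingHom).Splits := by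
  have := h.map (PowerSeries.expand r hr : PowerSeries ℂ →ₐ[ℂ] PowerSeries ℂ).toRingHom
  rw [Polynomial.map_map] at this
  convert this using 2
  ext1 a
  exact PowerSeries.expand_mul r hr q hq a

theorem spl.of_expand {P : Polynomial (PowerSeries ℂ)} {q : ℕ} {hq : q ≠ 0}
    (h : spl (P.map (PowerSeries.expand q hq : PowerSeries ℂ →ₐ[ℂ] PowerSeries ℂ).toRingHom)) :
    spl P := by
  obtain ⟨r, hr, h⟩ := h
  refine ⟨r * q, mul_ne_zero hr hq, ?_⟩
  rw [Polynomial.map_map] at h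
  convert h using 2
  ext1 a
  exact PowerSeries.expand_mul r hr q hq a

theorem spl.mul {f k : Polynomial (PowerSeries ℂ)} (hf : spl f) (hk : spl k) : spl (f * k) := by
  obtain ⟨q, hq, hf⟩ := hf
  obtain ⟨r, hr, hk⟩ := hk
  refine ⟨q * r, mul_ne_zero hq hr, ?_⟩
  rw [Polynomial.map_mul]
  refine Polynomial.Splits.mul ?_ (spl.mono_left hk q hq)
  have := spl.mono_left hf r hr
  convert this using 4
  exact mul_comm _ _

theorem spl.of_taylor {P : Polynomial (PowerSeries ℂ)} {a : PowerSeries ℂ}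
    (h : spl (Polynomial.taylor a P)) : spl P := by
  obtain ⟨q, hq, h⟩ := h
  refine ⟨q, hq, ?_⟩
  rw [Polynomial.map_taylor] at h
  have := h.taylor (-((PowerSeries.expand q hq : PowerSeries ℂ →ₐ[ℂ] PowerSeries ℂ).toRingHom a))
  rwa [Polynomial.taylor_taylor, neg_add_cancel, Polynomial.taylor_zero] at this

theorem puiseux (n : ℕ) : ∀ P : Polynomial (PowerSeries ℂ), P.Monic → P.natDegree < n → spl P := by
  induction n with
  | zero => intro P _ h; omega
  | succ n ih =>
    intro P₀ hP₀ hn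
    classical
    by_cases hd : P₀.natDegree = 0
    · refine ⟨1, one_ne_zero, Polynomial.Splits.map ?_ _⟩
      exact Polynomial.Splits.of_natDegree_eq_zero hd
    set d := P₀.natDegree with hddef
    have hdC : (d : ℂ) ≠ 0 := by exact_mod_cast hd
    -- Tschirnhaus
    apply spl.of_taylor (a := -(PowerSeries.C (d : ℂ)⁻¹ * P₀.coeff (d - 1)))
    set P := Polynomial.taylor (-(PowerSeries.C (d : ℂ)⁻¹ * P₀.coeff (d - 1))) P₀ with hPdef
    have hPd : P.natDegree = d := Polynomial.natDegree_taylor _ _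
    have hP : P.Monic := by
      rw [Polynomial.Monic, hPdef, Polynomial.leadingCoeff_taylor]; exact hP₀
    have hPd1 : P.coeff (d - 1) = 0 := by
      rw [hPdef, hddef, taylor_coeff_pred P₀ hP₀ _ (Nat.pos_of_ne_zero hd), ← hddef]
      have : (d : PowerSeries ℂ) * PowerSeries.C (d : ℂ)⁻¹ = 1 := by
        rw [show (d : PowerSeries ℂ) = PowerSeries.C (d : ℂ) by simp, ← map_mul, mul_inv_cancel₀ hdC, map_one]
      linear_combination (- P₀.coeff (d - 1)) * this
    clear_value P
    by_cases hX : ∀ j < d, P.coeff j = 0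
    · have : P = Polynomial.X ^ d := by
        ext1 j
        rw [Polynomial.coeff_X_pow]
        split_ifs with h
        · subst h; rw [← hPd]; exact hP.coeff_natDegree
        · rcases lt_or_gt_of_ne h with h | h
          · exact hX j h
          · exact Polynomial.coeff_eq_zero_of_natDegree_lt (by omega)
      rw [this]
      exact ⟨1, one_ne_zero, (Polynomial.Splits.X_pow d).map _⟩
    push Not at hX
    -- minimal slope
    obtain ⟨j, hjmem, hjmin⟩ := Finset.exists_min_image
      ((Finset.range d).filter fun j => P.coeff j ≠ 0)
      (fun j => ((P.coeff j).order.toNat : ℚ) / ((d - j : ℕ) : ℚ)) (by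
        obtain ⟨j, h1, h2⟩ := hX
        exact ⟨j, by simp [h1, h2]⟩)
    simp only [Finset.mem_filter, Finset.mem_range] at hjmem hjmin
    obtain ⟨hjd, hj0⟩ := hjmem
    set o := (P.coeff j).order.toNat with ho
    have hm : d - j ≠ 0 := by omega
    have hordj : (P.coeff j).order = (o : ℕ∞) := by
      rw [ho, order_coe_toNat hj0]
    let E := (PowerSeries.expand (d - j) hm : PowerSeries ℂ →ₐ[ℂ] PowerSeries ℂ).toRingHom
    have hE : ∀ a, E a = PowerSeries.expand (d - j) hm a := fun a => rfl
    have hb : ∀ i, ∃ b, i < d → E (P.coeff i) = b * (PowerSeries.X ^ o) ^ (d - i) := by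
      intro i
      by_cases hid : i < d
      swap
      · exact ⟨0, fun h => absurd h hid⟩
      by_cases hi0 : P.coeff i = 0
      · exact ⟨0, fun _ => by rw [hi0]; simp⟩
      have h1 := hjmin i ⟨hid, hi0⟩
      rw [div_le_div_iff₀ (by exact_mod_cast Nat.pos_of_ne_zero hm)
        (by exact_mod_cast (by omega : 0 < d - i))] at h1
      have h1 : o * (d - i) ≤ (P.coeff i).order.toNat * (d - j) := by exact_mod_cast h1
      have h2 : PowerSeries.X ^ (o * (d - i)) ∣ E (P.coeff i) := by
        rw [PowerSeries.X_pow_dvd_iff]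
        intro m hmlt
        apply PowerSeries.coeff_of_lt_order
        rw [hE, PowerSeries.order_expand]
        have : (P.coeff i).order = ((P.coeff i).order.toNat : ℕ∞) := by
          rw [order_coe_toNat hi0]
        rw [this, nsmul_eq_mul]
        have : m < (d - j) * (P.coeff i).order.toNat := by rw [mul_comm (d - j)]; omega
        exact_mod_cast this
      obtain ⟨b, hb⟩ := h2
      exact ⟨b, fun _ => by rw [hb, ← pow_mul, mul_comm]⟩
    choose b hb using hb
    let P' : Polynomial (PowerSeries ℂ) :=
      Polynomial.X ^ d + ∑ i ∈ Finset.range d, Polynomial.monomial i (b i)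
    have hdeglt : (∑ i ∈ Finset.range d, Polynomial.monomial i (b i)).degree < d := by
      refine lt_of_le_of_lt (Polynomial.degree_sum_le _ _) ?_
      rw [Finset.sup_lt_iff (by exact WithBot.bot_lt_coe d)]
      intro i hi
      exact lt_of_le_of_lt (Polynomial.degree_monomial_le _ _) (by exact_mod_cast Finset.mem_range.1 hi)
    have hP' : P'.Monic := Polynomial.monic_X_pow_add hdeglt
    have hP'd : P'.natDegree = d := Polynomial.natDegree_eq_of_degree_eq_some (by
      show (Polynomial.X ^ d + _ : Polynomial (PowerSeries ℂ)).degree = _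
      rw [Polynomial.degree_add_eq_left_of_degree_lt] <;> simp [hdeglt])
    have hP'c : ∀ i < d, P'.coeff i = b i := by
      intro i hi
      simp only [P', Polynomial.coeff_add, Polynomial.coeff_X_pow, Polynomial.finsetSum_coeff,
        Polynomial.coeff_monomial]
      simp [hi, hi.ne]
    have hscale : P'.scaleRoots (PowerSeries.X ^ o) = P.map E := by
      ext1 i
      rw [Polynomial.coeff_scaleRoots, hP'd, Polynomial.coeff_map]
      rcases lt_trichotomy i d with h | h | h
      · rw [hP'c i h, hb i h]
      · subst h
        have h1 : P'.coeff d = 1 := by rw [← hP'd]; exact hP'.coeff_natDegree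
        have h2 : P.coeff d = 1 := by rw [← hPd]; exact hP.coeff_natDegree
        rw [h1, h2]; simp
      · rw [Polynomial.coeff_eq_zero_of_natDegree_lt (by omega),
          Polynomial.coeff_eq_zero_of_natDegree_lt (p := P) (by omega)]; simp
    suffices hsplP' : spl P' by
      apply spl.of_expand (q := d - j) (hq := hm)
      show spl (P.map E)
      rw [← hscale]
      obtain ⟨q, hq, h⟩ := hsplP'
      refine ⟨q, hq, ?_⟩
      rw [Polynomial.map_scaleRoots _ _ _ (by rw [hP'.leadingCoeff]; simp)]
      exact h.scaleRoots _
    -- coefficients of P'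
    have hbj : PowerSeries.constantCoeff (P'.coeff j) ≠ 0 := by
      rw [hP'c j hjd]
      intro h
      have h1 := hb j hjd
      have h2 : PowerSeries.X ∣ b j := PowerSeries.X_dvd_iff.2 h
      obtain ⟨c, hc⟩ := h2
      have h3 : PowerSeries.coeff ((d - j) * o) (E (P.coeff j)) = 0 := by
        rw [h1, hc, ← pow_mul, mul_comm o, PowerSeries.coeff_mul_X_pow']
        simp
      rw [hE, PowerSeries.coeff_expand_mul] at h3
      exact PowerSeries.coeff_order hj0 (by rw [← ho]; exact h3)
    have hbd : P'.coeff (d - 1) = 0 := by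
      have hd1 : d - 1 < d := by omega
      have := hb (d - 1) hd1
      rw [hPd1, map_zero] at this
      rw [hP'c _ hd1]
      exact (mul_eq_zero.1 this.symm).resolve_right
        (pow_ne_zero _ (pow_ne_zero _ PowerSeries.X_ne_zero))
    let κ : PowerSeries ℂ →+* ℂ := PowerSeries.constantCoeff
    have hbar : (P'.map κ).natDegree = d := by rw [hP'.natDegree_map, hP'd]
    obtain ⟨r, hr⟩ := IsAlgClosed.exists_root (P'.map κ) (by
      intro h
      have := Polynomial.natDegree_eq_zero_iff_degree_le_zero.2 h.le
      omega)
    apply spl.of_taylor (a := PowerSeries.C r)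
    have htm : (Polynomial.taylor (PowerSeries.C r) P').Monic := by
      rw [Polynomial.Monic, Polynomial.leadingCoeff_taylor]; exact hP'
    have htd : (Polynomial.taylor (PowerSeries.C r) P').natDegree = d := by
      rw [Polynomial.natDegree_taylor, hP'd]
    have hmap : (Polynomial.taylor (PowerSeries.C r) P').map κ = Polynomial.taylor r (P'.map κ) := by
      rw [Polynomial.map_taylor]; simp [κ]
    have hc : ∀ i, PowerSeries.constantCoeff ((Polynomial.taylor (PowerSeries.C r) P').coeff i) =
        (Polynomial.taylor r (P'.map κ)).coeff i := by
      intro i; rw [← hmap, Polynomial.coeff_map]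
    have hex : ∃ i < d, PowerSeries.constantCoeff ((Polynomial.taylor (PowerSeries.C r) P').coeff i) ≠ 0 := by
      by_contra hcon
      push Not at hcon
      have h1 := hcon (d - 1) (by omega)
      rw [hc] at h1
      have h2 := taylor_coeff_pred (P'.map κ) (hP'.map κ) r (by omega)
      rw [hbar, h1, Polynomial.coeff_map, hbd, map_zero, zero_add] at h2
      have hr0 : r = 0 := (mul_eq_zero.1 h2.symm).resolve_left hdC
      have h3 := hcon j hjd
      rw [hc, hr0, Polynomial.taylor_zero, Polynomial.coeff_map] at h3
      exact hbj h3
    obtain ⟨i, hid, hi⟩ := hex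
    obtain ⟨f, k, hf, hk, hfk, hfd, hkd⟩ := hensel_factor _ htm (by
      rw [hc, Polynomial.taylor_coeff_zero]; exact hr) i (by omega) hi
    rw [hfk]
    exact (ih f hf (by omega)).mul (ih k hk (by omega))

end Sch

namespace Sch

def Good {k : Type*} [Field k] (e m : ℕ) (P : Polynomial (PowerSeries k)) : Prop :=
  (∀ n i, PowerSeries.coeff i (P.coeff n) ≠ 0 → e ≤ i ∧ e + m ≤ i + n) ∧
    PowerSeries.coeff e (P.coeff m) ≠ 0

section
variable {k : Type*} [Field k]

theorem coeff2_mul (P Q : Polynomial (PowerSeries k)) (n i : ℕ) :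
    PowerSeries.coeff i ((P * Q).coeff n) = ∑ a ∈ Finset.HasAntidiagonal.antidiagonal n, ∑ b ∈ Finset.HasAntidiagonal.antidiagonal i,
      PowerSeries.coeff b.1 (P.coeff a.1) * PowerSeries.coeff b.2 (Q.coeff a.2) := by
  rw [Polynomial.coeff_mul, map_sum]
  refine Finset.sum_congr rfl fun a _ => ?_
  rw [PowerSeries.coeff_mul]

theorem Good.mul {e m e' m' : ℕ} {P Q : Polynomial (PowerSeries k)} (hP : Good e m P)
    (hQ : Good e' m' Q) : Good (e + e') (m + m') (P * Q) := by
  constructor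
  · intro n i h
    rw [coeff2_mul] at h
    obtain ⟨a, ha, h⟩ := Finset.exists_ne_zero_of_sum_ne_zero h
    obtain ⟨b, hb, h⟩ := Finset.exists_ne_zero_of_sum_ne_zero h
    have h1 := hP.1 _ _ (left_ne_zero_of_mul h)
    have h2 := hQ.1 _ _ (right_ne_zero_of_mul h)
    rw [Finset.HasAntidiagonal.mem_antidiagonal] at ha hb
    omega
  · rw [coeff2_mul, Finset.sum_eq_single (m, m')]
    · rw [Finset.sum_eq_single (e, e')]
      · exact mul_ne_zero hP.2 hQ.2
      · intro b hb hne
        by_contra h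
        have h1 := hP.1 _ _ (left_ne_zero_of_mul h)
        have h2 := hQ.1 _ _ (right_ne_zero_of_mul h)
        rw [Finset.HasAntidiagonal.mem_antidiagonal] at hb
        exact hne (Prod.ext (by simp only; omega) (by simp only; omega))
      · intro h; exact (h (by rw [Finset.HasAntidiagonal.mem_antidiagonal])).elim
    · intro a ha hne
      by_contra h
      obtain ⟨b, hb, h⟩ := Finset.exists_ne_zero_of_sum_ne_zero h
      have h1 := hP.1 _ _ (left_ne_zero_of_mul h)
      have h2 := hQ.1 _ _ (right_ne_zero_of_mul h)
      rw [Finset.HasAntidiagonal.mem_antidiagonal] at ha hb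
      exact hne (Prod.ext (by simp only; omega) (by simp only; omega))
    · intro h; exact (h (by rw [Finset.HasAntidiagonal.mem_antidiagonal])).elim

theorem exists_ord (a : PowerSeries k) (ha : a ≠ 0) :
    ∃ e, PowerSeries.coeff e a ≠ 0 ∧ ∀ i, PowerSeries.coeff i a ≠ 0 → e ≤ i := by
  refine ⟨a.order.toNat, PowerSeries.coeff_order ha, fun i hi => ?_⟩
  have := PowerSeries.order_le i hi
  exact ENat.toNat_le_of_le_natCast this

theorem good_of_linear (P : Polynomial (PowerSeries k)) (hP : P ≠ 0) (hd : P.natDegree ≤ 1) :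
    ∃ e m, Good e m P := by
  have hn : ∀ n, 2 ≤ n → P.coeff n = 0 := fun n hn =>
    Polynomial.coeff_eq_zero_of_natDegree_lt (by omega)
  have hcase : ∀ n i, PowerSeries.coeff i (P.coeff n) ≠ 0 → n = 0 ∨ n = 1 := by
    intro n i h
    by_contra hcon
    rw [hn n (by omega)] at h
    simp at h
  by_cases h1 : P.coeff 1 = 0
  · have h0 : P.coeff 0 ≠ 0 := by
      intro h0
      apply hP
      ext1 n
      rcases n with _ | _ | n
      · simpa using h0
      · simpa using h1
      · simpa using hn (n + 2) (by omega)
    obtain ⟨e, he, hmin⟩ := exists_ord _ h0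
    refine ⟨e, 0, fun n i h => ?_, he⟩
    rcases hcase n i h with rfl | rfl
    · have := hmin _ h; omega
    · rw [h1] at h; simp at h
  · obtain ⟨e1, he1, hmin1⟩ := exists_ord _ h1
    by_cases h0 : P.coeff 0 = 0
    · refine ⟨e1, 1, fun n i h => ?_, he1⟩
      rcases hcase n i h with rfl | rfl
      · rw [h0] at h; simp at h
      · have := hmin1 _ h; omega
    · obtain ⟨e0, he0, hmin0⟩ := exists_ord _ h0
      by_cases hlt : e1 < e0
      · refine ⟨e1, 1, fun n i h => ?_, he1⟩
        rcases hcase n i h with rfl | rfl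
        · have := hmin0 _ h; omega
        · have := hmin1 _ h; omega
      · refine ⟨e0, 0, fun n i h => ?_, he0⟩
        rcases hcase n i h with rfl | rfl
        · have := hmin0 _ h; omega
        · have := hmin1 _ h; omega

theorem Good.of_C_mul {e m : ℕ} {P : Polynomial (PowerSeries k)} {c : PowerSeries k} (hc : c ≠ 0)
    (h : Good e m (Polynomial.C c * P)) : ∃ e', Good e' m P := by
  obtain ⟨f, hf, hfm⟩ := exists_ord c hc
  obtain ⟨c', hc'⟩ : PowerSeries.X ^ f ∣ c := by
    rw [PowerSeries.X_pow_dvd_iff]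
    intro i hi
    by_contra h
    have := hfm i h
    omega
  have hu : PowerSeries.constantCoeff c' ≠ 0 := by
    rw [hc', mul_comm, PowerSeries.coeff_mul_X_pow'] at hf
    simpa using hf
  have hinv : c' * c'⁻¹ = 1 := PowerSeries.mul_inv_cancel _ hu
  have hgi : Good 0 0 (Polynomial.C (c'⁻¹)) := by
    refine ⟨fun n i _ => ⟨by omega, by omega⟩, ?_⟩
    simp [hu]
  have h2 := hgi.mul h
  have e1 : Polynomial.C (c'⁻¹) * (Polynomial.C c * P) = Polynomial.C (PowerSeries.X ^ f) * P := by
    rw [← mul_assoc, ← Polynomial.C_mul, hc']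
    congr 2
    linear_combination (PowerSeries.X ^ f) * hinv
  rw [e1, zero_add, zero_add] at h2
  have hco : ∀ n i, PowerSeries.coeff (i + f) ((Polynomial.C (PowerSeries.X ^ f) * P).coeff n) =
      PowerSeries.coeff i (P.coeff n) := by
    intro n i
    rw [Polynomial.coeff_C_mul, mul_comm, PowerSeries.coeff_mul_X_pow]
  have hfe : f ≤ e := by
    have := h2.2
    rw [Polynomial.coeff_C_mul, mul_comm, PowerSeries.coeff_mul_X_pow'] at this
    by_contra hcon
    rw [if_neg hcon] at this
    exact this rfl
  refine ⟨e - f, fun n i h => ?_, ?_⟩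
  · rw [← hco] at h
    have := h2.1 _ _ h
    omega
  · rw [← hco, Nat.sub_add_cancel hfe]; exact h2.2

theorem good_comp_of_splits (Q h : Polynomial (PowerSeries k)) (hQ : Q.Splits) (hd : h.natDegree ≤ 1)
    (hne : Q.comp h ≠ 0) : ∃ e m, Good e m (Q.comp h) := by
  revert hne
  refine Submonoid.closure_induction (motive := fun Q _ => Q.comp h ≠ 0 → ∃ e m, Good e m (Q.comp h))
    ?_ ?_ ?_ hQ
  · rintro x (⟨a, rfl⟩ | ⟨a, rfl⟩) hne
    · rw [Polynomial.C_comp] at hne ⊢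
      exact good_of_linear _ hne (by simp)
    · refine good_of_linear _ hne ?_
      simpa using hd
  · intro hne
    exact good_of_linear _ hne (by simp)
  · intro x y _ _ hx hy hne
    rw [Polynomial.mul_comp] at hne ⊢
    obtain ⟨e, m, h1⟩ := hx (left_ne_zero_of_mul hne)
    obtain ⟨e', m', h2⟩ := hy (right_ne_zero_of_mul hne)
    exact ⟨_, _, h1.mul h2⟩
end

abbrev ex (q : ℕ) (hq : q ≠ 0) : PowerSeries ℂ →+* PowerSeries ℂ :=
  (PowerSeries.expand q hq : PowerSeries ℂ →ₐ[ℂ] PowerSeries ℂ).toRingHom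

theorem ex_inj (q : ℕ) (hq : q ≠ 0) : Function.Injective (ex q hq) := by
  intro a b h
  ext i
  have := congrArg (PowerSeries.coeff (q * i)) h
  simpa [ex, PowerSeries.coeff_expand_mul] using this

theorem good_of_puiseux (G : Polynomial (PowerSeries ℂ)) (hG : G ≠ 0) :
    ∃ q, ∃ hq : q ≠ 0, ∀ r, ∀ hr : r ≠ 0, ∀ h : Polynomial (PowerSeries ℂ), h.natDegree ≤ 1 →
      (G.map (ex (r * q) (mul_ne_zero hr hq))).comp h ≠ 0 →
      ∃ e m, Good e m ((G.map (ex (r * q) (mul_ne_zero hr hq))).comp h) := by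
  obtain ⟨q, hq, hs⟩ := puiseux _ G.integralNormalization (Polynomial.monic_integralNormalization hG)
    (Nat.lt_succ_self _)
  refine ⟨q, hq, fun r hr h hd hne => ?_⟩
  have hs := spl.mono_left hs r hr
  set E := ex (r * q) (mul_ne_zero hr hq) with hE
  change (G.integralNormalization.map E).Splits at hs
  have hl : E G.leadingCoeff ≠ 0 := by
    rw [Ne, map_eq_zero_iff _ (ex_inj _ _)]; exact Polynomial.leadingCoeff_ne_zero.2 hG
  have e1 : Polynomial.C (E G.leadingCoeff) * G.integralNormalization.map E =
      (G.map E).scaleRoots (E G.leadingCoeff) := by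
    rw [← Polynomial.map_scaleRoots _ _ _ hl, ← Polynomial.leadingCoeff_smul_integralNormalization,
      Polynomial.smul_eq_C_mul, Polynomial.map_mul, Polynomial.map_C]
  have hs2 := hs.C_mul (E G.leadingCoeff)
  rw [e1] at hs2
  have e2 : ((G.map E).scaleRoots (E G.leadingCoeff)).comp (Polynomial.C (E G.leadingCoeff) * h) =
      Polynomial.C (E G.leadingCoeff ^ (G.map E).natDegree) * (G.map E).comp h := by
    have := Polynomial.scaleRoots_eval₂_mul (p := G.map E) Polynomial.C h (E G.leadingCoeff)
    rw [Polynomial.C_pow]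
    exact this
  have hc : E G.leadingCoeff ^ (G.map E).natDegree ≠ 0 := pow_ne_zero _ hl
  obtain ⟨e, m, hg⟩ := good_comp_of_splits _ (Polynomial.C (E G.leadingCoeff) * h) hs2
    ((Polynomial.natDegree_C_mul_le _ _).trans hd) (by
      rw [e2]; exact mul_ne_zero (Polynomial.C_ne_zero.2 hc) hne)
  rw [e2] at hg
  obtain ⟨e', h'⟩ := hg.of_C_mul hc
  exact ⟨e', m, h'⟩

end Sch

namespace Sch

def ev2 {L : Type*} [CommRing L] (ι : ℝ →+* L) (u v : L) : Polynomial (Polynomial ℝ) →+* L :=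
  Polynomial.eval₂RingHom (Polynomial.eval₂RingHom ι u) v

theorem ev2_map {L L' : Type*} [CommRing L] [CommRing L'] (ψ : L →+* L') (ι : ℝ →+* L) (u v : L)
    (H : Polynomial (Polynomial ℝ)) : ψ (ev2 ι u v H) = ev2 (ψ.comp ι) (ψ u) (ψ v) H := by
  simp only [ev2, Polynomial.coe_eval₂RingHom]
  rw [Polynomial.hom_eval₂]
  congr 1
  ext a
  · simp
  · simp

theorem ev2_eq_sum {L : Type*} [CommRing L] (ι : ℝ →+* L) (u v : L)
    (H : Polynomial (Polynomial ℝ)) : ev2 ι u v H =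
      ∑ x ∈ H.support.sigma (fun n => (H.coeff n).support),
        ι ((H.coeff x.1).coeff x.2) * u ^ x.2 * v ^ x.1 := by
  rw [Finset.sum_sigma]
  simp only [ev2, Polynomial.coe_eval₂RingHom]
  rw [Polynomial.eval₂_eq_sum, Polynomial.sum_def]
  refine Finset.sum_congr rfl fun n _ => ?_
  rw [Polynomial.coe_eval₂RingHom, Polynomial.eval₂_eq_sum, Polynomial.sum_def, Finset.sum_mul]

def RGood (e m : ℕ) (H : Polynomial (Polynomial ℝ)) : Prop :=
  (∀ n i, (H.coeff n).coeff i ≠ 0 → e ≤ i ∧ e + m ≤ i + n) ∧ (H.coeff m).coeff e ≠ 0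

section ordered
variable {F : Type*} [Field F] [LinearOrder F] [IsStrictOrderedRing F]

theorem iota_nonneg (ι : ℝ →+* F) {r : ℝ} (h : 0 ≤ r) : 0 ≤ ι r := by
  rw [← Real.sq_sqrt h, map_pow]; positivity

theorem iota_mono (ι : ℝ →+* F) {r s : ℝ} (h : r ≤ s) : ι r ≤ ι s := by
  have := iota_nonneg ι (sub_nonneg.2 h)
  rw [map_sub] at this; linarith

theorem iota_lt (ι : ℝ →+* F) {r s : ℝ} (h : r < s) : ι r < ι s :=
  lt_of_le_of_ne (iota_mono ι h.le) (fun e => h.ne (ι.injective e))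

theorem iota_le_iff (ι : ℝ →+* F) {r s : ℝ} : ι r ≤ ι s ↔ r ≤ s :=
  ⟨fun h => by by_contra hc; exact absurd (iota_lt ι (not_le.1 hc)) (not_lt.2 h), iota_mono ι⟩

theorem iota_abs (ι : ℝ →+* F) (r : ℝ) : |ι r| = ι |r| := by
  rcases le_total 0 r with h | h
  · rw [abs_of_nonneg h, abs_of_nonneg (iota_nonneg ι h)]
  · have : ι r ≤ 0 := by simpa using iota_mono ι h
    rw [abs_of_nonpos h, abs_of_nonpos this, map_neg]

theorem mono_bound {w y d : F} (hw : 0 < w) (hwd : w ≤ d) (hd : d ≤ 1) (hy : 0 ≤ y) (hyd : y ≤ d)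
    {e m i n : ℕ} (hm : m = 0 ∨ w ≤ d * y) (h1 : e ≤ i) (h2 : e + m ≤ i + n)
    (hne : ¬ (i = e ∧ n = m)) : w ^ i * y ^ n ≤ d * (w ^ e * y ^ m) := by
  have hd0 : 0 < d := hw.trans_le hwd
  have hw1 : w ≤ 1 := hwd.trans hd
  have hy1 : y ≤ 1 := hyd.trans hd
  rcases lt_or_ge m n with hmn | hmn
  · obtain ⟨j, rfl⟩ := Nat.exists_eq_add_of_lt hmn
    have a1 : w ^ i ≤ w ^ e := pow_le_pow_of_le_one hw.le hw1 h1
    have a2 : y ^ (m + j + 1) ≤ d * y ^ m := by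
      have : y ^ (m + j + 1) ≤ y ^ (m + 1) := pow_le_pow_of_le_one hy hy1 (by omega)
      refine this.trans ?_
      rw [pow_succ, mul_comm]
      exact mul_le_mul_of_nonneg_right hyd (by positivity)
    calc w ^ i * y ^ (m + j + 1) ≤ w ^ e * (d * y ^ m) := mul_le_mul a1 a2 (by positivity) (by positivity)
      _ = _ := by ring
  · obtain ⟨j, rfl⟩ := Nat.exists_eq_add_of_le hmn
    rcases Nat.eq_zero_or_pos j with rfl | hj
    · have : w ^ i ≤ w ^ (e + 1) := pow_le_pow_of_le_one hw.le hw1 (by omega)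
      have a2 : w ^ (e + 1) ≤ d * w ^ e := by
        rw [pow_succ, mul_comm]
        exact mul_le_mul_of_nonneg_right hwd (by positivity)
      calc w ^ i * y ^ n ≤ (d * w ^ e) * y ^ n := mul_le_mul_of_nonneg_right (this.trans a2) (by positivity)
        _ = _ := by ring
    · have hwy : w ≤ d * y := hm.resolve_left (by omega)
      have : w ^ i ≤ w ^ (e + j) := pow_le_pow_of_le_one hw.le hw1 (by omega)
      have a2 : w ^ j ≤ d * y ^ j := by
        calc w ^ j ≤ (d * y) ^ j := pow_le_pow_left₀ hw.le hwy _
          _ = d ^ j * y ^ j := mul_pow _ _ _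
          _ ≤ d * y ^ j := mul_le_mul_of_nonneg_right (pow_le_of_le_one hd0.le hd (by omega)) (by positivity)
      calc w ^ i * y ^ n ≤ (w ^ e * (d * y ^ j)) * y ^ n := by
            refine mul_le_mul_of_nonneg_right (this.trans ?_) (by positivity)
            rw [pow_add]; exact mul_le_mul_of_nonneg_left a2 (by positivity)
        _ = _ := by ring
end ordered

theorem sign_lemma {e m : ℕ} {H : Polynomial (Polynomial ℝ)} (hH : RGood e m H) :
    ∃ δ : ℝ, 0 < δ ∧ ∀ (F : Type) [Field F] [LinearOrder F] [IsStrictOrderedRing F] (ι : ℝ →+* F)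
      (w y : F), 0 < w → w ≤ ι δ → |y| ≤ ι δ → (m = 0 ∨ w ≤ ι δ * |y|) →
      |ev2 ι w y H - ι ((H.coeff m).coeff e) * w ^ e * y ^ m| ≤
        ι (|(H.coeff m).coeff e| / 2) * (w ^ e * |y| ^ m) := by
  set c := (H.coeff m).coeff e with hc
  set S := H.support.sigma (fun n => (H.coeff n).support) with hS
  set B : ℝ := ∑ x ∈ S, |(H.coeff x.1).coeff x.2| with hB
  have hB0 : 0 ≤ B := Finset.sum_nonneg fun _ _ => abs_nonneg _
  have hc0 : 0 < |c| := abs_pos.2 hH.2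
  refine ⟨min 1 (|c| / (2 * (1 + B))), by positivity, ?_⟩
  intro F _ _ _ ι w y hw hwd hyd hm
  set δ := min 1 (|c| / (2 * (1 + B))) with hδ
  have hδ0 : 0 < δ := by positivity
  have hδ1 : ι δ ≤ 1 := by simpa using iota_mono ι (min_le_left 1 _ : δ ≤ 1)
  have hmem : (⟨m, e⟩ : Σ _ : ℕ, ℕ) ∈ S := by
    rw [hS, Finset.mem_sigma]
    refine ⟨?_, Polynomial.mem_support_iff.2 hH.2⟩
    rw [Polynomial.mem_support_iff]
    intro h0
    apply hH.2
    simp [h0]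
  rw [ev2_eq_sum, ← hS, ← Finset.add_sum_erase S _ hmem]
  simp only
  rw [← hc, add_sub_cancel_left]
  refine (Finset.abs_sum_le_sum_abs _ _).trans ?_
  have key : ∀ x ∈ S.erase ⟨m, e⟩, |ι ((H.coeff x.1).coeff x.2) * w ^ x.2 * y ^ x.1| ≤
      ι |(H.coeff x.1).coeff x.2| * (ι δ * (w ^ e * |y| ^ m)) := by
    intro x hx
    rw [Finset.mem_erase] at hx
    rw [abs_mul, abs_mul, iota_abs, abs_pow, abs_pow, abs_of_pos hw, mul_assoc]
    refine mul_le_mul_of_nonneg_left ?_ (iota_nonneg ι (abs_nonneg _))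
    have hx2 : (H.coeff x.1).coeff x.2 ≠ 0 := by
      have := (Finset.mem_sigma.1 hx.2).2
      exact Polynomial.mem_support_iff.1 this
    have := hH.1 _ _ hx2
    refine mono_bound hw hwd hδ1 (abs_nonneg _) hyd hm this.1 this.2 ?_
    rintro ⟨h1, h2⟩
    apply hx.1
    rcases x with ⟨a, b⟩
    simp only at h1 h2
    subst h1 h2
    rfl
  refine (Finset.sum_le_sum key).trans ?_
  rw [← Finset.sum_mul, ← mul_assoc]
  refine mul_le_mul_of_nonneg_right ?_ (by positivity)
  rw [← map_sum, ← map_mul]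
  apply iota_mono
  have : ∑ x ∈ S.erase ⟨m, e⟩, |(H.coeff x.1).coeff x.2| ≤ B :=
    Finset.sum_le_sum_of_subset_of_nonneg (Finset.erase_subset _ _) fun _ _ _ => abs_nonneg _
  have hδ2 : δ ≤ |c| / (2 * (1 + B)) := min_le_right _ _
  rw [le_div_iff₀ (by positivity)] at hδ2
  nlinarith

theorem sign_lemma' {e m : ℕ} {H : Polynomial (Polynomial ℝ)} (hH : RGood e m H) :
    ∃ δ : ℝ, 0 < δ ∧ ∀ (F : Type) [Field F] [LinearOrder F] [IsStrictOrderedRing F] (ι : ℝ →+* F)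
      (w y : F) (s : ℝ), 0 < w → w ≤ ι δ → |y| ≤ ι δ → (m = 0 ∨ w ≤ ι δ * |y|) →
      (m = 0 ∨ y = ι s * |y|) →
      (0 ≤ ev2 ι w y H ↔ 0 ≤ ((H.coeff m).coeff e) * s ^ m) := by
  obtain ⟨δ, hδ, h⟩ := sign_lemma hH
  refine ⟨δ, hδ, ?_⟩
  intro F _ _ _ ι w y s hw hwd hyd hm hs
  have key := h F ι w y hw hwd hyd hm
  set c := (H.coeff m).coeff e with hc
  have hδF : 0 < ι δ := by simpa using iota_lt ι hδ
  have hpos : 0 < w ^ e * |y| ^ m := by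
    rcases hm with rfl | hm
    · simpa using pow_pos hw e
    · have : 0 < |y| := by
        by_contra hcon
        have h0 : |y| = 0 := le_antisymm (not_lt.1 hcon) (abs_nonneg _)
        rw [h0, mul_zero] at hm
        exact absurd hw (not_lt.2 hm)
      positivity
  have hym : y ^ m = ι (s ^ m) * |y| ^ m := by
    rcases hs with rfl | hs
    · simp
    · conv_lhs => rw [hs]
      rw [mul_pow, map_pow]
  have hs1 : |ι s ^ m| = 1 := by
    rcases hs with rfl | hs
    · simp
    · rcases hm with rfl | hm
      · simp
      · have : |y| ≠ 0 := by
          intro h0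
          rw [h0, mul_zero] at hm
          exact absurd hw (not_lt.2 hm)
        have h2 : |y| = |ι s| * |y| := by
          conv_lhs => rw [hs]
          rw [abs_mul, abs_abs]
        have h3 : |ι s| = 1 := by
          have : (|ι s| - 1) * |y| = 0 := by linear_combination -h2
          rcases mul_eq_zero.1 this with h | h
          · linear_combination h
          · contradiction
        rw [abs_pow, h3, one_pow]
  have habs : ι |c| = |ι (c * s ^ m)| := by
    rw [map_mul, map_pow, abs_mul, hs1, mul_one, iota_abs]
  have e1 : ι c * w ^ e * y ^ m = ι (c * s ^ m) * (w ^ e * |y| ^ m) := by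
    rw [hym, map_mul]; ring
  have e2 : ι (|c| / 2) = |ι (c * s ^ m)| / 2 := by
    rw [← habs, map_div₀, map_ofNat]
  rw [e1, e2, abs_le] at key
  rw [← iota_le_iff ι, map_zero]
  have hcne : ι (c * s ^ m) ≠ 0 := by
    intro h0
    rw [h0, abs_zero, map_eq_zero, abs_eq_zero] at habs
    exact hH.2 habs
  constructor
  · intro h0
    by_contra hneg
    rw [not_le] at hneg
    rw [abs_of_neg hneg] at key
    nlinarith [mul_pos_of_neg_of_neg hneg (neg_neg_of_pos hpos)]
  · intro h0
    rw [abs_of_nonneg h0] at key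
    nlinarith [mul_nonneg h0 hpos.le]

end Sch

namespace Sch

/-- substitution `X ↦ w^q`, `Y ↦ S(w) + w^k Y` -/
def Hh (G : Polynomial (Polynomial ℝ)) (q k : ℕ) (S : Polynomial ℝ) : Polynomial (Polynomial ℝ) :=
  (G.map (Polynomial.expand ℝ q : Polynomial ℝ →ₐ[ℝ] Polynomial ℝ).toRingHom).comp
    (Polynomial.C S + Polynomial.C (Polynomial.X ^ k) * Polynomial.X)

theorem ev2_Hh {L : Type*} [CommRing L] (ι : ℝ →+* L) (w y : L) (G : Polynomial (Polynomial ℝ))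
    (q k : ℕ) (S : Polynomial ℝ) : ev2 ι w y (Hh G q k S) =
      ev2 ι (w ^ q) (S.eval₂ ι w + w ^ k * y) G := by
  simp only [ev2, Hh, Polynomial.coe_eval₂RingHom]
  rw [Polynomial.eval₂_comp, Polynomial.eval₂_map]
  congr 1
  · ext a
    · simp
    · simp [Polynomial.expand_X]
  · simp only [Polynomial.eval₂_add, Polynomial.eval₂_mul, Polynomial.eval₂_C, Polynomial.eval₂_X,
      Polynomial.coe_eval₂RingHom, Polynomial.eval₂_X_pow]

def jC : Polynomial ℝ →+* PowerSeries ℂ :=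
  (Polynomial.coeToPowerSeries.ringHom).comp (Polynomial.mapRingHom Complex.ofRealHom)

theorem coeff_jC (p : Polynomial ℝ) (i : ℕ) : PowerSeries.coeff i (jC p) = (p.coeff i : ℂ) := by
  simp [jC]

theorem jC_inj : Function.Injective jC := by
  intro a b h
  ext i
  have := congrArg (PowerSeries.coeff i) h
  simpa [coeff_jC] using this

theorem rgood_of_good {e m : ℕ} {H : Polynomial (Polynomial ℝ)} (h : Good e m (H.map jC)) :
    RGood e m H := by
  constructor
  · intro n i hn
    apply h.1
    rw [Polynomial.coeff_map, coeff_jC]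
    exact_mod_cast hn
  · have := h.2
    rw [Polynomial.coeff_map, coeff_jC] at this
    exact_mod_cast this

theorem Hh_map (G : Polynomial (Polynomial ℝ)) (q : ℕ) (hq : q ≠ 0) (k : ℕ) (S : Polynomial ℝ) :
    (Hh G q k S).map jC = ((G.map jC).map (ex q hq)).comp
      (Polynomial.C (jC S) + Polynomial.C (jC (Polynomial.X ^ k)) * Polynomial.X) := by
  rw [Hh, Polynomial.map_comp, Polynomial.map_map, Polynomial.map_map]
  congr 1
  · congr 1
    refine RingHom.ext fun p => ?_
    ext i
    simp only [RingHom.comp_apply]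
    rw [coeff_jC]
    change ((Polynomial.expand ℝ q p).coeff i : ℂ) = PowerSeries.coeff i (PowerSeries.expand q hq (jC p))
    rw [PowerSeries.coeff_expand, Polynomial.coeff_expand (Nat.pos_of_ne_zero hq)]
    split_ifs
    · rw [coeff_jC]
    · simp
  · simp

theorem Hh_ne_zero (G : Polynomial (Polynomial ℝ)) (hG : G ≠ 0) (q : ℕ) (hq : q ≠ 0) (k : ℕ)
    (S : Polynomial ℝ) : Hh G q k S ≠ 0 := by
  rw [Hh, Ne, Polynomial.comp_eq_zero_iff]
  rintro (h | ⟨-, h⟩)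
  · rw [Polynomial.map_eq_zero_iff] at h
    · exact hG h
    · exact Polynomial.expand_injective (Nat.pos_of_ne_zero hq)
  · have := congrArg (fun p => Polynomial.coeff p 1) h
    simp only [Polynomial.coeff_add, Polynomial.coeff_C_mul, Polynomial.coeff_X_one, mul_one,
      Polynomial.coeff_C_succ, zero_add] at this
    exact pow_ne_zero k Polynomial.X_ne_zero this

theorem exists_q1 (G : Polynomial (Polynomial ℝ)) (hG : G ≠ 0) :
    ∃ q, q ≠ 0 ∧ ∀ r, r ≠ 0 → ∀ k S, ∃ e m, RGood e m (Hh G (r * q) k S) := by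
  have hG' : G.map jC ≠ 0 := by
    rwa [Ne, Polynomial.map_eq_zero_iff jC_inj]
  obtain ⟨q, hq, h⟩ := good_of_puiseux (G.map jC) hG'
  refine ⟨q, hq, fun r hr k S => ?_⟩
  have hne : (Hh G (r * q) k S).map jC ≠ 0 := by
    rw [Ne, Polynomial.map_eq_zero_iff jC_inj]
    exact Hh_ne_zero G hG _ (mul_ne_zero hr hq) _ _
  rw [Hh_map _ _ (mul_ne_zero hr hq)] at hne
  obtain ⟨e, m, hg⟩ := h r hr _ (by
    refine (Polynomial.natDegree_add_le _ _).trans ?_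
    simp only [Polynomial.natDegree_C, zero_le, sup_of_le_right]
    exact (Polynomial.natDegree_C_mul_le _ _).trans (by simp)) hne
  rw [← Hh_map] at hg
  exact ⟨e, m, rgood_of_good hg⟩

theorem exists_q {I : Type} [Fintype I] (G : I → Polynomial (Polynomial ℝ)) (hG : ∀ i, G i ≠ 0) :
    ∃ q, q ≠ 0 ∧ ∀ i k S, ∃ e m, RGood e m (Hh (G i) q k S) := by
  classical
  choose q hq h using fun i => exists_q1 (G i) (hG i)
  refine ⟨∏ i, q i, Finset.prod_ne_zero_iff.2 fun i _ => hq i, fun i k S => ?_⟩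
  rw [← Finset.prod_erase_mul _ _ (Finset.mem_univ i)]
  exact h i _ (Finset.prod_ne_zero_iff.2 fun i _ => hq i) k S

/-- common conclusion -/
theorem all_fin {I : Type} [Fintype I] (G : I → Polynomial (Polynomial ℝ)) (q : ℕ) (hq : q ≠ 0)
    (k : ℕ) (S : Polynomial ℝ) (hS : S.eval 0 = 0) (s : ℝ) (hs : |s| = 1) (e m : I → ℕ)
    (hR : ∀ i, RGood (e i) (m i) (Hh (G i) q k S)) (ε : ℝ) (hε : 0 < ε) :
    ∃ u0 v0 : ℝ, 0 < u0 ∧ u0 < ε ∧ |v0| < ε ∧ ∀ i,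
      0 ≤ ((Hh (G i) q k S).coeff (m i)).coeff (e i) * s ^ (m i) →
      0 ≤ ev2 (RingHom.id ℝ) u0 v0 (G i) := by
  choose δ hδ h using fun i => sign_lemma' (hR i)
  have c1 : ∀ᶠ t in nhdsWithin (0:ℝ) (Set.Ioi 0), (t ^ 2) ^ q < ε := by
    refine (Continuous.tendsto' (by fun_prop) (0:ℝ) 0 ?_).mono_left nhdsWithin_le_nhds |>.eventually
      (gt_mem_nhds hε)
    simp [hq]
  have c2 : ∀ᶠ t in nhdsWithin (0:ℝ) (Set.Ioi 0), |S.eval (t ^ 2) + (t ^ 2) ^ k * (s * t)| < ε := by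
    refine (Continuous.tendsto' (f := fun t : ℝ => |S.eval (t ^ 2) + (t ^ 2) ^ k * (s * t)|)
      (by fun_prop) (0:ℝ) 0 ?_).mono_left nhdsWithin_le_nhds |>.eventually
      (gt_mem_nhds hε)
    simp [hS]
  have c3 : ∀ᶠ t in nhdsWithin (0:ℝ) (Set.Ioi 0), ∀ i, t < δ i := by
    rw [Filter.eventually_all]
    intro i
    exact (Continuous.tendsto' continuous_id (0:ℝ) 0 rfl).mono_left nhdsWithin_le_nhds |>.eventually
      (gt_mem_nhds (hδ i))
  have c4 : ∀ᶠ t in nhdsWithin (0:ℝ) (Set.Ioi 0), t < 1 := by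
    exact (Continuous.tendsto' continuous_id (0:ℝ) 0 rfl).mono_left nhdsWithin_le_nhds |>.eventually
      (gt_mem_nhds one_pos)
  obtain ⟨t, h1, h2, h3, h4, ht⟩ := (c1.and (c2.and (c3.and (c4.and self_mem_nhdsWithin)))).exists
  refine ⟨(t ^ 2) ^ q, S.eval (t ^ 2) + (t ^ 2) ^ k * (s * t), by positivity, h1, h2, fun i hi => ?_⟩
  have habs : |s * t| = t := by rw [abs_mul, hs, abs_of_pos ht, one_mul]
  have key := (h i ℝ (RingHom.id ℝ) (t ^ 2) (s * t) s (by positivity)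
    (by have := h3 i; simp only [RingHom.id_apply]; nlinarith) (by rw [habs]; exact (h3 i).le)
    (Or.inr (by rw [habs, RingHom.id_apply]; have := h3 i; nlinarith))
    (Or.inr (by rw [habs, RingHom.id_apply]))).2 hi
  rw [ev2_Hh] at key
  exact key

section ordered
variable {F : Type} [Field F] [LinearOrder F] [IsStrictOrderedRing F]

def Inf (ι : ℝ →+* F) (a : F) : Prop := ∀ ε : ℝ, 0 < ε → |a| ≤ ι ε

theorem exists_st (ι : ℝ →+* F) (a : F) (M : ℝ) (hM : |a| ≤ ι M) : ∃ s : ℝ, Inf ι (a - ι s) := by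
  rw [abs_le, ← map_neg] at hM
  set S := {r : ℝ | ι r ≤ a}
  have hne : S.Nonempty := ⟨-M, hM.1⟩
  have hbd : BddAbove S := ⟨M, fun r hr => (iota_le_iff ι).1 (le_trans hr hM.2)⟩
  refine ⟨sSup S, fun ε hε => ?_⟩
  rw [abs_le]
  constructor
  · obtain ⟨r, hr, hlt⟩ := exists_lt_of_lt_csSup hne (sub_lt_self (sSup S) hε)
    have h1 : ι r ≤ a := hr
    have h2 := iota_mono ι hlt.le
    rw [map_sub] at h2
    linarith
  · by_contra hcon
    have : sSup S + ε ∈ S := by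
      change ι (sSup S + ε) ≤ a
      rw [map_add]; linarith
    have := le_csSup hbd this
    linarith

def st (ι : ℝ →+* F) (a : F) : ℝ := by
  classical
  exact if h : ∃ s : ℝ, Inf ι (a - ι s) then h.choose else 0

theorem st_spec (ι : ℝ →+* F) (a : F) (M : ℝ) (hM : |a| ≤ ι M) : Inf ι (a - ι (st ι a)) := by
  have h := exists_st ι a M hM
  rw [st, dif_pos h]
  exact h.choose_spec

/-- the sequence of remainders -/
def ys (ι : ℝ →+* F) (w v : F) : ℕ → F
  | 0 => v
  | k + 1 => ys ι w v k / w - ι (st ι (ys ι w v k / w))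

def ss (ι : ℝ →+* F) (w v : F) : ℕ → ℝ
  | 0 => 0
  | k + 1 => st ι (ys ι w v k / w)

def Sp (s : ℕ → ℝ) (k : ℕ) : Polynomial ℝ := ∑ l ∈ Finset.range (k + 1), Polynomial.monomial l (s l)

theorem ys_eq (ι : ℝ →+* F) (w v : F) (hw : w ≠ 0) (k : ℕ) :
    v = (Sp (ss ι w v) k).eval₂ ι w + w ^ k * ys ι w v k := by
  induction k with
  | zero => simp [Sp, ss, ys]
  | succ k ih =>
    rw [Sp, Finset.sum_range_succ, Polynomial.eval₂_add, ← Sp, Polynomial.eval₂_monomial]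
    conv_lhs => rw [ih]
    simp only [ys, ss]
    field_simp
    ring

theorem Sp_zero (s : ℕ → ℝ) (hs : s 0 = 0) (k : ℕ) : (Sp s k).eval 0 = 0 := by
  rw [Sp, Polynomial.eval_finsetSum]
  refine Finset.sum_eq_zero fun l _ => ?_
  rcases l with _ | l
  · simp [hs]
  · simp
end ordered

end Sch

namespace Sch

def jR : Polynomial ℝ →+* PowerSeries ℝ := Polynomial.coeToPowerSeries.ringHom

theorem coeff_jR (p : Polynomial ℝ) (i : ℕ) : PowerSeries.coeff i (jR p) = p.coeff i := by
  simp [jR]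

theorem rgood_of_goodR {e m : ℕ} {H : Polynomial (Polynomial ℝ)} (h : Good e m (H.map jR)) :
    RGood e m H := by
  constructor
  · intro n i hn
    apply h.1
    rwa [Polynomial.coeff_map, coeff_jR]
  · have := h.2
    rwa [Polynomial.coeff_map, coeff_jR] at this

def PP (G : Polynomial (Polynomial ℝ)) (q : ℕ) : Polynomial (PowerSeries ℝ) :=
  G.map (jR.comp (Polynomial.expand ℝ q : Polynomial ℝ →ₐ[ℝ] Polynomial ℝ).toRingHom)

theorem Hh_mapR (G : Polynomial (Polynomial ℝ)) (q : ℕ) (k : ℕ) (S : Polynomial ℝ) :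
    (Hh G q k S).map jR = (PP G q).comp
      (Polynomial.C (jR S) + Polynomial.C (PowerSeries.X ^ k) * Polynomial.X) := by
  rw [Hh, PP, Polynomial.map_comp, Polynomial.map_map]
  congr 1
  simp [jR]

theorem PP_eval (G : Polynomial (Polynomial ℝ)) (q : ℕ) (φ : PowerSeries ℝ) :
    (PP G q).eval φ = ev2 PowerSeries.C (PowerSeries.X ^ q) φ G := by
  rw [PP, Polynomial.eval_map, ev2, Polynomial.coe_eval₂RingHom]
  congr 1
  ext1
  · ext1 a; simp [jR]
  · simp [jR, Polynomial.expand_X]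

theorem PP_deriv (G : Polynomial (Polynomial ℝ)) (q : ℕ) :
    (PP G q).derivative = PP G.derivative q := by
  rw [PP, PP, Polynomial.derivative_map]

theorem comp_lin_coeff {R : Type*} [CommRing R] (P : Polynomial R) (a b : R) (n : ℕ) :
    (P.comp (Polynomial.C a + Polynomial.C b * Polynomial.X)).coeff n =
      (Polynomial.taylor a P).coeff n * b ^ n := by
  rw [← Polynomial.comp_C_mul_X_coeff, Polynomial.taylor_apply, Polynomial.comp_assoc]
  congr 2
  simp [add_comm]

theorem coeff_congr_of_dvd {a b : PowerSeries ℝ} {N : ℕ} (h : PowerSeries.X ^ N ∣ a - b) {i : ℕ}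
    (hi : i < N) : PowerSeries.coeff i a = PowerSeries.coeff i b := by
  have := PowerSeries.X_pow_dvd_iff.1 h i hi
  rw [map_sub] at this
  linear_combination this

theorem le_of_dvd {a : PowerSeries ℝ} {N : ℕ} (h : PowerSeries.X ^ N ∣ a) {i : ℕ}
    (hi : PowerSeries.coeff i a ≠ 0) : N ≤ i := by
  by_contra hc
  exact hi (PowerSeries.X_pow_dvd_iff.1 h i (by omega))

theorem type2_nonvan (P : Polynomial (PowerSeries ℝ)) (φ : PowerSeries ℝ) (h : P.eval φ ≠ 0) :
    ∃ e, ∀ N, e ≤ N → ∀ a, PowerSeries.X ^ (N + 1) ∣ φ - a →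
      Good e 0 (P.comp (Polynomial.C a + Polynomial.C (PowerSeries.X ^ N) * Polynomial.X)) := by
  obtain ⟨e, he, hmin⟩ := exists_ord _ h
  refine ⟨e, fun N hN a ha => ?_⟩
  have hd : PowerSeries.X ^ (N + 1) ∣ P.eval φ - P.eval a := ha.trans (Polynomial.sub_dvd_eval_sub _ _ _)
  constructor
  · intro n i hi
    rw [comp_lin_coeff] at hi
    rcases n with _ | n
    · rw [pow_zero, mul_one, Polynomial.taylor_coeff_zero] at hi
      rcases lt_or_ge i (N + 1) with h1 | h1
      · rw [← coeff_congr_of_dvd hd h1] at hi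
        have := hmin _ hi
        omega
      · omega
    · have : N ≤ i := le_of_dvd (by
        rw [pow_succ, ← mul_assoc]; exact Dvd.intro_left _ rfl) hi
      omega
  · rw [comp_lin_coeff, pow_zero, mul_one, Polynomial.taylor_coeff_zero,
      ← coeff_congr_of_dvd hd (by omega)]
    exact he

theorem type2_van (P : Polynomial (PowerSeries ℝ)) (φ : PowerSeries ℝ) (h0 : P.eval φ = 0)
    (h : P.derivative.eval φ ≠ 0) :
    ∃ e, ∀ N, e ≤ N → ∀ a, PowerSeries.X ^ (N + 1) ∣ φ - a →
      Good (e + N) 1 (P.comp (Polynomial.C a + Polynomial.C (PowerSeries.X ^ N) * Polynomial.X)) := by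
  obtain ⟨e, he, hmin⟩ := exists_ord _ h
  refine ⟨e, fun N hN a ha => ?_⟩
  have hd : PowerSeries.X ^ (N + 1) ∣ P.derivative.eval φ - P.derivative.eval a :=
    ha.trans (Polynomial.sub_dvd_eval_sub _ _ _)
  have hXe : PowerSeries.X ^ e ∣ P.derivative.eval φ := by
    rw [PowerSeries.X_pow_dvd_iff]
    intro i hi
    by_contra hc
    have := hmin i hc
    omega
  have h0a : PowerSeries.X ^ (e + N + 1) ∣ P.eval a := by
    obtain ⟨k, hk⟩ := P.binomExpansion φ (a - φ)
    rw [add_sub_cancel, h0, zero_add] at hk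
    rw [hk]
    have ha' : PowerSeries.X ^ (N + 1) ∣ a - φ := by rw [← neg_sub]; exact (dvd_neg).2 ha
    refine dvd_add ?_ ?_
    · rw [add_assoc, pow_add]; exact mul_dvd_mul hXe ha'
    · refine Dvd.dvd.mul_left ?_ _
      have := pow_dvd_pow_of_dvd ha' 2
      rw [← pow_mul] at this
      exact (pow_dvd_pow _ (by omega)).trans this
  constructor
  · intro n i hi
    rw [comp_lin_coeff] at hi
    rcases n with _ | _ | n
    · rw [pow_zero, mul_one, Polynomial.taylor_coeff_zero] at hi
      have := le_of_dvd h0a hi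
      omega
    · rw [zero_add, pow_one, Polynomial.taylor_coeff_one, PowerSeries.coeff_mul_X_pow'] at hi
      have h1 : N ≤ i := by by_contra hc; rw [if_neg hc] at hi; exact hi rfl
      rw [if_pos h1] at hi
      rcases lt_or_ge (i - N) (N + 1) with h2 | h2
      · rw [← coeff_congr_of_dvd hd h2] at hi
        have := hmin _ hi
        omega
      · omega
    · have : 2 * N ≤ i := le_of_dvd (by
        rw [← pow_mul]
        refine Dvd.dvd.mul_left (pow_dvd_pow _ ?_) _
        nlinarith) hi
      omega
  · rw [comp_lin_coeff, pow_one, Polynomial.taylor_coeff_one, PowerSeries.coeff_mul_X_pow,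
      ← coeff_congr_of_dvd hd (by omega)]
    exact he

theorem Sp_dvd (s : ℕ → ℝ) (N : ℕ) : PowerSeries.X ^ (N + 1) ∣ PowerSeries.mk s - jR (Sp s N) := by
  rw [PowerSeries.X_pow_dvd_iff]
  intro i hi
  rw [map_sub, coeff_jR, PowerSeries.coeff_mk, Sp, Polynomial.finsetSum_coeff,
    Finset.sum_eq_single i]
  · simp
  · intro b _ hb
    rw [Polynomial.coeff_monomial, if_neg hb]
  · intro h; exact absurd (Finset.mem_range.2 hi) h

theorem exists_sgn {F : Type} [Field F] [LinearOrder F] [IsStrictOrderedRing F] (ι : ℝ →+* F) (y : F) :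
    ∃ s : ℝ, |s| = 1 ∧ y = ι s * |y| := by
  rcases le_total 0 y with h | h
  · exact ⟨1, by simp, by simp [abs_of_nonneg h]⟩
  · exact ⟨-1, by simp, by simp [abs_of_nonpos h]⟩

/-- Local Artin-Lang -/
theorem ALL {I : Type} [Fintype I] (G : I → Polynomial (Polynomial ℝ)) (hG : ∀ i, G i ≠ 0)
    (h1 : ∀ i j, i ≠ j → ∀ q, q ≠ 0 → ∀ φ, ev2 PowerSeries.C (PowerSeries.X ^ q) φ (G i) = 0 →
      ev2 PowerSeries.C (PowerSeries.X ^ q) φ (G j) ≠ 0)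
    (h2 : ∀ i, ∀ q, q ≠ 0 → ∀ φ, ev2 PowerSeries.C (PowerSeries.X ^ q) φ (G i) = 0 →
      ev2 PowerSeries.C (PowerSeries.X ^ q) φ (G i).derivative ≠ 0)
    {F : Type} [Field F] [LinearOrder F] [IsStrictOrderedRing F] (ι : ℝ →+* F) (u v : F)
    (hu : 0 < u) (hu' : Inf ι u) (hv : Inf ι v) (ε : ℝ) (hε : 0 < ε) :
    ∃ u0 v0 : ℝ, 0 < u0 ∧ u0 < ε ∧ |v0| < ε ∧ ∀ i, 0 ≤ ev2 ι u v (G i) →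
      0 ≤ ev2 (RingHom.id ℝ) u0 v0 (G i) := by
  classical
  obtain ⟨q, hq, hR⟩ := exists_q G hG
  obtain ⟨F', _, _, _, κ, hκ, w, hw, hwq⟩ := exists_qth_root F u hu q hq
  set ι' : ℝ →+* F' := κ.comp ι with hι'
  have hκabs : ∀ a, |κ a| = κ |a| := by
    intro a
    rcases le_total 0 a with h | h
    · rw [abs_of_nonneg h, abs_of_nonneg (hκ _ h)]
    · have := hκ (-a) (by linarith)
      rw [map_neg] at this
      rw [abs_of_nonpos h, abs_of_nonpos (by linarith), map_neg]
  have hκinf : ∀ a, Inf ι a → Inf ι' (κ a) := by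
    intro a ha e he
    have := hκ _ (sub_nonneg.2 (ha e he))
    rw [map_sub] at this
    rw [hκabs, hι', RingHom.comp_apply]; linarith
  have hwinf : Inf ι' w := by
    intro e he
    have h3 := hκinf _ hu' (e ^ q) (by positivity)
    rw [← hwq, map_pow, abs_pow] at h3
    by_contra hc
    have h4 : 0 ≤ ι' e := iota_nonneg _ he.le
    exact absurd (pow_lt_pow_left₀ (not_le.1 hc) h4 hq) (not_lt.2 h3)
  set y := ys ι' w (κ v) with hy
  set s := ss ι' w (κ v) with hs
  have hs0 : s 0 = 0 := rfl
  have hyeq : ∀ k, κ v = (Sp s k).eval₂ ι' w + w ^ k * y k := fun k => ys_eq ι' w (κ v) hw.ne' k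
  have hev : ∀ k i, κ (ev2 ι u v (G i)) = ev2 ι' w (y k) (Hh (G i) q k (Sp s k)) := by
    intro k i
    rw [ev2_Hh, ev2_map, ← hyeq, hwq]
  have hevnn : ∀ k i, 0 ≤ ev2 ι u v (G i) → 0 ≤ ev2 ι' w (y k) (Hh (G i) q k (Sp s k)) := by
    intro k i h
    rw [← hev]; exact hκ _ h
  by_cases ht : ∃ k, Inf ι' (y k) ∧ ∀ δ : ℝ, 0 < δ → w ≤ ι' δ * |y k|
  · obtain ⟨k, hk, hkw⟩ := ht
    choose e m hem using fun i => hR i k (Sp s k)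
    obtain ⟨σ, hσ, hσy⟩ := exists_sgn ι' (y k)
    obtain ⟨u0, v0, h3, h4, h5, h6⟩ := all_fin G q hq k (Sp s k) (Sp_zero s hs0 k) σ hσ e m hem ε hε
    refine ⟨u0, v0, h3, h4, h5, fun i hi => h6 i ?_⟩
    obtain ⟨δ, hδ, hδ'⟩ := sign_lemma' (hem i)
    refine (hδ' F' ι' w (y k) σ hw ?_ (hk δ hδ) (Or.inr (hkw δ hδ)) (Or.inr hσy)).1 (hevnn k i hi)
    exact (le_abs_self _).trans (hwinf δ hδ)
  · push Not at ht
    have hyinf : ∀ k, Inf ι' (y k) := by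
      intro k
      induction k with
      | zero => exact hκinf _ hv
      | succ k ih =>
        obtain ⟨δ, hδ, hlt⟩ := ht k ih
        have hδ' : 0 < ι' δ := by simpa using iota_lt ι' hδ
        refine st_spec ι' (y k / w) (1 / δ) ?_
        rw [abs_div, abs_of_pos hw, div_le_iff₀ hw, map_div₀, map_one, div_mul_eq_mul_div, one_mul,
          le_div_iff₀ hδ', mul_comm]
        exact hlt.le
    set φ := PowerSeries.mk s with hφ
    have hex : ∀ i, ∃ N0 m, ∃ e : ℕ → ℕ, ∀ N, N0 ≤ N → RGood (e N) m (Hh (G i) q N (Sp s N)) ∧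
        ((m = 0 ∧ (PP (G i) q).eval φ ≠ 0) ∨ (m = 1 ∧ (PP (G i) q).eval φ = 0)) := by
      intro i
      by_cases hv0 : (PP (G i) q).eval φ = 0
      · have : (PP (G i) q).derivative.eval φ ≠ 0 := by
          rw [PP_deriv, PP_eval]
          exact h2 i q hq φ (by rw [← PP_eval]; exact hv0)
        obtain ⟨e, he⟩ := type2_van _ _ hv0 this
        refine ⟨e, 1, fun N => e + N, fun N hN => ⟨rgood_of_goodR ?_, Or.inr ⟨rfl, hv0⟩⟩⟩
        rw [Hh_mapR]
        exact he N hN _ (Sp_dvd s N)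
      · obtain ⟨e, he⟩ := type2_nonvan _ _ hv0
        refine ⟨e, 0, fun N => e, fun N hN => ⟨rgood_of_goodR ?_, Or.inl ⟨rfl, hv0⟩⟩⟩
        rw [Hh_mapR]
        exact he N hN _ (Sp_dvd s N)
    choose N0 m e hem using hex
    set N := ∑ i, N0 i with hN
    have hNi : ∀ i, N0 i ≤ N := fun i => Finset.single_le_sum (f := N0) (fun _ _ => Nat.zero_le _) (Finset.mem_univ i)
    have hsg : ∃ σ : ℝ, |σ| = 1 ∧ ∀ i, m i = 1 →
        0 ≤ ((Hh (G i) q N (Sp s N)).coeff (m i)).coeff (e i N) * σ ^ m i := by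
      by_cases hi0 : ∃ i0, m i0 = 1
      · obtain ⟨i0, hi0⟩ := hi0
        have huniq : ∀ i, m i = 1 → i = i0 := by
          intro i hi
          by_contra hne
          have a1 : (PP (G i) q).eval φ = 0 := by
            rcases (hem i N (hNi i)).2 with h | h
            · omega
            · exact h.2
          have a2 : (PP (G i0) q).eval φ = 0 := by
            rcases (hem i0 N (hNi i0)).2 with h | h
            · omega
            · exact h.2
          rw [PP_eval] at a1 a2
          exact h1 i i0 hne q hq φ a1 a2
        set c := ((Hh (G i0) q N (Sp s N)).coeff (m i0)).coeff (e i0 N) with hc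
        rcases le_total 0 c with h | h
        · exact ⟨1, by simp, fun i hi => by rw [huniq i hi, ← hc]; simpa using h⟩
        · exact ⟨-1, by simp, fun i hi => by rw [huniq i hi, ← hc, hi0]; simpa using h⟩
      · exact ⟨1, by simp, fun i hi => absurd ⟨i, hi⟩ hi0⟩
    obtain ⟨σ, hσ, hσc⟩ := hsg
    obtain ⟨u0, v0, h3, h4, h5, h6⟩ := all_fin G q hq N (Sp s N) (Sp_zero s hs0 N) σ hσ
      (fun i => e i N) m (fun i => (hem i N (hNi i)).1) ε hε
    refine ⟨u0, v0, h3, h4, h5, fun i hi => h6 i ?_⟩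
    rcases (hem i N (hNi i)).2 with h | h
    · obtain ⟨δ, hδ, hδ'⟩ := sign_lemma' (hem i N (hNi i)).1
      refine (hδ' F' ι' w (y N) σ hw ?_ (hyinf N δ hδ) (Or.inl h.1) (Or.inl h.1)).1 (hevnn N i hi)
      exact (le_abs_self _).trans (hwinf δ hδ)
    · exact hσc i h.1

end Sch

namespace Sch

section bez
variable {R : Type*} [CommRing R] [IsDomain R]

theorem pseudo_div (m : Polynomial R) (hm : m ≠ 0) (n : ℕ) : ∀ f : Polynomial R, f.natDegree < n →
    ∃ c : R, c ≠ 0 ∧ ∃ h r : Polynomial R, Polynomial.C c * f = m * h + r ∧ r.degree < m.degree := by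
  induction n with
  | zero => intro f hf; omega
  | succ n ih =>
    intro f hf
    by_cases hd : f.degree < m.degree
    · exact ⟨1, one_ne_zero, 0, f, by simp, hd⟩
    · rw [not_lt] at hd
      have hf0 : f ≠ 0 := by
        rintro rfl
        rw [Polynomial.degree_zero, le_bot_iff, Polynomial.degree_eq_bot] at hd
        exact hm hd
      have hnd : m.natDegree ≤ f.natDegree := Polynomial.natDegree_le_natDegree hd
      set f1 := Polynomial.C m.leadingCoeff * f -
        Polynomial.C f.leadingCoeff * (m * Polynomial.X ^ (f.natDegree - m.natDegree)) with hf1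
      have hlc : m.leadingCoeff ≠ 0 := Polynomial.leadingCoeff_ne_zero.2 hm
      have hle : f1.degree < f.degree := by
        have d1 : (Polynomial.C m.leadingCoeff * f).degree = f.degree := Polynomial.degree_C_mul hlc
        rw [← d1]
        apply Polynomial.degree_sub_lt_left
        · rw [d1, Polynomial.degree_C_mul (Polynomial.leadingCoeff_ne_zero.2 hf0), Polynomial.degree_mul,
            Polynomial.degree_X_pow, Polynomial.degree_eq_natDegree hm, Polynomial.degree_eq_natDegree hf0]
          norm_cast; omega
        · exact mul_ne_zero (Polynomial.C_ne_zero.2 hlc) hf0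
        · simp [mul_comm]
      by_cases hn : f.natDegree = 0
      · have h0 : f1 = 0 := by
          rw [← Polynomial.degree_eq_bot]
          rw [Polynomial.degree_eq_natDegree hf0, hn] at hle
          simpa using hle
        refine ⟨m.leadingCoeff, hlc, Polynomial.C f.leadingCoeff * Polynomial.X ^ (f.natDegree - m.natDegree),
          0, ?_, by rw [Polynomial.degree_zero, bot_lt_iff_ne_bot]; exact Polynomial.degree_ne_bot.2 hm⟩
        linear_combination (hf1.symm.trans h0)
      · obtain ⟨c, hc, h, r, he, hr⟩ := ih f1 (by
          have := Polynomial.natDegree_lt_natDegree_iff (p := f1) (q := f)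
          by_cases h1 : f1 = 0
          · rw [h1]; simp; omega
          · have := Polynomial.natDegree_lt_natDegree h1 hle
            omega)
        refine ⟨c * m.leadingCoeff, mul_ne_zero hc hlc, h + Polynomial.C c * (Polynomial.C f.leadingCoeff *
          Polynomial.X ^ (f.natDegree - m.natDegree)), r, ?_, hr⟩
        rw [Polynomial.C_mul]
        linear_combination he + Polynomial.C c * hf1.symm

theorem bez_prime (π q : Polynomial R) (hπ : Prime π) (hdeg : 0 < π.natDegree) (hq : ¬ π ∣ q) :
    ∃ a b : Polynomial R, ∃ d : R, d ≠ 0 ∧ a * π + b * q = Polynomial.C d := by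
  classical
  have hex : ∃ n : ℕ, ∃ m ∈ Ideal.span {π, q}, m ≠ 0 ∧ m.natDegree = n :=
    ⟨_, π, Ideal.subset_span (by simp), hπ.ne_zero, rfl⟩
  obtain ⟨m, hmI, hm0, hmd⟩ := Nat.find_spec hex
  have hmin : ∀ r ∈ Ideal.span {π, q}, r.degree < m.degree → r = 0 := by
    intro r hr hd
    by_contra h0
    have := Nat.find_min hex (m := r.natDegree) (by
      rw [← hmd]; exact Polynomial.natDegree_lt_natDegree h0 hd)
    exact this ⟨r, hr, h0, rfl⟩
  have hdiv : ∀ f ∈ Ideal.span {π, q}, ∃ c : R, c ≠ 0 ∧ ∃ h, Polynomial.C c * f = m * h := by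
    intro f hf
    obtain ⟨c, hc, h, r, he, hr⟩ := pseudo_div m hm0 _ f (Nat.lt_succ_self _)
    have hrI : r ∈ Ideal.span {π, q} := by
      have : r = Polynomial.C c * f - m * h := by rw [he]; ring
      rw [this]
      exact Ideal.sub_mem _ (Ideal.mul_mem_left _ _ hf) (Ideal.mul_mem_right _ _ hmI)
    rw [hmin r hrI hr, add_zero] at he
    exact ⟨c, hc, h, he⟩
  have hndC : ∀ c : R, c ≠ 0 → ¬ π ∣ Polynomial.C c := by
    intro c hc hd
    have := Polynomial.natDegree_le_of_dvd hd (Polynomial.C_ne_zero.2 hc)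
    rw [Polynomial.natDegree_C] at this
    omega
  have hm : m.natDegree = 0 := by
    by_contra hne
    obtain ⟨c, hc, h, he⟩ := hdiv π (Ideal.subset_span (by simp))
    have hπm : π ∣ m := by
      rcases hπ.dvd_or_dvd (show π ∣ m * h from he ▸ Dvd.intro_left _ rfl) with h1 | ⟨h', rfl⟩
      · exact h1
      · exfalso
        have : Polynomial.C c = m * h' := by
          apply mul_right_cancel₀ hπ.ne_zero
          rw [he]; ring
        have h3 := congrArg Polynomial.natDegree this
        have h' : h' ≠ 0 := by
          rintro rfl
          rw [mul_zero, Polynomial.C_eq_zero] at this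
          exact hc this
        rw [Polynomial.natDegree_C, Polynomial.natDegree_mul hm0 h'] at h3
        omega
    obtain ⟨c', hc', h', he'⟩ := hdiv q (Ideal.subset_span (by simp))
    rcases hπ.dvd_or_dvd (show π ∣ Polynomial.C c' * q from he' ▸ hπm.mul_right _) with h1 | h1
    · exact hndC c' hc' h1
    · exact hq h1
  rw [Polynomial.natDegree_eq_zero] at hm
  obtain ⟨d, rfl⟩ := hm
  obtain ⟨a, b, hab⟩ := Ideal.mem_span_pair.1 hmI
  exact ⟨a, b, d, fun h => hm0 (by rw [h, map_zero]), hab⟩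

theorem bez [UniqueFactorizationMonoid R] (q : Polynomial R) (p : Polynomial R) (hp : p ≠ 0)
    (h : ∀ π : Polynomial R, Prime π → 0 < π.natDegree → π ∣ p → ¬ π ∣ q) :
    ∃ a b : Polynomial R, ∃ d : R, d ≠ 0 ∧ a * p + b * q = Polynomial.C d := by
  revert hp h
  refine UniqueFactorizationMonoid.induction_on_prime p ?_ ?_ ?_
  · intro h; exact absurd rfl h
  · intro x hx _ _
    obtain ⟨y, hy⟩ := hx.exists_left_inv
    exact ⟨y, 0, 1, one_ne_zero, by simp [hy]⟩
  · intro p' π hp' hπ ih _ h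
    obtain ⟨a, b, d, hd, he⟩ := ih hp' fun ρ h1 h2 h3 => h ρ h1 h2 (h3.mul_left _)
    obtain ⟨a', b', d', hd', he'⟩ : ∃ a b : Polynomial R, ∃ d : R, d ≠ 0 ∧ a * π + b * q = Polynomial.C d := by
      rcases Nat.eq_zero_or_pos π.natDegree with h0 | h0
      · rw [Polynomial.natDegree_eq_zero] at h0
        obtain ⟨d, rfl⟩ := h0
        exact ⟨1, 0, d, fun h => hπ.ne_zero (by rw [h, map_zero]), by simp⟩
      · exact bez_prime π q hπ h0 (h π hπ h0 (Dvd.intro _ rfl))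
    refine ⟨a' * a, a' * π * b + b' * Polynomial.C d, d' * d, mul_ne_zero hd' hd, ?_⟩
    rw [Polynomial.C_mul, ← he', ← he]
    ring
end bez

abbrev A2 := MvPolynomial (Fin 2) ℝ

def Φ : A2 →+* Polynomial (Polynomial ℝ) :=
  MvPolynomial.eval₂Hom (Polynomial.C.comp Polynomial.C) ![Polynomial.C Polynomial.X, Polynomial.X]

def Ψ : Polynomial (Polynomial ℝ) →+* A2 := ev2 MvPolynomial.C (X 0) (X 1)

theorem ΨΦ (g : A2) : Ψ (Φ g) = g := by
  have : Ψ.comp Φ = RingHom.id _ := by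
    apply MvPolynomial.ringHom_ext
    · intro r; simp [Ψ, Φ, ev2]
    · intro i; fin_cases i <;> simp [Ψ, Φ, ev2]
  exact congrArg (fun f => f g) this

theorem ΦΨ (g : Polynomial (Polynomial ℝ)) : Φ (Ψ g) = g := by
  have : Φ.comp Ψ = RingHom.id _ := by
    ext1
    · ext1
      · ext1 r; simp [Ψ, Φ, ev2]
      · simp [Ψ, Φ, ev2]
    · simp [Ψ, Φ, ev2]
  exact congrArg (fun f => f g) this

def Φe : A2 ≃+* Polynomial (Polynomial ℝ) := RingEquiv.ofRingHom Φ Ψ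
  (RingHom.ext ΦΨ) (RingHom.ext ΨΦ)

theorem ev2_Φ {L : Type*} [CommRing L] (ι : ℝ →+* L) (u v : L) (g : A2) :
    ev2 ι u v (Φ g) = MvPolynomial.eval₂ ι ![u, v] g := by
  have : (ev2 ι u v).comp Φ = MvPolynomial.eval₂Hom ι ![u, v] := by
    apply MvPolynomial.ringHom_ext
    · intro r; simp [Φ, ev2]
    · intro i; fin_cases i <;> simp [Φ, ev2]
  exact congrArg (fun f => f g) this

theorem Φ_deriv (g : A2) : (Φ g).derivative = Φ (pderiv 1 g) := by
  induction g using MvPolynomial.induction_on with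
  | C a => simp [Φ]
  | add p q hp hq => simp [hp, hq]
  | mul_X p i hp =>
    rw [map_mul, Polynomial.derivative_mul, hp, Derivation.leibniz]
    fin_cases i
    · simp [Φ, pderiv_X]; ring
    · simp [Φ, pderiv_X]; ring

theorem Φ_irr {g : A2} : Irreducible (Φ g) ↔ Irreducible g := MulEquiv.irreducible_iff Φe

theorem Φ_dvd {g h : A2} : Φ g ∣ Φ h ↔ g ∣ h := map_dvd_iff Φe

theorem BZ1 (p q : A2) (hp : p ≠ 0) (h : IsRelPrime p q) :
    ∃ a b : A2, ∃ D : Polynomial ℝ, D ≠ 0 ∧ a * p + b * q = D.eval₂ MvPolynomial.C (X 0) := by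
  obtain ⟨a, b, d, hd, he⟩ := bez (Φ q) (Φ p) (fun h => hp (by rw [← ΨΦ p, h, map_zero]))
    (fun π hπ _ h1 h2 => by
      rw [← ΦΨ π, Φ_dvd] at h1 h2
      have := h h1 h2
      exact hπ.not_isUnit (by rw [← ΦΨ π]; exact this.map Φ))
  refine ⟨Ψ a, Ψ b, d, hd, ?_⟩
  have := congrArg Ψ he
  rw [map_add, map_mul, map_mul, ΨΦ, ΨΦ] at this
  rw [this]
  simp [Ψ, ev2]

theorem BZ2 (g : A2) (h : Squarefree g) :
    ∃ a b : A2, ∃ D : Polynomial ℝ, D ≠ 0 ∧ a * g + b * pderiv 1 g = D.eval₂ MvPolynomial.C (X 0) := by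
  obtain ⟨a, b, d, hd, he⟩ := bez (Φ (pderiv 1 g)) (Φ g)
    (fun h0 => h.ne_zero (by rw [← ΨΦ g, h0, map_zero]))
    (fun π hπ hdeg h1 h2 => by
      obtain ⟨t, ht⟩ := h1
      rw [← Φ_deriv, ht, Polynomial.derivative_mul] at h2
      have h3 : π ∣ Polynomial.derivative π * t := (dvd_add_left (Dvd.intro _ rfl)).1 h2
      rcases hπ.dvd_or_dvd h3 with h4 | h4
      · have hd0 : Polynomial.derivative π ≠ 0 := by
          intro h0
          have := Polynomial.derivative_eq_zero.1 h0
          omega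
        have h5 := Polynomial.natDegree_le_of_dvd h4 hd0
        have h6 := Polynomial.natDegree_derivative_lt (p := π) (by omega)
        omega
      · obtain ⟨t', rfl⟩ := h4
        have : Ψ π * Ψ π ∣ g := ⟨Ψ t', by rw [← ΨΦ g, ht, map_mul, map_mul]; ring⟩
        have := h _ this
        exact hπ.not_isUnit (by rw [← ΦΨ π]; exact this.map Φ))
  refine ⟨Ψ a, Ψ b, d, hd, ?_⟩
  have := congrArg Ψ he
  rw [map_add, map_mul, map_mul, ΨΦ, ΨΦ] at this
  rw [this]
  simp [Ψ, ev2]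

end Sch

namespace Sch

abbrev LL := FractionRing (PowerSeries ℝ)
def ιL : ℝ →+* LL := (algebraMap (PowerSeries ℝ) LL).comp PowerSeries.C

theorem ιL_eq : ιL = algebraMap ℝ LL := by
  rw [IsScalarTower.algebraMap_eq ℝ (PowerSeries ℝ) LL]
  rfl

theorem transc (q : ℕ) (hq : q ≠ 0) :
    ¬ IsAlgebraic ℝ (algebraMap (PowerSeries ℝ) LL (PowerSeries.X ^ q)) := by
  rintro ⟨D, hD, h⟩
  apply hD
  rw [Polynomial.aeval_algebraMap_apply, map_eq_zero_iff _ (IsFractionRing.injective (PowerSeries ℝ) LL)] at h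
  have : jR (Polynomial.expand ℝ q D) = 0 := by
    rw [← h]
    have : (jR.comp (Polynomial.expand ℝ q : Polynomial ℝ →ₐ[ℝ] Polynomial ℝ).toRingHom) =
      (Polynomial.aeval (PowerSeries.X ^ q : PowerSeries ℝ)).toRingHom := by
      ext1
      · ext1 a; simp [jR]
      · simp [jR, Polynomial.expand_X]
    exact congrArg (fun f => f D) this
  have h2 : Polynomial.expand ℝ q D = 0 := by
    ext i
    rw [← coeff_jR, this]; simp
  exact (Polynomial.expand_eq_zero (Nat.pos_of_ne_zero hq)).1 h2

structure Chart where
  cx : ∀ (L : Type) [Field L], (ℝ →+* L) → L → L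
  cy : ∀ (L : Type) [Field L], (ℝ →+* L) → L → L → L
  tr : ∀ u : LL, IsAlgebraic ℝ (cx LL ιL u) → IsAlgebraic ℝ u
  k : ℕ
  G : ∀ g : A2, ∃ G : Polynomial (Polynomial ℝ), ∃ n : ℕ, ∀ (L : Type) [Field L] (ι : ℝ →+* L) (u v : L),
    u ≠ 0 → ev2 ι u v G = u ^ n * MvPolynomial.eval₂ ι ![cx L ι u, cy L ι u v] g ∧
      u ^ k * ev2 ι u v G.derivative = u ^ n * MvPolynomial.eval₂ ι ![cx L ι u, cy L ι u v] (pderiv 1 g)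

theorem ALc (c : Chart) {I : Type} [Fintype I] (g : I → A2) (hsq : ∀ i, Squarefree (g i))
    (hcop : ∀ i j, i ≠ j → IsRelPrime (g i) (g j))
    {F : Type} [Field F] [LinearOrder F] [IsStrictOrderedRing F] (ι : ℝ →+* F) (u v : F)
    (hu : 0 < u) (hu' : Inf ι u) (hv : Inf ι v) (ε : ℝ) (hε : 0 < ε) :
    ∃ u0 v0 : ℝ, 0 < u0 ∧ u0 < ε ∧ |v0| < ε ∧ ∀ i,
      0 ≤ MvPolynomial.eval₂ ι ![c.cx F ι u, c.cy F ι u v] (g i) →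
      0 ≤ MvPolynomial.eval ![c.cx ℝ (RingHom.id ℝ) u0, c.cy ℝ (RingHom.id ℝ) u0 v0] (g i) := by
  choose G n hG using fun i => c.G (g i)
  set α := algebraMap (PowerSeries ℝ) LL with hα
  have hX : ∀ q, α (PowerSeries.X ^ q) ≠ 0 := by
    intro q
    rw [Ne, map_eq_zero_iff _ (IsFractionRing.injective (PowerSeries ℝ) LL)]
    exact pow_ne_zero _ PowerSeries.X_ne_zero
  have tr : ∀ q, q ≠ 0 → ∀ D : Polynomial ℝ, D ≠ 0 → ∀ y : LL,
      MvPolynomial.eval₂ ιL ![c.cx LL ιL (α (PowerSeries.X ^ q)), y] (D.eval₂ MvPolynomial.C (X 0)) ≠ 0 := by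
    intro q hq D hD y h0
    apply transc q hq
    apply c.tr
    refine ⟨D, hD, ?_⟩
    rw [Polynomial.aeval_def, ← ιL_eq]
    rw [← MvPolynomial.coe_eval₂Hom, Polynomial.hom_eval₂] at h0
    have e1 : (eval₂Hom ιL ![c.cx LL ιL (α (PowerSeries.X ^ q)), y]).comp C = ιL :=
      RingHom.ext fun r => by simp
    have e2 : (eval₂Hom ιL ![c.cx LL ιL (α (PowerSeries.X ^ q)), y]) (X 0) =
      c.cx LL ιL (α (PowerSeries.X ^ q)) := by simp
    rw [e1, e2] at h0
    exact h0
  have van : ∀ i q φ, ev2 PowerSeries.C (PowerSeries.X ^ q) φ (G i) = 0 →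
      MvPolynomial.eval₂ ιL ![c.cx LL ιL (α (PowerSeries.X ^ q)), c.cy LL ιL (α (PowerSeries.X ^ q)) (α φ)] (g i) = 0 := by
    intro i q φ h0
    have h1 := congrArg α h0
    rw [map_zero, ev2_map] at h1
    have h2 := (hG i LL ιL (α (PowerSeries.X ^ q)) (α φ) (hX q)).1
    rw [ιL] at h2
    rw [h2] at h1
    exact (mul_eq_zero.1 h1).resolve_left (pow_ne_zero _ (hX q))
  have van' : ∀ i q φ, ev2 PowerSeries.C (PowerSeries.X ^ q) φ (G i).derivative = 0 →
      MvPolynomial.eval₂ ιL ![c.cx LL ιL (α (PowerSeries.X ^ q)), c.cy LL ιL (α (PowerSeries.X ^ q)) (α φ)]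
        (pderiv 1 (g i)) = 0 := by
    intro i q φ h0
    have h1 := congrArg α h0
    rw [map_zero, ev2_map] at h1
    have h2 := (hG i LL ιL (α (PowerSeries.X ^ q)) (α φ) (hX q)).2
    rw [ιL, h1, mul_zero] at h2
    exact (mul_eq_zero.1 h2.symm).resolve_left (pow_ne_zero _ (hX q))
  have h2 : ∀ i, ∀ q, q ≠ 0 → ∀ φ, ev2 PowerSeries.C (PowerSeries.X ^ q) φ (G i) = 0 →
      ev2 PowerSeries.C (PowerSeries.X ^ q) φ (G i).derivative ≠ 0 := by
    intro i q hq φ a1 a2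
    obtain ⟨a, b, D, hD, he⟩ := BZ2 (g i) (hsq i)
    apply tr q hq D hD
    rw [← he, MvPolynomial.eval₂_add, MvPolynomial.eval₂_mul, MvPolynomial.eval₂_mul, van i q φ a1,
      van' i q φ a2]
    simp
  have h1 : ∀ i j, i ≠ j → ∀ q, q ≠ 0 → ∀ φ, ev2 PowerSeries.C (PowerSeries.X ^ q) φ (G i) = 0 →
      ev2 PowerSeries.C (PowerSeries.X ^ q) φ (G j) ≠ 0 := by
    intro i j hij q hq φ a1 a2
    obtain ⟨a, b, D, hD, he⟩ := BZ1 (g i) (g j) (hsq i).ne_zero (hcop i j hij)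
    apply tr q hq D hD
    rw [← he, MvPolynomial.eval₂_add, MvPolynomial.eval₂_mul, MvPolynomial.eval₂_mul, van i q φ a1,
      van j q φ a2]
    simp
  have h0 : ∀ i, G i ≠ 0 := by
    intro i h0
    refine h2 i 1 one_ne_zero 0 ?_ ?_
    · rw [h0]; simp
    · rw [h0]; simp
  obtain ⟨u0, v0, b1, b2, b3, b4⟩ := ALL G h0 h1 h2 ι u v hu hu' hv ε hε
  refine ⟨u0, v0, b1, b2, b3, fun i hi => ?_⟩
  have c1 := (hG i F ι u v hu.ne').1
  have c2 := (hG i ℝ (RingHom.id ℝ) u0 v0 b1.ne').1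
  have := b4 i (by rw [c1]; exact mul_nonneg (by positivity) hi)
  rw [c2] at this
  exact nonneg_of_mul_nonneg_right this (by positivity)

def chart2 (p0 p1 σ : ℝ) (hσ : σ ≠ 0) : Chart where
  cx L _ ι u := ι p0 + ι σ * u
  cy L _ ι u v := ι p1 + v
  tr u h := by
    rw [ιL_eq] at h
    have h1 := (h.sub (isAlgebraic_algebraMap (R := ℝ) (A := LL) p0)).mul
      (isAlgebraic_algebraMap (R := ℝ) (A := LL) σ⁻¹)
    have e1 : ((algebraMap ℝ LL) p0 + (algebraMap ℝ LL) σ * u - (algebraMap ℝ LL) p0) *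
        (algebraMap ℝ LL) σ⁻¹ = u := by
      rw [add_sub_cancel_left, mul_comm, ← mul_assoc, ← map_mul, inv_mul_cancel₀ hσ]
      simp
    rw [e1] at h1
    exact h1
  k := 0
  G g := by
    refine ⟨Φ (MvPolynomial.eval₂Hom MvPolynomial.C ![C p0 + C σ * X 0, C p1 + X 1] g), 0, ?_⟩
    intro L _ ι u v _
    have hcomp : ∀ g : A2, ev2 ι u v (Φ (MvPolynomial.eval₂Hom MvPolynomial.C ![C p0 + C σ * X 0, C p1 + X 1] g)) =
        MvPolynomial.eval₂ ι ![ι p0 + ι σ * u, ι p1 + v] g := by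
      intro g
      have : ((MvPolynomial.eval₂Hom ι ![u, v]).comp (MvPolynomial.eval₂Hom MvPolynomial.C
          ![C p0 + C σ * X 0, C p1 + X 1])) = MvPolynomial.eval₂Hom ι ![ι p0 + ι σ * u, ι p1 + v] := by
        apply MvPolynomial.ringHom_ext
        · intro r; simp
        · intro i; fin_cases i <;> simp
      rw [ev2_Φ]
      exact congrArg (fun f => f g) this
    have hder : ∀ g : A2, pderiv (1 : Fin 2) (MvPolynomial.eval₂Hom MvPolynomial.C ![C p0 + C σ * X 0, C p1 + X 1] g) =
        MvPolynomial.eval₂Hom MvPolynomial.C ![C p0 + C σ * X 0, C p1 + X 1] (pderiv 1 g) := by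
      intro g
      induction g using MvPolynomial.induction_on with
      | C a => simp
      | add p q hp hq => simp only [map_add, hp, hq]
      | mul_X p i hp =>
        rw [map_mul, Derivation.leibniz, hp, Derivation.leibniz]
        fin_cases i
        · simp [pderiv_X]
        · simp [pderiv_X]
    refine ⟨by rw [hcomp]; simp, ?_⟩
    rw [Φ_deriv]
    rw [hder]
    rw [hcomp]

def chart1 (σ v1 : ℝ) (hσ : σ ≠ 0) : Chart where
  cx L _ ι u := ι σ / u
  cy L _ ι u v := (v + ι v1) / u
  tr u h := by
    rw [ιL_eq] at h
    have h1 := h.inv.mul (isAlgebraic_algebraMap (R := ℝ) (A := LL) σ)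
    have : algebraMap ℝ LL σ ≠ 0 := by simpa using hσ
    rw [inv_div, div_mul_cancel₀ _ this] at h1
    exact h1
  k := 1
  G g := by
    induction g using MvPolynomial.induction_on with
    | C a =>
      refine ⟨Polynomial.C (Polynomial.C a), 0, ?_⟩
      intro L _ ι u v _
      simp [ev2]
    | add p q hp hq =>
      obtain ⟨G, n, h⟩ := hp
      obtain ⟨G', n', h'⟩ := hq
      refine ⟨Polynomial.C (Polynomial.X ^ n') * G + Polynomial.C (Polynomial.X ^ n) * G', n + n', ?_⟩
      intro L _ ι u v hu
      obtain ⟨h1, h2⟩ := h L ι u v hu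
      obtain ⟨h1', h2'⟩ := h' L ι u v hu
      have hX : ∀ n, ev2 ι u v (Polynomial.C (Polynomial.X ^ n)) = u ^ n := by
        intro n; rw [map_pow, map_pow]; simp [ev2]
      rw [Polynomial.derivative_add, Polynomial.derivative_C_mul, Polynomial.derivative_C_mul]
      simp only [map_add, map_mul, hX, MvPolynomial.eval₂_add, h1, h1']
      constructor
      · ring
      · linear_combination u ^ n' * h2 + u ^ n * h2'
    | mul_X p i hp =>
      obtain ⟨G, n, h⟩ := hp
      fin_cases i
      · refine ⟨Polynomial.C (Polynomial.C σ) * G, n + 1, ?_⟩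
        intro L _ ι u v hu
        obtain ⟨h1, h2⟩ := h L ι u v hu
        have hX : ev2 ι u v (Polynomial.C (Polynomial.C σ)) = ι σ := by simp [ev2]
        rw [Polynomial.derivative_C_mul, Derivation.leibniz]
        simp only [map_mul, hX, h1, MvPolynomial.eval₂_mul]
        constructor
        · simp [pow_succ]; field_simp
        · simp [pderiv_X, pow_succ]
          field_simp
          simp at h2
          linear_combination ι σ * h2
      · refine ⟨G * (Polynomial.X + Polynomial.C (Polynomial.C v1)), n + 1, ?_⟩
        intro L _ ι u v hu
        obtain ⟨h1, h2⟩ := h L ι u v hu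
        have hX : ev2 ι u v (Polynomial.X + Polynomial.C (Polynomial.C v1)) = v + ι v1 := by simp [ev2]
        have hY : ev2 ι u v (Polynomial.derivative (Polynomial.X + Polynomial.C (Polynomial.C v1))) = 1 := by
          simp
        rw [Polynomial.derivative_mul, Derivation.leibniz]
        rw [map_add, map_mul, map_mul, map_mul, hX, hY, h1, MvPolynomial.eval₂_mul]
        constructor
        · simp [pow_succ]; field_simp
        · simp [pderiv_X, pow_succ]
          field_simp
          simp at h2
          linear_combination (v + ι v1) * h2

end Sch

namespace Sch

def sw : A2 ≃ₐ[ℝ] A2 := renameEquiv ℝ (Equiv.swap (0 : Fin 2) 1)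

theorem sw_sw (g : A2) : sw (sw g) = g := by
  simp only [sw, renameEquiv_apply, rename_rename]
  have : (⇑(Equiv.swap (0 : Fin 2) 1) ∘ ⇑(Equiv.swap (0 : Fin 2) 1)) = id := by
    funext i; simp
  rw [this]
  simp

theorem eval_sw (p : Fin 2 → ℝ) (g : A2) : eval p (sw g) = eval ![p 1, p 0] g := by
  simp only [sw, renameEquiv_apply]
  rw [eval_rename]
  congr 2
  ext i; fin_cases i <;> simp

theorem sw_X0 : sw (X 0) = X 1 := by simp [sw]
theorem sw_X1 : sw (X 1) = X 0 := by simp [sw]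
theorem sw_C (a : ℝ) : sw (C a) = C a := by simp [sw]

theorem squarefree_sw {g : A2} (h : Squarefree g) : Squarefree (sw g) := by
  intro x hx
  have : sw x * sw x ∣ g := by
    rw [← map_mul, ← sw_sw g]
    exact map_dvd sw hx
  have := (h _ this).map sw
  rwa [sw_sw] at this

theorem relprime_sw {g h : A2} (hr : IsRelPrime g h) : IsRelPrime (sw g) (sw h) := by
  intro x h1 h2
  have h1' := map_dvd sw h1
  have h2' := map_dvd sw h2
  rw [sw_sw] at h1' h2'
  have := (hr h1' h2').map sw
  rwa [sw_sw] at this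

section
variable {F : Type} [Field F] [LinearOrder F] [IsStrictOrderedRing F]

def Fin_ (ι : ℝ →+* F) (a : F) : Prop := ∃ M : ℝ, |a| ≤ ι M

theorem phi_eq (φ : A2 →+* F) (g : A2) :
    φ g = MvPolynomial.eval₂ (φ.comp C) ![φ (X 0), φ (X 1)] g := by
  have : φ = MvPolynomial.eval₂Hom (φ.comp C) ![φ (X 0), φ (X 1)] := by
    apply MvPolynomial.ringHom_ext
    · intro r; simp
    · intro i; fin_cases i <;> simp
  exact congrArg (fun f => f g) this

theorem AL2a {I : Type} [Fintype I] (g : I → A2) (hsq : ∀ i, Squarefree (g i))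
    (hcop : ∀ i j, i ≠ j → IsRelPrime (g i) (g j)) (φ : A2 →+* F) (p : Fin 2 → ℝ)
    (h0 : Inf (φ.comp C) (φ (X 0) - φ (C (p 0)))) (h1 : Inf (φ.comp C) (φ (X 1) - φ (C (p 1))))
    (hne : φ (X 0) ≠ φ (C (p 0))) (ε : ℝ) (hε : 0 < ε) :
    ∃ p' : Fin 2 → ℝ, p' ≠ p ∧ (∀ i, |p' i - p i| < ε) ∧ ∀ i, 0 ≤ φ (g i) → 0 ≤ eval p' (g i) := by
  obtain ⟨σ, hσ, hs⟩ := exists_sgn (φ.comp C) (φ (X 0) - φ (C (p 0)))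
  have hσ0 : σ ≠ 0 := by rintro rfl; simp at hσ
  obtain ⟨u0, v0, a1, a2, a3, a4⟩ := ALc (chart2 (p 0) (p 1) σ hσ0) g hsq hcop (φ.comp C)
    |φ (X 0) - φ (C (p 0))| (φ (X 1) - φ (C (p 1))) (abs_pos.2 (sub_ne_zero.2 hne))
    (fun e he => by rw [abs_abs]; exact h0 e he) h1 ε hε
  simp only [chart2, RingHom.id_apply] at a4
  refine ⟨![p 0 + σ * u0, p 1 + v0], ?_, ?_, fun i hi => a4 i ?_⟩
  · intro h
    have := congrFun h 0
    simp [hσ0, a1.ne'] at this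
  · intro i
    fin_cases i
    · simp [abs_mul, hσ, abs_of_pos a1, a2]
    · simpa using a3
  · rw [← hs]
    simp only [RingHom.comp_apply, add_sub_cancel]
    rw [← phi_eq]; exact hi

theorem AL1a {I : Type} [Fintype I] (g : I → A2) (hsq : ∀ i, Squarefree (g i))
    (hcop : ∀ i j, i ≠ j → IsRelPrime (g i) (g j)) (φ : A2 →+* F)
    (h0 : ¬ Fin_ (φ.comp C) (φ (X 0))) (h1 : |φ (X 1)| ≤ |φ (X 0)|) (R : ℝ) :
    ∃ p' : Fin 2 → ℝ, R ≤ p' 0 ^ 2 + p' 1 ^ 2 ∧ ∀ i, 0 ≤ φ (g i) → 0 ≤ eval p' (g i) := by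
  set ι := φ.comp C with hι
  obtain ⟨σ, hσ, hs⟩ := exists_sgn ι (φ (X 0))
  have hσ0 : σ ≠ 0 := by rintro rfl; simp at hσ
  have hbig : ∀ M, ι M < |φ (X 0)| := by
    intro M
    by_contra hc
    exact h0 ⟨M, not_lt.1 hc⟩
  have hpos : 0 < |φ (X 0)| := by simpa using hbig 0
  set u := |φ (X 0)|⁻¹ with hu
  have hu0 : 0 < u := inv_pos.2 hpos
  have huinf : Inf ι u := by
    intro e he
    have he' : 0 < ι e := by simpa using iota_lt ι he
    rw [abs_of_pos hu0, hu, inv_le_comm₀ hpos he', ← map_inv₀]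
    exact (hbig _).le
  have hfin : |φ (X 1) * u| ≤ ι 1 := by
    rw [abs_mul, abs_of_pos hu0, hu, ← div_eq_mul_inv, map_one, div_le_one hpos]
    exact h1
  have hvinf := st_spec ι _ 1 hfin
  set v1 := st ι (φ (X 1) * u)
  have hε : 0 < (1 + |R|)⁻¹ := by positivity
  obtain ⟨u0, v0, a1, a2, a3, a4⟩ := ALc (chart1 σ v1 hσ0) g hsq hcop ι u (φ (X 1) * u - ι v1) hu0 huinf hvinf
    (1 + |R|)⁻¹ hε
  simp only [chart1, RingHom.id_apply, sub_add_cancel] at a4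
  refine ⟨![σ / u0, (v0 + v1) / u0], ?_, fun i hi => a4 i ?_⟩
  · have h2 : R ≤ (σ / u0) ^ 2 := by
      have h3 : 1 + |R| < u0⁻¹ := by
        rw [lt_inv_comm₀ (by positivity) a1]; exact a2
      have h4 : (σ / u0) ^ 2 = (u0⁻¹) ^ 2 := by
        rw [div_eq_mul_inv, mul_pow, ← sq_abs σ, hσ]; ring
      rw [h4]
      have := le_abs_self R
      have := abs_nonneg R
      nlinarith
    simp only [Matrix.cons_val_zero, Matrix.cons_val_one]
    have := sq_nonneg ((v0 + v1) / u0)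
    linarith
  · have e1 : ι σ / u = φ (X 0) := by
      rw [hu, div_inv_eq_mul]; exact hs.symm
    have e2 : φ (X 1) * u / u = φ (X 1) := mul_div_cancel_right₀ _ hu0.ne'
    rw [e1, e2, ← phi_eq]; exact hi

theorem sw_phi (φ : A2 →+* F) : (φ.comp (sw : A2 →+* A2)).comp C = φ.comp C := by
  ext1 r; simp [sw_C]

theorem AL2 {I : Type} [Fintype I] (g : I → A2) (hsq : ∀ i, Squarefree (g i))
    (hcop : ∀ i j, i ≠ j → IsRelPrime (g i) (g j)) (φ : A2 →+* F) (p : Fin 2 → ℝ)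
    (h0 : Inf (φ.comp C) (φ (X 0) - φ (C (p 0)))) (h1 : Inf (φ.comp C) (φ (X 1) - φ (C (p 1))))
    (hne : φ (X 0) ≠ φ (C (p 0)) ∨ φ (X 1) ≠ φ (C (p 1))) (ε : ℝ) (hε : 0 < ε) :
    ∃ p' : Fin 2 → ℝ, p' ≠ p ∧ (∀ i, |p' i - p i| < ε) ∧ ∀ i, 0 ≤ φ (g i) → 0 ≤ eval p' (g i) := by
  rcases hne with hne | hne
  · exact AL2a g hsq hcop φ p h0 h1 hne ε hε
  · obtain ⟨p', a1, a2, a3⟩ := AL2a (fun i => sw (g i)) (fun i => squarefree_sw (hsq i))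
      (fun i j hij => relprime_sw (hcop i j hij)) (φ.comp (sw : A2 →+* A2)) ![p 1, p 0]
      (by rw [sw_phi]; simpa [sw_X0, sw_C] using h1) (by rw [sw_phi]; simpa [sw_X1, sw_C] using h0)
      (by simpa [sw_X0, sw_C] using hne) ε hε
    refine ⟨![p' 1, p' 0], ?_, ?_, ?_⟩
    · rintro rfl
      apply a1
      ext i; fin_cases i <;> simp
    · intro i
      fin_cases i
      · simpa using a2 1
      · simpa using a2 0
    · intro i hi
      rw [← eval_sw]
      apply a3
      simpa [sw_sw] using hi

theorem AL1 {I : Type} [Fintype I] (g : I → A2) (hsq : ∀ i, Squarefree (g i))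
    (hcop : ∀ i j, i ≠ j → IsRelPrime (g i) (g j)) (φ : A2 →+* F)
    (h0 : ¬ (Fin_ (φ.comp C) (φ (X 0)) ∧ Fin_ (φ.comp C) (φ (X 1)))) (R : ℝ) :
    ∃ p' : Fin 2 → ℝ, R ≤ p' 0 ^ 2 + p' 1 ^ 2 ∧ ∀ i, 0 ≤ φ (g i) → 0 ≤ eval p' (g i) := by
  rcases le_total |φ (X 1)| |φ (X 0)| with h | h
  · refine AL1a g hsq hcop φ ?_ h R
    rintro ⟨M, hM⟩
    exact h0 ⟨⟨M, hM⟩, ⟨M, h.trans hM⟩⟩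
  · obtain ⟨p', a1, a3⟩ := AL1a (fun i => sw (g i)) (fun i => squarefree_sw (hsq i))
      (fun i j hij => relprime_sw (hcop i j hij)) (φ.comp (sw : A2 →+* A2))
      (by
        rw [sw_phi]
        rintro ⟨M, hM⟩
        simp only [RingHom.comp_apply, RingHom.coe_coe, sw_X0] at hM
        exact h0 ⟨⟨M, h.trans hM⟩, ⟨M, hM⟩⟩) (by simpa [sw_X0, sw_X1] using h) R
    refine ⟨![p' 1, p' 0], by simpa [add_comm] using a1, fun i hi => ?_⟩
    rw [← eval_sw]
    apply a3
    simpa [sw_sw] using hi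

/-- if both coordinates are near a real point, values are near -/
theorem inf_eval (φ : A2 →+* F) (p : Fin 2 → ℝ)
    (h0 : Inf (φ.comp C) (φ (X 0) - φ (C (p 0)))) (h1 : Inf (φ.comp C) (φ (X 1) - φ (C (p 1)))) (g : A2) :
    Inf (φ.comp C) (φ g - φ (C (eval p g))) := by
  set ι := φ.comp C with hι
  have hC : ∀ r, φ (C r) = ι r := fun _ => rfl
  simp only [hC] at h0 h1 ⊢
  have hadd : ∀ a b : F, Inf ι a → Inf ι b → Inf ι (a + b) := by
    intro a b ha hb e he
    have := ha (e / 2) (by linarith)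
    have := hb (e / 2) (by linarith)
    have h3 : ι e = ι (e / 2) + ι (e / 2) := by rw [← map_add]; congr 1; ring
    rw [h3]
    exact (abs_add_le _ _).trans (by linarith)
  have hmul : ∀ a b : F, Inf ι a → Fin_ ι b → Inf ι (a * b) := by
    rintro a b ha ⟨M, hM⟩ e he
    have h2 := ha (e / (1 + |M|)) (by positivity)
    have h3 : |b| ≤ ι (1 + |M|) := hM.trans (iota_mono ι (by linarith [le_abs_self M]))
    rw [abs_mul]
    calc |a| * |b| ≤ ι (e / (1 + |M|)) * ι (1 + |M|) :=
          mul_le_mul h2 h3 (abs_nonneg _) (iota_nonneg ι (by positivity))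
      _ = ι e := by rw [← map_mul]; congr 1; field_simp
  have hfin : ∀ a (r : ℝ), Inf ι (a - ι r) → Fin_ ι a := by
    intro a r h
    refine ⟨1 + |r|, ?_⟩
    have h2 := h 1 one_pos
    have h3 : a = (a - ι r) + ι r := by ring
    rw [h3, map_add, ← iota_abs]
    exact (abs_add_le _ _).trans (by linarith)
  have hmul2 : ∀ a b (r s : ℝ), Inf ι (a - ι r) → Inf ι (b - ι s) → Inf ι (a * b - ι (r * s)) := by
    intro a b r s ha hb
    have : a * b - ι (r * s) = (a - ι r) * b + (b - ι s) * ι r := by rw [map_mul]; ring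
    rw [this]
    exact hadd _ _ (hmul _ _ ha (hfin _ _ hb)) (hmul _ _ hb ⟨|r|, by rw [iota_abs]⟩)
  induction g using MvPolynomial.induction_on with
  | C a =>
    intro e he
    simp only [eval_C, hC, sub_self, abs_zero]
    exact iota_nonneg ι he.le
  | add f g hf hg =>
    have := hadd _ _ hf hg
    convert this using 1
    simp only [map_add]; ring
  | mul_X f i hf =>
    rw [map_mul, map_mul, eval_X]
    apply hmul2 _ _ _ _ hf
    fin_cases i
    · exact h0
    · exact h1

theorem inf_nonneg (ι : ℝ →+* F) (a : F) (r : ℝ) (h : Inf ι (a - ι r)) (ha : 0 ≤ a) : 0 ≤ r := by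
  by_contra hr
  rw [not_le] at hr
  have h1 := (abs_le.1 (h (-r / 2) (by linarith))).2
  have h2 : ι (-r / 2) < ι (-r) := iota_lt ι (by linarith)
  rw [map_neg] at h2
  linarith

end

end Sch

namespace Sch

theorem IsPre.C_mem {T : Set A2} (hT : IsPre T) {r : ℝ} (h : 0 ≤ r) : (C r : A2) ∈ T := by
  have := hT.sq (C (Real.sqrt r) : A2)
  rwa [← map_pow, Real.sq_sqrt h] at this

theorem Chalf : (C (1/2) : A2) * 2 = 1 := by
  rw [show (2 : A2) = C 2 from (map_ofNat C 2).symm, ← C_mul]; norm_num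

theorem arch_of_ball {T : Set A2} (hT : IsPre T) (R : ℝ) (hR : C R - X 0 ^ 2 - X 1 ^ 2 ∈ T) (f : A2) :
    ∃ N : ℝ, 0 ≤ N ∧ C N - f ∈ T ∧ C N + f ∈ T := by
  have hX : ∀ i : Fin 2, C R - X i ^ 2 ∈ T → ∃ N : ℝ, 0 ≤ N ∧ C N - X i ∈ T ∧ C N + X i ∈ T := by
    intro i hi
    have hi : C |R| - X i ^ 2 ∈ T := by
      have := hT.add hi (hT.C_mem (r := |R| - R) (by linarith [le_abs_self R]))
      convert this using 1
      rw [C_sub]; ring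
    have hh : (C (1/2) : A2) * 2 = 1 := Chalf
    refine ⟨(|R| + 1) / 2, by positivity, ?_, ?_⟩
    · have := hT.mul (hT.C_mem (r := 1/2) (by norm_num)) (hT.add hi (hT.sq (X i - 1)))
      convert this using 1
      rw [show (|R| + 1) / 2 = 1/2 * |R| + 1/2 by ring, C_add, C_mul]
      linear_combination (X i : A2) * hh
    · have := hT.mul (hT.C_mem (r := 1/2) (by norm_num)) (hT.add hi (hT.sq (X i + 1)))
      convert this using 1
      rw [show (|R| + 1) / 2 = 1/2 * |R| + 1/2 by ring, C_add, C_mul]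
      linear_combination (X i : A2) * hh * (-1)
  induction f using MvPolynomial.induction_on with
  | C a =>
    refine ⟨|a|, abs_nonneg _, ?_, ?_⟩
    · rw [← C_sub]; exact hT.C_mem (by linarith [le_abs_self a])
    · rw [← C_add]; exact hT.C_mem (by linarith [neg_abs_le a])
  | add f g hf hg =>
    obtain ⟨N, hN, h1, h2⟩ := hf
    obtain ⟨M, hM, h3, h4⟩ := hg
    refine ⟨N + M, by positivity, ?_, ?_⟩
    · convert hT.add h1 h3 using 1; rw [C_add]; ring
    · convert hT.add h2 h4 using 1; rw [C_add]; ring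
  | mul_X f i hf =>
    obtain ⟨N, hN, h1, h2⟩ := hf
    have : ∃ N : ℝ, 0 ≤ N ∧ C N - X i ∈ T ∧ C N + X i ∈ T := by
      apply hX
      fin_cases i
      · convert hT.add hR (hT.sq (X 1)) using 1; simp only [Fin.zero_eta]; ring
      · convert hT.add hR (hT.sq (X 0)) using 1; simp only [Fin.mk_one]; ring
    obtain ⟨M, hM, h3, h4⟩ := this
    have hh : (C (1/2) : A2) * 2 = 1 := Chalf
    refine ⟨N * M, by positivity, ?_, ?_⟩
    · convert hT.mul (hT.C_mem (r := 1/2) (by norm_num)) (hT.add (hT.mul h1 h4) (hT.mul h2 h3)) using 1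
      rw [C_mul]
      linear_combination (-(C N * C M - f * X i)) * hh
    · convert hT.mul (hT.C_mem (r := 1/2) (by norm_num)) (hT.add (hT.mul h1 h3) (hT.mul h2 h4)) using 1
      rw [C_mul]
      linear_combination (-(C N * C M + f * X i)) * hh

section
variable {J : Type} [Fintype J] (g : J → A2)

/-- the basic closed set -/
def KS : Set (Fin 2 → ℝ) := {p | ∀ j, 0 ≤ eval p (g j)}

theorem place (hirr : ∀ j, Irreducible (g j)) (hcop : ∀ i j, i ≠ j → IsRelPrime (g i) (g j))
    (hb : Bornology.IsBounded (KS g)) {F : Type} [Field F] [LinearOrder F] [IsStrictOrderedRing F]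
    (φ : A2 →+* F) (hφ : ∀ j, 0 ≤ φ (g j)) :
    ∃ p ∈ KS g, Inf (φ.comp C) (φ (X 0) - φ (C (p 0))) ∧ Inf (φ.comp C) (φ (X 1) - φ (C (p 1))) := by
  have hfin : Fin_ (φ.comp C) (φ (X 0)) ∧ Fin_ (φ.comp C) (φ (X 1)) := by
    by_contra hc
    obtain ⟨R, hR⟩ := hb.exists_norm_le
    obtain ⟨p, hp, hp'⟩ := AL1 g (fun j => (hirr j).squarefree) hcop φ hc (2 * R ^ 2 + 1)
    have hn := hR p (fun j => hp' j (hφ j))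
    have h0 := (norm_le_pi_norm p 0).trans hn
    have h1 := (norm_le_pi_norm p 1).trans hn
    rw [Real.norm_eq_abs] at h0 h1
    have := sq_le_sq' (abs_le.1 h0).1 (abs_le.1 h0).2
    have := sq_le_sq' (abs_le.1 h1).1 (abs_le.1 h1).2
    linarith
  obtain ⟨⟨M, hM⟩, ⟨M', hM'⟩⟩ := hfin
  have a0 := st_spec _ _ M hM
  have a1 := st_spec _ _ M' hM'
  set p : Fin 2 → ℝ := ![st (φ.comp C) (φ (X 0)), st (φ.comp C) (φ (X 1))]
  have b0 : Inf (φ.comp C) (φ (X 0) - φ (C (p 0))) := a0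
  have b1 : Inf (φ.comp C) (φ (X 1) - φ (C (p 1))) := a1
  refine ⟨p, ?_, b0, b1⟩
  intro j
  exact inf_nonneg _ _ _ (inf_eval φ p b0 b1 (g j)) (hφ j)

variable (hirr : ∀ j, Irreducible (g j)) (hcop : ∀ i j, i ≠ j → IsRelPrime (g i) (g j))
    (hb : Bornology.IsBounded (KS g)) {T : Set A2} (hT : IsPre T) (hg : ∀ j, g j ∈ T)
include hirr hcop hb hT hg

theorem weak_psatz (f : A2) (hf : ∀ p ∈ KS g, 0 < eval p f) :
    ∃ s ∈ T, ∃ t ∈ T, f * t = 1 + s := by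
  by_contra hc
  have := ps _ (hT.ext (-f)) 1 (by
    intro k hk
    simp only [one_pow] at hk
    obtain ⟨x, hx, y, hy, h⟩ := hk
    exact hc ⟨x, hx, y, hy, by linear_combination h⟩)
  obtain ⟨F, _, _, _, φ, h1, _⟩ := this
  have hTφ : ∀ t ∈ T, 0 ≤ φ t := fun t ht => h1 t ⟨t, ht, 0, hT.zero, by ring⟩
  have hfφ : 0 ≤ φ (-f) := h1 _ ⟨0, hT.zero, 1, hT.one, by ring⟩
  obtain ⟨p, hp, a0, a1⟩ := place g hirr hcop hb φ (fun j => hTφ _ (hg j))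
  have := inf_nonneg _ _ _ (inf_eval φ p a0 a1 (-f)) hfφ
  have := hf p hp
  rw [map_neg] at *
  linarith

theorem arch (f : A2) : ∃ N : ℝ, 0 ≤ N ∧ C N - f ∈ T ∧ C N + f ∈ T := by
  obtain ⟨R, hR⟩ := hb.exists_norm_le
  set r := 2 * R ^ 2 + 1
  set ρ : A2 := C r - X 0 ^ 2 - X 1 ^ 2
  obtain ⟨t0, h0, t1, h1, he⟩ := weak_psatz g hirr hcop hb hT hg ρ (by
    intro p hp
    have hn := hR p hp
    have h0 := (norm_le_pi_norm p 0).trans hn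
    have h1 := (norm_le_pi_norm p 1).trans hn
    rw [Real.norm_eq_abs] at h0 h1
    have := sq_le_sq' (abs_le.1 h0).1 (abs_le.1 h0).2
    have := sq_le_sq' (abs_le.1 h1).1 (abs_le.1 h1).2
    simp [ρ]
    linarith)
  have hρ : (1 + t0) * ρ ∈ T := by
    have : (1 + t0) * ρ = ρ ^ 2 * t1 := by rw [← he]; ring
    rw [this]; exact hT.mul (hT.sq _) h1
  have hr : 0 ≤ r := by positivity
  set S : Set A2 := ((Subsemiring.closure {a : A2 | ∃ b, a = b ^ 2} : Subsemiring A2) : Set A2)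
  have hS : IsPre S := ⟨fun h h' => add_mem (S := Subsemiring A2) h h', fun h h' => mul_mem (S := Subsemiring A2) h h',
    fun a => Subsemiring.subset_closure ⟨a, rfl⟩⟩
  have hST : ∀ x ∈ S, x ∈ T := by
    intro x hx
    induction hx using Subsemiring.closure_induction with
    | mem x h => obtain ⟨b, rfl⟩ := h; exact hT.sq b
    | zero => exact hT.zero
    | one => exact hT.one
    | add x y _ _ h h' => exact hT.add h h'
    | mul x y _ _ h h' => exact hT.mul h h'
  obtain ⟨N, hN, h2, -⟩ := arch_of_ball (hS.ext ρ) r ⟨0, hS.zero, 1, hS.one, by simp [ρ]⟩ t0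
  obtain ⟨x, hx, y, hy, hxy⟩ := h2
  have h1t : 1 + t0 ∈ T := hT.add hT.one h0
  have h3 : (1 + t0) * (C N - t0) ∈ T := by
    rw [hxy]
    convert hT.add (hT.mul h1t (hST _ hx)) (hT.mul hρ (hST _ hy)) using 1
    ring
  have hh : (C (1/2) : A2) * 2 = 1 := Chalf
  have h4 : C (N + N ^ 2 / 4) - t0 ∈ T := by
    convert hT.add h3 (hT.sq (C (1/2) * C N - t0)) using 1
    rw [show N + N ^ 2 / 4 = N + (1/2 * N) ^ 2 by ring, C_add, C_pow, C_mul]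
    linear_combination (t0 * C N) * hh
  have h5 : ρ + C r * t0 ∈ T := by
    convert hT.add hρ (hT.mul h0 (hT.add (hT.sq (X 0)) (hT.sq (X 1)))) using 1
    simp only [ρ]; ring
  refine arch_of_ball hT (r + r * (N + N ^ 2 / 4)) ?_ f
  convert hT.add h5 (hT.mul (hT.C_mem hr) h4) using 1
  rw [C_add, C_mul]; ring

theorem KD (f : A2) (hf : ∀ p ∈ KS g, 0 < eval p f) : f ∈ T := by
  obtain ⟨s, hs, t, ht, he⟩ := weak_psatz g hirr hcop hb hT hg f hf
  obtain ⟨N, hN, h1, -⟩ := arch g hirr hcop hb hT hg t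
  obtain ⟨r, hr, -, h2⟩ := arch g hirr hcop hb hT hg f
  have h1 : C (N + 1) - t ∈ T := by
    convert hT.add h1 hT.one using 1
    rw [C_add, C_1]; ring
  have key : ∀ k : ℕ, C (max (r - k * (1 / (N + 1))) 0) + f ∈ T := by
    intro k
    induction k with
    | zero => simpa [hr] using h2
    | succ k ih =>
      set r' := max (r - k * (1 / (N + 1))) 0
      have hr' : 0 ≤ r' := le_max_right _ _
      have h3 : C (r' - 1 / (N + 1)) + f ∈ T := by
        have := hT.mul (hT.C_mem (r := 1 / (N + 1)) (by positivity))
          (hT.add (hT.mul h1 ih) (hT.add hs (hT.mul (hT.C_mem hr') ht)))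
        convert this using 1
        have hh : (C (1 / (N + 1)) : A2) * C (N + 1) = 1 := by
          rw [← C_mul, one_div_mul_cancel (by positivity), C_1]
        rw [C_sub]
        linear_combination (-(f + C r')) * hh + C (1 / (N + 1)) * he
      have h4 := hT.add h3 (hT.C_mem (r := max (r - (k + 1 : ℕ) * (1 / (N + 1))) 0 - (r' - 1 / (N + 1))) (by
        rw [sub_nonneg]
        simp only [r']
        push_cast
        rcases le_total (r - k * (1 / (N + 1))) 0 with h | h
        · rw [max_eq_right h]
          refine le_trans ?_ (le_max_right _ _)
          have : 0 ≤ 1 / (N + 1) := by positivity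
          linarith
        · rw [max_eq_left h]
          refine le_trans ?_ (le_max_left _ _)
          linarith))
      convert h4 using 1
      rw [add_right_comm, ← C_add, add_sub_cancel]
  obtain ⟨k, hk⟩ := exists_nat_ge (r * (N + 1))
  have := key k
  rw [max_eq_right] at this
  · simpa using this
  · rw [mul_one_div, sub_nonpos, le_div_iff₀ (by positivity)]
    exact hk

end

end Sch

namespace Sch

theorem isolate (Z : Set (Fin 2 → ℝ)) (hZ : Z.Finite) (p : Fin 2 → ℝ) :
    ∃ ε > 0, ∀ q ∈ Z, (∀ i, |q i - p i| < ε) → q = p := by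
  have : (Z \ {p})ᶜ ∈ nhds p := (hZ.subset Set.diff_subset).isClosed.isOpen_compl.mem_nhds (by simp)
  obtain ⟨ε, hε, h⟩ := Metric.mem_nhds_iff.1 this
  refine ⟨ε, hε, fun q hq hd => ?_⟩
  by_contra hne
  have : q ∈ Metric.ball p ε := by
    rw [Metric.mem_ball, dist_pi_lt_iff hε]
    intro i; rw [Real.dist_eq]; exact hd i
  exact h this ⟨hq, hne⟩

section
variable {J : Type} [Fintype J] (g : J → A2)
variable (hirr : ∀ j, Irreducible (g j)) (hcop : ∀ i j, i ≠ j → IsRelPrime (g i) (g j))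
    (hb : Bornology.IsBounded (KS g)) {T : Set A2} (hT : IsPre T) (hg : ∀ j, g j ∈ T)
include hirr hcop hb hT hg

theorem loj0 (f : A2) (hf : ∀ p ∈ KS g, 0 ≤ eval p f) (hsq : Squarefree f)
    (hfg : ∀ j, IsRelPrime f (g j)) (hZ : {p | p ∈ KS g ∧ eval p f = 0}.Finite) (D : A2)
    (hD : ∀ p ∈ KS g, eval p f = 0 → eval p D = 0) :
    ∃ k, ∃ s ∈ T, ∃ t ∈ T, f * t = D ^ (2 * k) + s := by
  by_contra hc
  have := ps _ (hT.ext (-f)) D (by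
    intro k hk
    obtain ⟨x, hx, y, hy, h⟩ := hk
    exact hc ⟨k, x, hx, y, hy, by linear_combination h⟩)
  obtain ⟨F, _, _, _, φ, h1, hφD⟩ := this
  have hTφ : ∀ t ∈ T, 0 ≤ φ t := fun t ht => h1 t ⟨t, ht, 0, hT.zero, by ring⟩
  have hfφ : 0 ≤ φ (-f) := h1 _ ⟨0, hT.zero, 1, hT.one, by ring⟩
  obtain ⟨p, hp, a0, a1⟩ := place g hirr hcop hb φ (fun j => hTφ _ (hg j))
  have hfp := inf_nonneg _ _ _ (inf_eval φ p a0 a1 (-f)) hfφ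
  have hfp2 := hf p hp
  rw [map_neg] at hfp
  have hfp0 : eval p f = 0 := by linarith
  have hDp := hD p hp hfp0
  have hne : φ (X 0) ≠ φ (C (p 0)) ∨ φ (X 1) ≠ φ (C (p 1)) := by
    by_contra hcon
    push Not at hcon
    apply hφD
    have : φ D = φ (C (eval p D)) := by
      have h : φ = (φ.comp C).comp (eval p) := by
        apply MvPolynomial.ringHom_ext
        · intro r; simp
        · intro i; fin_cases i <;> simp [hcon]
      exact congrArg (fun f => f D) h
    rw [this, hDp]; simp
  obtain ⟨ε, hε, hiso⟩ := isolate _ hZ p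
  obtain ⟨p', b1, b2, b3⟩ := AL2 (fun o : Option J => o.elim (-f) g)
    (by rintro (_ | j)
        · exact (Associated.neg_left (Associated.refl f)).squarefree_iff.2 hsq
        · exact (hirr j).squarefree)
    (by rintro (_ | i) (_ | j) hij
        · exact absurd rfl hij
        · exact (hfg j).neg_left
        · exact (hfg i).symm.neg_right
        · exact hcop i j (fun h => hij (by rw [h]))) φ p a0 a1 hne ε hε
  have hp' : p' ∈ KS g := fun j => b3 (some j) (hTφ _ (hg j))
  have h5 := b3 none hfφ
  have h6 := hf p' hp'
  simp only [Option.elim, map_neg] at h5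
  exact b1 (hiso p' ⟨hp', by linarith⟩ b2)

theorem eval_T_nonneg_bdd (t : A2) : ∃ M : ℝ, ∀ p ∈ KS g, |eval p t| ≤ M := by
  obtain ⟨R, hR⟩ := hb.exists_norm_le
  have hc : IsCompact (Metric.closedBall (0 : Fin 2 → ℝ) R) := isCompact_closedBall _ _
  have hcont : ContinuousOn (fun p : Fin 2 → ℝ => eval p t) (Metric.closedBall (0 : Fin 2 → ℝ) R) :=
    (MvPolynomial.continuous_eval t).continuousOn
  obtain ⟨M, hM⟩ := hc.exists_bound_of_continuousOn hcont
  exact ⟨M, fun p hp => hM p (by simpa using hR p hp)⟩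

theorem loj (hTK : ∀ t ∈ T, ∀ p ∈ KS g, 0 ≤ eval p t)
    (f : A2) (hf : ∀ p ∈ KS g, 0 ≤ eval p f) (hsq : Squarefree f)
    (hfg : ∀ j, IsRelPrime f (g j)) (hZ : {p | p ∈ KS g ∧ eval p f = 0}.Finite) (D : A2)
    (hD : ∀ p ∈ KS g, eval p f = 0 → eval p D = 0) :
    ∃ k, ∃ c > 0, ∀ p ∈ KS g, c * eval p D ^ (2 * k) ≤ eval p f := by
  obtain ⟨k, s, hs, t, ht, he⟩ := loj0 g hirr hcop hb hT hg f hf hsq hfg hZ D hD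
  obtain ⟨M, hM⟩ := eval_T_nonneg_bdd g hirr hcop hb hT hg t
  refine ⟨k, 1 / (|M| + 1), by positivity, fun p hp => ?_⟩
  have h1 := hTK s hs p hp
  have h2 := congrArg (eval p) he
  simp only [map_mul, map_add, map_pow] at h2
  have h3 := hM p hp
  have h4 := hf p hp
  rw [one_div, inv_mul_le_iff₀ (by positivity)]
  have h5 : eval p t ≤ |M| + 1 := by linarith [le_abs_self (eval p t), le_abs_self M]
  nlinarith
end

end Sch

namespace Sch

abbrev cj : PowerSeries ℂ →+* PowerSeries ℂ := PowerSeries.map (starRingEnd ℂ)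

theorem cj_cj (a : PowerSeries ℂ) : cj (cj a) = a := by
  ext n; simp

theorem map_cj_cj (P : Polynomial (PowerSeries ℂ)) : (P.map cj).map cj = P := by
  rw [Polynomial.map_map]
  have : cj.comp cj = RingHom.id _ := RingHom.ext cj_cj
  rw [this, Polynomial.map_id]

theorem ex_coeff (q : ℕ) (hq : q ≠ 0) (a : PowerSeries ℂ) (n : ℕ) :
    PowerSeries.coeff n (ex q hq a) = if q ∣ n then PowerSeries.coeff (n / q) a else 0 := by
  simp [ex, PowerSeries.coeff_expand]

theorem ex_cj (q : ℕ) (hq : q ≠ 0) : (ex q hq).comp cj = cj.comp (ex q hq) := by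
  ext a n
  simp only [RingHom.comp_apply, ex_coeff, PowerSeries.coeff_map]
  split_ifs <;> simp

theorem ex_rescale (q : ℕ) (hq : q ≠ 0) (ω : ℂ) :
    (PowerSeries.rescale ω).comp (ex q hq) = (ex q hq).comp (PowerSeries.rescale (ω ^ q)) := by
  ext a n
  simp only [RingHom.comp_apply, ex_coeff, PowerSeries.coeff_rescale]
  split_ifs with h
  · obtain ⟨m, rfl⟩ := h
    rw [Nat.mul_div_cancel_left _ (Nat.pos_of_ne_zero hq), pow_mul]
  · simp

/-- invariance under the primitive root implies coming from `ex q`. -/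
theorem descend_coeff (q : ℕ) (hq : q ≠ 0) (ζ : ℂ) (hζ : IsPrimitiveRoot ζ q) (a : PowerSeries ℂ)
    (h : PowerSeries.rescale ζ a = a) : ∃ b, ex q hq b = a := by
  refine ⟨PowerSeries.mk fun n => PowerSeries.coeff (q * n) a, ?_⟩
  ext n
  rw [ex_coeff]
  split_ifs with hd
  · obtain ⟨m, rfl⟩ := hd
    simp [Nat.mul_div_cancel_left _ (Nat.pos_of_ne_zero hq)]
  · have h1 := congrArg (PowerSeries.coeff n) h
    rw [PowerSeries.coeff_rescale] at h1
    by_contra hne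
    apply hd
    apply (hζ.pow_eq_one_iff_dvd n).1
    exact mul_right_cancel₀ (Ne.symm hne) (by rw [h1, one_mul])

def NoReal (P : Polynomial (PowerSeries ℂ)) : Prop :=
  ∀ (q : ℕ) (hq : q ≠ 0) (σ : ℂ), (σ = 1 ∨ σ = -1) → ∀ ψ : PowerSeries ℂ, cj ψ = ψ →
    (P.map ((ex q hq).comp (PowerSeries.rescale σ))).eval ψ ≠ 0

theorem NoReal.of_dvd {P Q : Polynomial (PowerSeries ℂ)} (hP : NoReal P) (h : Q ∣ P) : NoReal Q := by
  obtain ⟨R, rfl⟩ := h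
  intro q hq σ hσ ψ hψ h0
  apply hP q hq σ hσ ψ hψ
  rw [Polynomial.map_mul, Polynomial.eval_mul, h0, zero_mul]

theorem not_selfconj (π : Polynomial (PowerSeries ℂ)) (hm : π.Monic) (hp : Prime π)
    (hr : NoReal π) : π.map cj ≠ π := by
  intro hc
  have hdeg : 0 < π.natDegree := by
    rw [Nat.pos_iff_ne_zero]
    intro h
    exact hp.not_isUnit (by rw [hm.natDegree_eq_zero.1 h]; exact isUnit_one)
  obtain ⟨q, hq, hs⟩ := puiseux _ π hm (Nat.lt_succ_self _)
  change (π.map (ex q hq)).Splits at hs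
  have hdq : (π.map (ex q hq)).degree ≠ 0 := by
    rw [hm.degree_map, Polynomial.degree_eq_natDegree hm.ne_zero]
    exact_mod_cast hdeg.ne'
  obtain ⟨ξ, hξ⟩ : ∃ ξ, (π.map (ex q hq)).eval ξ = 0 := by
    exact hs.exists_eval_eq_zero hdq
  set ζ := Complex.exp (2 * Real.pi * Complex.I / q) with hζd
  have hζ : IsPrimitiveRoot ζ q := Complex.isPrimitiveRoot_exp q hq
  set L : ℕ → Polynomial (PowerSeries ℂ) := fun j =>
    Polynomial.X - Polynomial.C (PowerSeries.rescale (ζ ^ j) ξ) with hL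
  set R := ∏ j ∈ Finset.range q, L j with hR
  have hLr : ∀ j, (L j).map (PowerSeries.rescale ζ) = L (j + 1) := by
    intro j
    simp only [hL, Polynomial.map_sub, Polynomial.map_X, Polynomial.map_C, PowerSeries.rescale_rescale]
    rw [pow_succ]
  have hLq : L q = L 0 := by
    simp only [hL, hζ.pow_eq_one, pow_zero]
  have hRr : R.map (PowerSeries.rescale ζ) = R := by
    rw [hR, Polynomial.map_prod]
    simp only [hLr]
    obtain ⟨n, rfl⟩ := Nat.exists_eq_succ_of_ne_zero hq
    rw [Finset.prod_range_succ, Finset.prod_range_succ' (fun k => L k), hLq]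
  have hR0 : ∃ R0 : Polynomial (PowerSeries ℂ), R0.map (ex q hq) = R := by
    have : R ∈ Polynomial.lifts (ex q hq) := by
      rw [Polynomial.lifts_iff_coeff_lifts]
      intro n
      obtain ⟨b, hb⟩ := descend_coeff q hq ζ hζ (R.coeff n) (by
        conv_rhs => rw [← hRr]
        rw [Polynomial.coeff_map])
      exact ⟨b, hb⟩
    exact (Polynomial.mem_lifts _).1 this
  obtain ⟨R0, hR0⟩ := hR0
  have hRξ : R.eval ξ = 0 := by
    rw [hR, Polynomial.eval_prod]
    apply Finset.prod_eq_zero (Finset.mem_range.2 (Nat.pos_of_ne_zero hq))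
    simp [hL]
  have hdvd : π ∣ R0 := by
    by_contra hnd
    obtain ⟨a, b, d, hd, he⟩ := bez_prime π R0 hp hdeg hnd
    have h1 := congrArg (fun p => (p.map (ex q hq)).eval ξ) he
    simp only [Polynomial.map_add, Polynomial.map_mul, Polynomial.eval_add, Polynomial.eval_mul, hξ,
      hR0, hRξ, Polynomial.map_C, Polynomial.eval_C, mul_zero, add_zero] at h1
    exact hd (ex_inj q hq (by rw [← h1, map_zero]))
  have hξc : (π.map (ex q hq)).eval (cj ξ) = 0 := by
    have h1 := congrArg cj hξ
    rw [map_zero, ← Polynomial.eval₂_hom, ← Polynomial.eval_map, Polynomial.map_map, ← ex_cj,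
      ← Polynomial.map_map, hc] at h1
    exact h1
  have hRc : R.eval (cj ξ) = 0 := by
    obtain ⟨S, rfl⟩ := hdvd
    rw [← hR0, Polynomial.map_mul, Polynomial.eval_mul, hξc, zero_mul]
  rw [hR, Polynomial.eval_prod, Finset.prod_eq_zero_iff] at hRc
  obtain ⟨j, -, hj⟩ := hRc
  simp only [hL, Polynomial.eval_sub, Polynomial.eval_X, Polynomial.eval_C, sub_eq_zero] at hj
  set ω := Complex.exp (Real.pi * Complex.I * j / q) with hω
  have hqC : (q : ℂ) ≠ 0 := by exact_mod_cast hq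
  have hω2 : ω ^ 2 = ζ ^ j := by
    rw [hω, hζd, ← Complex.exp_nat_mul, ← Complex.exp_nat_mul]
    congr 1; push_cast; ring
  have hωq : ω ^ q = (-1) ^ j := by
    rw [hω, ← Complex.exp_nat_mul, ← Complex.exp_pi_mul_I, ← Complex.exp_nat_mul]
    congr 1; field_simp
  have hωc : (starRingEnd ℂ) ω * ω = 1 := by
    rw [hω, ← Complex.exp_conj, ← Complex.exp_add]
    have : (starRingEnd ℂ) (Real.pi * Complex.I * j / q) + (Real.pi * Complex.I * j / q) = 0 := by
      simp; ring
    rw [this, Complex.exp_zero]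
  refine hr q hq (ω ^ q) ?_ (PowerSeries.rescale ω ξ) ?_ ?_
  · rw [hωq]; exact neg_one_pow_eq_or ℂ j
  · ext n
    have h1 := congrArg (PowerSeries.coeff n) hj
    rw [PowerSeries.coeff_map, PowerSeries.coeff_rescale, ← hω2] at h1
    rw [PowerSeries.coeff_map, PowerSeries.coeff_rescale, map_mul, h1, map_pow]
    calc (starRingEnd ℂ) ω ^ n * ((ω ^ 2) ^ n * PowerSeries.coeff n ξ)
        = ((starRingEnd ℂ) ω * ω) ^ n * (ω ^ n * PowerSeries.coeff n ξ) := by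
          rw [mul_pow]; ring
      _ = _ := by rw [hωc, one_pow, one_mul]
  · rw [← ex_rescale, ← Polynomial.map_map, Polynomial.eval_map, Polynomial.eval₂_hom, hξ, map_zero]

theorem norm_form (n : ℕ) : ∀ P : Polynomial (PowerSeries ℂ), P.natDegree < n → P.Monic →
    P.map cj = P → NoReal P → ∃ Q : Polynomial (PowerSeries ℂ), P = Q * Q.map cj := by
  induction n with
  | zero => intro P h; omega
  | succ n ih =>
    intro P hn hm hc hr
    by_cases hd : P.natDegree = 0
    · refine ⟨1, ?_⟩
      rw [hm.natDegree_eq_zero.1 hd]; simp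
    have hnu : ¬ IsUnit P := fun h => hd (by rw [hm.eq_one_of_isUnit h]; simp)
    obtain ⟨π0, hπ0, hπd⟩ := WfDvdMonoid.exists_irreducible_factor hnu hm.ne_zero
    have hlu : IsUnit π0.leadingCoeff := by
      obtain ⟨s, hs⟩ := hπd
      apply IsUnit.of_mul_eq_one s.leadingCoeff
      rw [← Polynomial.leadingCoeff_mul, ← hs, hm.leadingCoeff]
    obtain ⟨π, hpi, hπm, hπd⟩ : ∃ π : Polynomial (PowerSeries ℂ), Prime π ∧ π.Monic ∧ π ∣ P := by
      obtain ⟨c, hc⟩ := hlu.exists_left_inv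
      have hcu : IsUnit (Polynomial.C c : Polynomial (PowerSeries ℂ)) :=
        Polynomial.isUnit_C.2 (IsUnit.of_mul_eq_one _ hc)
      have ha : Associated π0 (Polynomial.C c * π0) := by
        obtain ⟨u, hu⟩ := hcu
        exact ⟨u, by rw [hu, mul_comm]⟩
      refine ⟨Polynomial.C c * π0, ha.prime hπ0.prime, ?_, (ha.dvd_iff_dvd_left).1 hπd⟩
      rw [Polynomial.Monic, Polynomial.leadingCoeff_mul, Polynomial.leadingCoeff_C, hc]
    have hne := not_selfconj π hπm hpi (hr.of_dvd hπd)
    have hmc : (π.map cj).Monic := hπm.map _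
    have hnd : ¬ π ∣ π.map cj := by
      intro h
      exact hne (Polynomial.eq_of_monic_of_dvd_of_natDegree_le hπm hmc h
        (by rw [hπm.natDegree_map]))
    have hcd : π.map cj ∣ P := by
      rw [← hc]; exact Polynomial.map_dvd cj hπd
    obtain ⟨s, hs⟩ := hcd
    rw [hs] at hπd
    obtain ⟨P1, hP1⟩ := (hpi.dvd_or_dvd hπd).resolve_left hnd
    have hP : P = (π * π.map cj) * P1 := by rw [hs, hP1]; ring
    have hMm : (π * π.map cj).Monic := hπm.mul hmc
    have hP1m : P1.Monic := hMm.of_mul_monic_left (hP ▸ hm)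
    have hdeg : P.natDegree = (π * π.map cj).natDegree + P1.natDegree := by
      rw [hP, hMm.natDegree_mul hP1m]
    have hπdeg : 0 < π.natDegree := by
      rw [Nat.pos_iff_ne_zero]
      intro h
      exact hpi.not_isUnit (by rw [hπm.natDegree_eq_zero.1 h]; exact isUnit_one)
    rw [hπm.natDegree_mul hmc] at hdeg
    have hc1 : P1.map cj = P1 := by
      apply mul_left_cancel₀ hMm.ne_zero
      rw [← hP]
      conv_rhs => rw [← hc, hP]
      rw [Polynomial.map_mul, Polynomial.map_mul, map_cj_cj]; ring
    obtain ⟨Q, hQ⟩ := ih P1 (by omega) hP1m hc1 (hr.of_dvd ⟨π * π.map cj, by rw [hP]; ring⟩)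
    refine ⟨π * Q, ?_⟩
    rw [hP, Polynomial.map_mul]
    conv_lhs => rw [hQ]
    ring

end Sch

namespace Sch

theorem eval_ev2 (p : Fin 2 → ℝ) (g : A2) : eval p g = ev2 (RingHom.id ℝ) (p 0) (p 1) (Φ g) := by
  rw [ev2_Φ, ← MvPolynomial.eval₂_id]
  congr 1
  ext i; fin_cases i <;> simp

theorem growth (G : A2) (δ : ℝ) (hδ : 0 < δ) (M : ℕ) (hM : (Φ G).natDegree < M) :
    ∃ B : ℝ, 0 ≤ B ∧ ∀ p : Fin 2 → ℝ, |p 0| ≤ δ → δ ≤ |p 1| → |eval p G| ≤ B * |p 1| ^ M := by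
  have h1 : ∀ k, ∃ b : ℝ, ∀ u : ℝ, |u| ≤ δ → |((Φ G).coeff k).eval u| ≤ b := by
    intro k
    obtain ⟨b, hb⟩ := (isCompact_Icc (a := -δ) (b := δ)).exists_bound_of_continuousOn
      (((Φ G).coeff k).continuous.continuousOn)
    exact ⟨b, fun u hu => hb u ⟨(abs_le.1 hu).1, (abs_le.1 hu).2⟩⟩
  choose b hb using h1
  have hb0 : ∀ k, 0 ≤ b k := fun k => (abs_nonneg _).trans (hb k 0 (by simpa using hδ.le))
  refine ⟨∑ k ∈ Finset.range M, b k / δ ^ (M - k), Finset.sum_nonneg fun k _ => div_nonneg (hb0 k) (by positivity), ?_⟩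
  intro p hu hv
  have he : eval p G = ∑ k ∈ Finset.range M, ((Φ G).coeff k).eval (p 0) * p 1 ^ k := by
    rw [eval_ev2, ev2, Polynomial.coe_eval₂RingHom, Polynomial.eval₂_eq_sum_range' _ hM]
    rfl
  rw [he, Finset.sum_mul]
  refine (Finset.abs_sum_le_sum_abs _ _).trans (Finset.sum_le_sum fun k hk => ?_)
  rw [abs_mul, abs_pow, div_mul_eq_mul_div, le_div_iff₀ (by positivity)]
  have hk : k < M := Finset.mem_range.1 hk
  calc |((Φ G).coeff k).eval (p 0)| * |p 1| ^ k * δ ^ (M - k)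
      ≤ b k * |p 1| ^ k * |p 1| ^ (M - k) := by
        have := hb k _ hu
        have := hb0 k
        gcongr
    _ = b k * |p 1| ^ M := by rw [mul_assoc, ← pow_add]; congr 2; omega

theorem noReal_of_pos (H : A2) (δ c : ℝ) (K : ℕ) (hδ : 0 < δ) (hc : 0 < c)
    (hH : ∀ p : Fin 2 → ℝ, |p 0| ≤ δ → c * |p 0| ^ K ≤ eval p H) : NoReal ((Φ H).map jC) := by
  intro q hq σ hσ ψ hψ h0
  obtain ⟨τ, hτ, hτσ⟩ : ∃ τ : ℝ, |τ| = 1 ∧ σ = τ := by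
    rcases hσ with rfl | rfl
    · exact ⟨1, by simp, by simp⟩
    · exact ⟨-1, by simp, by simp⟩
  set n := q * K + 1 with hn
  set ψn : Polynomial ℝ := ∑ i ∈ Finset.range n, Polynomial.monomial i (PowerSeries.coeff i ψ).re with hψn
  have hre : ∀ i, ((PowerSeries.coeff i ψ).re : ℂ) = PowerSeries.coeff i ψ := by
    intro i
    have := congrArg (PowerSeries.coeff i) hψ
    rw [PowerSeries.coeff_map] at this
    exact Complex.conj_eq_iff_re.1 this
  have hcoef : ∀ i, i < n → ψn.coeff i = (PowerSeries.coeff i ψ).re := by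
    intro i hi
    rw [hψn, Polynomial.finsetSum_coeff, Finset.sum_eq_single i]
    · simp
    · intro j _ hj; rw [Polynomial.coeff_monomial, if_neg hj]
    · intro h; exact absurd (Finset.mem_range.2 hi) h
  set pw : Polynomial ℝ := ev2 Polynomial.C (Polynomial.C τ * Polynomial.X ^ q) ψn (Φ H) with hpw
  have hev : ∀ w : ℝ, pw.eval w = eval ![τ * w ^ q, ψn.eval w] H := by
    intro w
    have := ev2_map (Polynomial.evalRingHom w) Polynomial.C (Polynomial.C τ * Polynomial.X ^ q) ψn (Φ H)
    rw [← hpw] at this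
    rw [eval_ev2]
    have h2 : (Polynomial.evalRingHom w).comp Polynomial.C = RingHom.id ℝ := by
      ext r; simp
    rw [h2] at this
    simpa using this
  set Pm := (Φ H).map ((((ex q hq).comp (PowerSeries.rescale σ))).comp jC) with hPm
  rw [Polynomial.map_map, ← hPm] at h0
  have hjp : jC pw = Pm.eval (jC ψn) := by
    rw [hpw, ev2_map, hPm, Polynomial.eval_map, ev2, Polynomial.coe_eval₂RingHom]
    congr 1
    ext1
    · ext1 r
      simp only [RingHom.comp_apply, Polynomial.coe_eval₂RingHom, Polynomial.eval₂_C]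
      have h1 : jC (Polynomial.C r) = PowerSeries.C (r : ℂ) := by simp [jC]
      rw [h1]
      ext i
      rw [ex_coeff, PowerSeries.coeff_rescale, PowerSeries.coeff_C, PowerSeries.coeff_C]
      by_cases hi : i = 0
      · subst hi; simp
      · rw [if_neg hi]
        split_ifs with h2 h3
        · exfalso
          obtain ⟨m, rfl⟩ := h2
          rw [Nat.mul_div_cancel_left _ (Nat.pos_of_ne_zero hq)] at h3
          exact hi (by rw [h3, mul_zero])
        · simp
        · rfl
    · ext1 i
      simp only [Polynomial.coe_eval₂RingHom, Polynomial.eval₂_X, RingHom.comp_apply, ex_coeff,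
        PowerSeries.coeff_rescale, coeff_jC, Polynomial.coeff_C_mul, Polynomial.coeff_X_pow, Polynomial.coeff_X]
      rw [hτσ]
      by_cases hi : i = q
      · subst hi
        rw [if_pos dvd_rfl, Nat.div_self (Nat.pos_of_ne_zero hq)]; simp
      · rw [if_neg hi]
        split_ifs with h1 h2
        · exfalso; apply hi
          obtain ⟨m, rfl⟩ := h1
          rw [Nat.mul_div_cancel_left _ (Nat.pos_of_ne_zero hq)] at h2
          rw [← h2, mul_one]
        · simp
        · simp
  have hdvd : (PowerSeries.X : PowerSeries ℂ) ^ n ∣ jC ψn - ψ := by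
    rw [PowerSeries.X_pow_dvd_iff]
    intro m hm
    rw [map_sub, coeff_jC, hcoef m hm, hre, sub_self]
  have hdvd2 : (PowerSeries.X : PowerSeries ℂ) ^ n ∣ jC pw := by
    have := hdvd.trans (Polynomial.sub_dvd_eval_sub (jC ψn) ψ Pm)
    rwa [h0, sub_zero, ← hjp] at this
  have hdvd3 : (Polynomial.X : Polynomial ℝ) ^ n ∣ pw := by
    rw [Polynomial.X_pow_dvd_iff]
    rw [PowerSeries.X_pow_dvd_iff] at hdvd2
    intro d hd
    have := hdvd2 d hd
    rw [coeff_jC] at this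
    exact_mod_cast this
  obtain ⟨r, hr⟩ := hdvd3
  have hlim : Filter.Tendsto (fun w : ℝ => w * r.eval w) (nhdsWithin 0 (Set.Ioi 0)) (nhds 0) := by
    have : Continuous fun w : ℝ => w * r.eval w := continuous_id.mul r.continuous
    have := this.tendsto 0
    simp only [zero_mul] at this
    exact this.mono_left nhdsWithin_le_nhds
  have hqlim : Filter.Tendsto (fun w : ℝ => w ^ q) (nhdsWithin 0 (Set.Ioi 0)) (nhds 0) := by
    have := (continuous_pow (M := ℝ) q).tendsto 0
    rw [zero_pow hq] at this
    exact this.mono_left nhdsWithin_le_nhds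
  have hle : c ≤ 0 := by
    apply ge_of_tendsto hlim
    filter_upwards [self_mem_nhdsWithin, hqlim.eventually (ge_mem_nhds hδ)] with w hw hwq
    have hw : 0 < w := hw
    have h1 := hH ![τ * w ^ q, ψn.eval w] (by
      simp only [Matrix.cons_val_zero, abs_mul, hτ, one_mul]
      rw [abs_of_pos (by positivity)]; exact hwq)
    rw [← hev, hr] at h1
    simp only [Matrix.cons_val_zero, abs_mul, hτ, one_mul, Polynomial.eval_mul, Polynomial.eval_pow,
      Polynomial.eval_X] at h1
    rw [abs_of_pos (by positivity), ← pow_mul, hn, pow_succ] at h1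
    have : 0 < w ^ (q * K) := by positivity
    have h2 : c * w ^ (q * K) ≤ (w * r.eval w) * w ^ (q * K) := by linarith
    exact le_of_mul_le_mul_right h2 this
  linarith

theorem lemmaL (G : A2) (δ c : ℝ) (K : ℕ) (hδ : 0 < δ) (hc : 0 < c)
    (hG : ∀ p : Fin 2 → ℝ, |p 0| ≤ δ → |p 1| ≤ δ → c * |p 0| ^ K ≤ eval p G) (N : ℕ) :
    ∃ A B : A2, G - A ^ 2 - B ^ 2 ∈ (idealOfVars (Fin 2) ℝ) ^ N := by
  set M := 2 * (N + (Φ G).natDegree + 1) with hM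
  obtain ⟨B, hB, hgr⟩ := growth G δ hδ M (by omega)
  set κ := B + c * δ ^ K / δ ^ M with hκ
  have hκ0 : 0 < κ := by positivity
  set H := G + C κ * X 1 ^ M with hH
  have hHpos : ∀ p : Fin 2 → ℝ, |p 0| ≤ δ → c * |p 0| ^ K ≤ eval p H := by
    intro p hp
    have hev : eval p H = eval p G + κ * |p 1| ^ M := by
      rw [hH]; simp [hM, pow_mul]
    rw [hev]
    rcases le_total |p 1| δ with h | h
    · have := hG p hp h
      have : 0 ≤ κ * |p 1| ^ M := by positivity
      linarith
    · have h1 := hgr p hp h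
      have h2 := neg_abs_le (eval p G)
      have h3 : c * δ ^ K ≤ c * δ ^ K / δ ^ M * |p 1| ^ M := by
        rw [div_mul_eq_mul_div, le_div_iff₀ (by positivity)]
        gcongr
      have h4 : c * |p 0| ^ K ≤ c * δ ^ K := by gcongr
      rw [hκ]; linarith
  set H' := C κ⁻¹ * H with hH'
  have hH'H : H = C κ * H' := by
    rw [hH', ← mul_assoc, ← C_mul, mul_inv_cancel₀ hκ0.ne', C_1, one_mul]
  have hno : NoReal ((Φ H').map jC) := by
    apply noReal_of_pos H' δ (κ⁻¹ * c) K hδ (by positivity)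
    intro p hp
    rw [hH', map_mul, eval_C, mul_assoc]
    exact mul_le_mul_of_nonneg_left (hHpos p hp) (by positivity)
  have hΦ : Φ H' = Φ (C κ⁻¹ * G) + Polynomial.X ^ M := by
    rw [hH', hH, mul_add, ← mul_assoc, ← C_mul, inv_mul_cancel₀ hκ0.ne', C_1, one_mul, map_add, map_pow]
    simp [Φ]
  have hmon : (Φ H').Monic := by
    rw [hΦ, add_comm]
    apply Polynomial.monic_X_pow_add
    rw [map_mul]
    have : Φ (C κ⁻¹) = Polynomial.C (Polynomial.C κ⁻¹) := by simp [Φ]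
    rw [this]
    rw [Polynomial.degree_C_mul (by simpa using hκ0.ne')]
    refine lt_of_le_of_lt Polynomial.degree_le_natDegree ?_
    exact_mod_cast (by omega : (Φ G).natDegree < M)
  have hcjj : cj.comp jC = jC := by
    refine RingHom.ext fun a => PowerSeries.ext fun i => ?_
    simp only [RingHom.comp_apply, PowerSeries.coeff_map, coeff_jC, Complex.conj_ofReal]
  obtain ⟨Q, hQ⟩ := norm_form _ ((Φ H').map jC) (Nat.lt_succ_self _) (hmon.map _)
    (by rw [Polynomial.map_map, hcjj]) hno
  set tr : (ℂ → ℝ) → Polynomial (Polynomial ℝ) := fun r =>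
    ∑ k ∈ Finset.range (Q.natDegree + 1), Polynomial.monomial k
      (∑ n ∈ Finset.range N, Polynomial.monomial n (r (PowerSeries.coeff n (Q.coeff k)))) with htr
  have hcoef : ∀ r : ℂ → ℝ, r 0 = 0 → ∀ k n, n < N →
      ((tr r).coeff k).coeff n = r (PowerSeries.coeff n (Q.coeff k)) := by
    intro r hr0 k n hn
    have h1 : (tr r).coeff k = if k < Q.natDegree + 1 then
        (∑ n ∈ Finset.range N, Polynomial.monomial n (r (PowerSeries.coeff n (Q.coeff k)))) else 0 := by
      rw [htr]
      simp only [Polynomial.finsetSum_coeff, Polynomial.coeff_monomial]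
      rw [Finset.sum_ite_eq']
      simp
    rw [h1]
    split_ifs with hk
    · simp only [Polynomial.finsetSum_coeff, Polynomial.coeff_monomial]
      rw [Finset.sum_ite_eq', if_pos (Finset.mem_range.2 hn)]
    · have : Q.coeff k = 0 := Polynomial.coeff_eq_zero_of_natDegree_lt (by omega)
      rw [this]
      simp [hr0]
  set QA := tr Complex.re with hQA
  set QB := tr Complex.im with hQB
  set I' : Polynomial (PowerSeries ℂ) := Polynomial.C (PowerSeries.C Complex.I) with hI'
  set Q' : Polynomial (PowerSeries ℂ) := QA.map jC + I' * QB.map jC with hQ'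
  have hd1 : Polynomial.C (PowerSeries.X ^ N : PowerSeries ℂ) ∣ Q - Q' := by
    rw [Polynomial.C_dvd_iff_dvd_coeff]
    intro k
    rw [PowerSeries.X_pow_dvd_iff]
    intro n hn
    rw [hQ', Polynomial.coeff_sub, Polynomial.coeff_add, hI', Polynomial.coeff_C_mul,
      Polynomial.coeff_map, Polynomial.coeff_map, map_sub, map_add, PowerSeries.coeff_C_mul, coeff_jC, coeff_jC,
      hcoef _ (by simp) k n hn, hcoef _ (by simp) k n hn, sub_eq_zero, mul_comm, Complex.re_add_im]
  have hd2 : Polynomial.C (PowerSeries.X ^ N : PowerSeries ℂ) ∣ Q.map cj - Q'.map cj := by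
    have := Polynomial.map_dvd cj hd1
    rw [Polynomial.map_C, map_pow, PowerSeries.map_X, Polynomial.map_sub] at this
    exact this
  have hQc : Q'.map cj = QA.map jC - I' * QB.map jC := by
    rw [hQ', Polynomial.map_add, Polynomial.map_mul, Polynomial.map_map, Polynomial.map_map, hcjj, hI',
      Polynomial.map_C, PowerSeries.map_C, Complex.conj_I, map_neg, map_neg]
    ring
  have hI2 : I' ^ 2 = -1 := by
    rw [hI', ← Polynomial.C_pow, ← map_pow, Complex.I_sq]; simp
  have hd3 : Polynomial.C (PowerSeries.X ^ N : PowerSeries ℂ) ∣ (Φ H' - QA ^ 2 - QB ^ 2).map jC := by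
    have h1 : (Φ H' - QA ^ 2 - QB ^ 2).map jC = (Q - Q') * Q.map cj + Q' * (Q.map cj - Q'.map cj) := by
      rw [Polynomial.map_sub, Polynomial.map_sub, hQ, Polynomial.map_pow, Polynomial.map_pow, hQc, hQ']
      linear_combination (-(QB.map jC) ^ 2) * hI2
    rw [h1]
    exact dvd_add (Dvd.dvd.mul_right hd1 _) (Dvd.dvd.mul_left hd2 _)
  have hd4 : Polynomial.C (Polynomial.X ^ N : Polynomial ℝ) ∣ Φ H' - QA ^ 2 - QB ^ 2 := by
    rw [Polynomial.C_dvd_iff_dvd_coeff] at hd3 ⊢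
    intro k
    have := hd3 k
    rw [PowerSeries.X_pow_dvd_iff] at this
    rw [Polynomial.X_pow_dvd_iff]
    intro d hd
    have := this d hd
    rw [Polynomial.coeff_map, coeff_jC] at this
    exact_mod_cast this
  obtain ⟨E, hE⟩ := hd4
  have hX : ∀ i : Fin 2, (X i : A2) ∈ idealOfVars (Fin 2) ℝ := fun i => Ideal.subset_span ⟨i, rfl⟩
  refine ⟨C (Real.sqrt κ) * Ψ QA, C (Real.sqrt κ) * Ψ QB, ?_⟩
  have h5 : H' - Ψ QA ^ 2 - Ψ QB ^ 2 = X 0 ^ N * Ψ E := by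
    have := congrArg Ψ hE
    rw [map_sub, map_sub, map_pow, map_pow, ΨΦ, map_mul] at this
    rw [this]
    congr 1
    rw [Polynomial.C_pow, map_pow]
    simp [Ψ, ev2]
  have h6 : (C (Real.sqrt κ) : A2) ^ 2 = C κ := by rw [← C_pow, Real.sq_sqrt hκ0.le]
  have h7 : G - (C (Real.sqrt κ) * Ψ QA) ^ 2 - (C (Real.sqrt κ) * Ψ QB) ^ 2 =
      X 0 ^ N * (C κ * Ψ E) - X 1 ^ N * (C κ * X 1 ^ (M - N)) := by
    have h8 : G = C κ * H' - C κ * (X 1 ^ N * X 1 ^ (M - N)) := by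
      rw [← hH'H, hH, ← pow_add, show N + (M - N) = M by omega]; ring
    rw [h8]
    linear_combination C κ * h5 - (Ψ QA ^ 2 + Ψ QB ^ 2) * h6
  rw [h7]
  exact sub_mem (Ideal.mul_mem_right _ _ (Ideal.pow_mem_pow (hX 0) N))
    (Ideal.mul_mem_right _ _ (Ideal.pow_mem_pow (hX 1) N))

end Sch

namespace Sch

abbrev m0 : Ideal A2 := idealOfVars (Fin 2) ℝ

/-- square the `i`-th variable -/
def Ev (i : Fin 2) : A2 →ₐ[ℝ] A2 := aeval (fun j => if j = i then X j ^ 2 else X j)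
/-- reflect the `i`-th variable -/
def Rf (i : Fin 2) : A2 →ₐ[ℝ] A2 := aeval (fun j => if j = i then - X j else X j)

theorem Rf_Ev (i : Fin 2) (h : A2) : Rf i (Ev i h) = Ev i h := by
  have : (Rf i).comp (Ev i) = Ev i := by
    ext j
    by_cases hj : j = i <;> simp [Rf, Ev, hj]
  exact congrArg (fun f => f h) this

theorem Ev_decomp (i : Fin 2) (h : A2) : ∃ h0 h1, h = Ev i h0 + X i * Ev i h1 := by
  induction h using MvPolynomial.induction_on with
  | C a => exact ⟨C a, 0, by simp [Ev]⟩
  | add f g hf hg =>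
    obtain ⟨f0, f1, rfl⟩ := hf
    obtain ⟨g0, g1, rfl⟩ := hg
    exact ⟨f0 + g0, f1 + g1, by simp only [map_add]; ring⟩
  | mul_X f j hf =>
    obtain ⟨f0, f1, rfl⟩ := hf
    by_cases hj : j = i
    · subst hj
      refine ⟨X j * f1, f0, ?_⟩
      simp [Ev]; ring
    · refine ⟨X j * f0, X j * f1, ?_⟩
      simp [Ev, hj]; ring

theorem Rf_m0 (i : Fin 2) (N : ℕ) {h : A2} (hh : h ∈ m0 ^ N) : Rf i h ∈ m0 ^ N := by
  have h1 : m0.map (Rf i : A2 →+* A2) ≤ m0 := by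
    rw [m0, idealOfVars, Ideal.map_span, Ideal.span_le]
    rintro _ ⟨_, ⟨j, rfl⟩, rfl⟩
    have hX : (X j : A2) ∈ Ideal.span (Set.range (X : Fin 2 → A2)) := Ideal.subset_span ⟨j, rfl⟩
    by_cases hj : j = i
    · simpa [Rf, hj] using hX
    · simpa [Rf, hj] using hX
  have h2 := Ideal.mem_map_of_mem (Rf i : A2 →+* A2) hh
  rw [Ideal.map_pow] at h2
  exact Ideal.pow_right_mono h1 N h2

theorem Ev_coeff (i : Fin 2) (d : Fin 2 →₀ ℕ) (h : A2) :
    coeff (d + Finsupp.single i (d i)) (Ev i h) = coeff d h := by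
  induction h using MvPolynomial.induction_on' with
  | add p q hp hq => simp [hp, hq]
  | monomial e r =>
    have h1 : Ev i (monomial e r) = monomial (e + Finsupp.single i (e i)) r := by
      rw [Ev, aeval_monomial, monomial_eq (s := e + Finsupp.single i (e i))]
      congr 1
      rw [Finsupp.prod_fintype _ _ (by simp), Finsupp.prod_fintype _ _ (by simp)]
      apply Finset.prod_congr rfl
      intro j _
      by_cases hj : j = i
      · subst hj; simp; ring
      · simp [hj, Finsupp.single_apply, Ne.symm hj]
    rw [h1, coeff_monomial, coeff_monomial]
    congr 1
    rw [eq_iff_iff]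
    constructor
    · intro h
      ext j
      have := DFunLike.congr_fun h j
      by_cases hj : j = i
      · subst hj; simp at this; omega
      · simpa [Finsupp.single_apply, Ne.symm hj] using this
    · intro h; rw [h]

theorem Ev_m0 (i : Fin 2) (N : ℕ) {h : A2} (hh : Ev i h ∈ m0 ^ (2 * N)) : h ∈ m0 ^ N := by
  rw [m0, mem_pow_idealOfVars_iff'] at *
  intro d hd
  rw [← Ev_coeff i]
  apply hh
  rw [map_add, Finsupp.degree_single]
  have : d i ≤ d.degree := Finsupp.le_degree i d
  omega

def Rep (W : Set A2) (F : A2) (N : ℕ) : Prop :=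
  ∃ (ι : Type) (_ : Fintype ι) (w h : ι → A2), (∀ k, w k ∈ W) ∧ F - ∑ k, w k * h k ^ 2 ∈ m0 ^ N

theorem par (i : Fin 2) (W : Set A2) (hW : ∀ w ∈ W, Ev i w = w) (F : A2) (N : ℕ)
    (h : Rep W (Ev i F) (2 * N)) : Rep (W ∪ (fun w => w * X i) '' W) F N := by
  obtain ⟨ι, _, w, h, hw, hm⟩ := h
  choose h0 h1 hd using fun k => Ev_decomp i (h k)
  refine ⟨ι ⊕ ι, inferInstance, Sum.elim w (fun k => w k * X i), Sum.elim h0 h1, ?_, ?_⟩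
  · rintro (k | k)
    · exact Or.inl (hw k)
    · exact Or.inr ⟨w k, hw k, rfl⟩
  apply Ev_m0 i
  have h2 := Rf_m0 i _ hm
  have h3 := Ideal.mul_mem_left _ (C (1/2)) (add_mem hm h2)
  convert h3 using 1
  have hRw : ∀ k, Rf i (w k) = w k := fun k => by rw [← hW _ (hw k), Rf_Ev]
  have hRX : Rf i (X i) = - X i := by simp [Rf]
  have hEX : Ev i (X i) = X i ^ 2 := by simp [Ev]
  have hsum : (Ev i F - ∑ k, w k * h k ^ 2 + Rf i (Ev i F - ∑ k, w k * h k ^ 2)) =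
      2 * Ev i (F - ∑ k, Sum.elim w (fun k => w k * X i) k * Sum.elim h0 h1 k ^ 2) := by
    rw [Fintype.sum_sum_type]
    simp only [Sum.elim_inl, Sum.elim_inr, map_sub, map_add, map_sum, map_mul, map_pow, Rf_Ev, hRw, hEX]
    have e1 : ∀ k, Ev i (w k) = w k := fun k => hW _ (hw k)
    have e2 : ∀ k, Rf i (h k) = Ev i (h0 k) - X i * Ev i (h1 k) := by
      intro k; rw [hd k, map_add, map_mul, Rf_Ev, Rf_Ev, hRX]; ring
    simp only [e1, e2]
    have e3 : (∑ k, w k * h k ^ 2) + (∑ k, w k * (Ev i (h0 k) - X i * Ev i (h1 k)) ^ 2) =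
        2 * (∑ k, w k * Ev i (h0 k) ^ 2 + ∑ k, w k * X i ^ 2 * Ev i (h1 k) ^ 2) := by
      rw [← Finset.sum_add_distrib, ← Finset.sum_add_distrib, Finset.mul_sum]
      apply Finset.sum_congr rfl
      intro k _
      rw [hd k]; ring
    linear_combination -e3
  rw [hsum, ← mul_assoc, Chalf, one_mul]

theorem eval_Ev0 (y : Fin 2 → ℝ) (F : A2) : eval y (Ev 0 F) = eval ![y 0 ^ 2, y 1] F := by
  have : (eval y).comp (Ev 0 : A2 →+* A2) = eval ![y 0 ^ 2, y 1] := by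
    apply MvPolynomial.ringHom_ext
    · intro r; simp
    · intro i; fin_cases i <;> simp [Ev]
  exact congrArg (fun f => f F) this

theorem eval_Ev1 (y : Fin 2 → ℝ) (F : A2) : eval y (Ev 1 F) = eval ![y 0, y 1 ^ 2] F := by
  have : (eval y).comp (Ev 1 : A2 →+* A2) = eval ![y 0, y 1 ^ 2] := by
    apply MvPolynomial.ringHom_ext
    · intro r; simp
    · intro i; fin_cases i <;> simp [Ev]
  exact congrArg (fun f => f F) this

theorem quad0 (G : A2) (δ c : ℝ) (K : ℕ) (hδ : 0 < δ) (hc : 0 < c)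
    (hG : ∀ p : Fin 2 → ℝ, |p 0| ≤ δ → |p 1| ≤ δ → c * |p 0| ^ K ≤ eval p G) (N : ℕ) :
    Rep {1} G N := by
  obtain ⟨A, B, h⟩ := lemmaL G δ c K hδ hc hG N
  refine ⟨Fin 2, inferInstance, fun _ => 1, ![A, B], fun _ => rfl, ?_⟩
  convert h using 1
  simp [Fin.sum_univ_two]; ring

theorem sq_le_aux {δ a : ℝ} (h : |a| ≤ min δ 1) : a ^ 2 ≤ δ := by
  have h1 := h.trans (min_le_left _ _)
  have h2 := h.trans (min_le_right _ _)
  rw [← sq_abs]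
  nlinarith [abs_nonneg a]

theorem quad1 (G : A2) (δ c : ℝ) (K : ℕ) (hδ : 0 < δ) (hc : 0 < c)
    (hG : ∀ p : Fin 2 → ℝ, 0 ≤ p 0 → |p 0| ≤ δ → |p 1| ≤ δ → c * |p 0| ^ K ≤ eval p G) (N : ℕ) :
    Rep {1, X 0} G N := by
  have h := quad0 (Ev 0 G) (min δ 1) c (2 * K) (by positivity) hc (by
    intro p h0 h1
    rw [eval_Ev0]
    have := hG ![p 0 ^ 2, p 1] (sq_nonneg _) (by
      simp only [Matrix.cons_val_zero]
      rw [abs_of_nonneg (sq_nonneg _)]; exact sq_le_aux h0) (by simpa using h1.trans (min_le_left _ _))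
    simpa [pow_mul] using this) (2 * N)
  have := par 0 _ (by rintro _ rfl; simp) G N h
  convert this using 1
  ext x; simp [or_comm]

theorem quad2 (G : A2) (δ c : ℝ) (K : ℕ) (hδ : 0 < δ) (hc : 0 < c)
    (hG : ∀ p : Fin 2 → ℝ, 0 ≤ p 0 → 0 ≤ p 1 → |p 0| ≤ δ → |p 1| ≤ δ → c * |p 0| ^ K ≤ eval p G) (N : ℕ) :
    Rep ({1, X 0} ∪ (fun w => w * X 1) '' {1, X 0}) G N := by
  have h := quad1 (Ev 1 G) (min δ 1) c K (by positivity) hc (by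
    intro p hp h0 h1
    rw [eval_Ev1]
    have := hG ![p 0, p 1 ^ 2] hp (sq_nonneg _) (by simpa using h0.trans (min_le_left _ _)) (by
      simp only [Matrix.cons_val_one]
      rw [abs_of_nonneg (sq_nonneg _)]; exact sq_le_aux h1)
    simpa using this) (2 * N)
  exact par 1 _ (by rintro _ (rfl | rfl) <;> simp [Ev]) G N h

end Sch

namespace Sch

/-- maximal ideal of a real point -/
def mp (p : Fin 2 → ℝ) : Ideal A2 := Ideal.span {X 0 - C (p 0), X 1 - C (p 1)}

theorem X_mp (p : Fin 2 → ℝ) (i : Fin 2) : (X i - C (p i) : A2) ∈ mp p := by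
  apply Ideal.subset_span
  fin_cases i <;> simp

theorem sub_eval_mp (p : Fin 2 → ℝ) (h : A2) : h - C (eval p h) ∈ mp p := by
  induction h using MvPolynomial.induction_on with
  | C a => simp
  | add f g hf hg =>
    have := (mp p).add_mem hf hg
    simp only [map_add]
    convert this using 1; ring
  | mul_X f j hf =>
    have h1 := (mp p).mul_mem_right (X j) hf
    have h2 := (mp p).mul_mem_left (C (eval p f)) (X_mp p j)
    have := (mp p).add_mem h1 h2
    simp only [map_mul, eval_X]
    convert this using 1; ring

theorem mem_mp (p : Fin 2 → ℝ) (h : A2) : h ∈ mp p ↔ eval p h = 0 := by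
  constructor
  · intro hh
    obtain ⟨a, b, rfl⟩ := Ideal.mem_span_pair.1 hh
    simp
  · intro hh
    have := sub_eval_mp p h
    rwa [hh, C_0, sub_zero] at this

theorem eval_bdd (h : A2) (p : Fin 2 → ℝ) : ∃ M : ℝ, 0 ≤ M ∧ ∀ x : Fin 2 → ℝ, ‖x - p‖ ≤ 1 → |eval x h| ≤ M := by
  have hc : IsCompact (Metric.closedBall p 1) := isCompact_closedBall p 1
  obtain ⟨M, hM⟩ := hc.exists_bound_of_continuousOn (f := fun x => eval x h)
    (MvPolynomial.continuous_eval h).continuousOn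
  refine ⟨max M 0, le_max_right _ _, fun x hx => ?_⟩
  have := hM x (by rwa [Metric.mem_closedBall, dist_eq_norm])
  exact this.trans (le_max_left _ _)

theorem mp_bound (p : Fin 2 → ℝ) (N : ℕ) (h : A2) (hh : h ∈ mp p ^ N) :
    ∃ M : ℝ, 0 ≤ M ∧ ∀ x : Fin 2 → ℝ, ‖x - p‖ ≤ 1 → |eval x h| ≤ M * ‖x - p‖ ^ N := by
  induction N generalizing h with
  | zero => simpa using eval_bdd h p
  | succ N ih =>
    rw [pow_succ] at hh
    induction hh using Submodule.mul_induction_on' with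
    | mem_mul_mem a ha b hb =>
      obtain ⟨M, hM0, hM⟩ := ih a ha
      obtain ⟨r, s, rfl⟩ := Ideal.mem_span_pair.1 hb
      obtain ⟨R, hR0, hR⟩ := eval_bdd r p
      obtain ⟨S, hS0, hS⟩ := eval_bdd s p
      refine ⟨M * (R + S), by positivity, fun x hx => ?_⟩
      have h0 : |x 0 - p 0| ≤ ‖x - p‖ := norm_le_pi_norm (x - p) 0
      have h1 : |x 1 - p 1| ≤ ‖x - p‖ := norm_le_pi_norm (x - p) 1
      have hb' : |eval x (r * (X 0 - C (p 0)) + s * (X 1 - C (p 1)))| ≤ (R + S) * ‖x - p‖ := by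
        simp only [map_add, map_mul, map_sub, eval_X, eval_C]
        refine (abs_add_le _ _).trans ?_
        rw [abs_mul, abs_mul, add_mul]
        exact add_le_add (mul_le_mul (hR x hx) h0 (abs_nonneg _) hR0)
          (mul_le_mul (hS x hx) h1 (abs_nonneg _) hS0)
      rw [map_mul, abs_mul]
      refine (mul_le_mul (hM x hx) hb' (abs_nonneg _) (by positivity)).trans (le_of_eq (by ring))
    | add a ha b hb iha ihb =>
      obtain ⟨M, hM0, hM⟩ := iha
      obtain ⟨R, hR0, hR⟩ := ihb
      refine ⟨M + R, by positivity, fun x hx => ?_⟩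
      rw [map_add, add_mul]
      exact (abs_add_le _ _).trans (add_le_add (hM x hx) (hR x hx))

theorem taylor1 (p : Fin 2 → ℝ) (u : A2) :
    u - C (eval p u) - C (eval p (pderiv 0 u)) * (X 0 - C (p 0)) - C (eval p (pderiv 1 u)) * (X 1 - C (p 1))
      ∈ mp p ^ 2 := by
  induction u using MvPolynomial.induction_on with
  | C a => simp
  | add f g hf hg =>
    have := (mp p ^ 2).add_mem hf hg
    simp only [map_add]
    convert this using 1; ring
  | mul_X f j hf =>
    have h1 := (mp p ^ 2).mul_mem_right (X j) hf
    have h2 : ∀ i : Fin 2, C (eval p (pderiv i f)) * (X i - C (p i)) * (X j - C (p j)) ∈ mp p ^ 2 := by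
      intro i
      rw [mul_assoc, pow_two]
      exact Ideal.mul_mem_left _ _ (Ideal.mul_mem_mul (X_mp p i) (X_mp p j))
    have := (mp p ^ 2).add_mem ((mp p ^ 2).add_mem h1 (h2 0)) (h2 1)
    convert this using 1
    fin_cases j
    · simp [pderiv_X]; ring
    · simp [pderiv_X]; ring

theorem pderiv_strict (p : Fin 2 → ℝ) (u : A2) :
    HasStrictFDerivAt (fun x : Fin 2 → ℝ => eval x u)
      (eval p (pderiv 0 u) • ContinuousLinearMap.proj (R := ℝ) (φ := fun _ : Fin 2 => ℝ) 0
        + eval p (pderiv 1 u) • ContinuousLinearMap.proj (R := ℝ) (φ := fun _ : Fin 2 => ℝ) 1) p := by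
  induction u using MvPolynomial.induction_on with
  | C a => simpa using hasStrictFDerivAt_const (𝕜 := ℝ) a p
  | add f g hf hg =>
    have := hf.add hg
    simp only [map_add]
    refine this.congr_fderiv ?_
    ext x; simp; ring
  | mul_X f j hf =>
    have hj : HasStrictFDerivAt (fun x : Fin 2 → ℝ => x j)
      (ContinuousLinearMap.proj (R := ℝ) (φ := fun _ : Fin 2 => ℝ) j) p :=
      (ContinuousLinearMap.proj (R := ℝ) (φ := fun _ : Fin 2 => ℝ) j).hasStrictFDerivAt
    have := hf.mul hj
    simp only [map_mul, eval_X]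
    refine this.congr_fderiv ?_
    ext x
    fin_cases j
    · simp [pderiv_X]; ring
    · simp [pderiv_X]; ring

/-- Jacobian determinant at `p` -/
def Jac (p : Fin 2 → ℝ) (u v : A2) : ℝ :=
  eval p (pderiv 0 u) * eval p (pderiv 1 v) - eval p (pderiv 1 u) * eval p (pderiv 0 v)

theorem theta_m0 (p : Fin 2 → ℝ) (u v : A2) (hu : eval p u = 0) (hv : eval p v = 0) (N : ℕ) {h : A2}
    (hh : h ∈ m0 ^ N) : aeval ![u, v] h ∈ mp p ^ N := by
  have h1 : m0.map (aeval ![u, v] : A2 →ₐ[ℝ] A2) ≤ mp p := by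
    rw [m0, idealOfVars, Ideal.map_span, Ideal.span_le]
    rintro _ ⟨_, ⟨j, rfl⟩, rfl⟩
    rw [SetLike.mem_coe, mem_mp]
    fin_cases j <;> simp [hu, hv]
  have h2 := Ideal.mem_map_of_mem (aeval ![u, v] : A2 →ₐ[ℝ] A2) hh
  rw [Ideal.map_pow] at h2
  exact Ideal.pow_right_mono h1 N h2

theorem theta_base (p : Fin 2 → ℝ) (u v : A2) (hu : eval p u = 0) (hv : eval p v = 0)
    (hJ : Jac p u v ≠ 0) (h : A2) (hh : h ∈ mp p) :
    ∃ F : A2, F ∈ m0 ∧ h - aeval ![u, v] F ∈ mp p ^ 2 := by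
  have tu := taylor1 p u
  have tv := taylor1 p v
  have th := taylor1 p h
  rw [mem_mp] at hh
  rw [hu, C_0, sub_zero] at tu
  rw [hv, C_0, sub_zero] at tv
  rw [hh, C_0, sub_zero] at th
  set a := eval p (pderiv 0 u); set b := eval p (pderiv 1 u)
  set c := eval p (pderiv 0 v); set d := eval p (pderiv 1 v)
  set e := eval p (pderiv 0 h); set f := eval p (pderiv 1 h)
  have hJ' : a * d - b * c ≠ 0 := hJ
  -- r a + s c = e, r b + s d = f
  set r := (e * d - f * c) / (a * d - b * c) with hr
  set s := (a * f - b * e) / (a * d - b * c) with hs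
  have e1 : r * a + s * c = e := by rw [hr, hs]; rw [div_mul_eq_mul_div, div_mul_eq_mul_div, ← add_div, div_eq_iff hJ']; ring
  have e2 : r * b + s * d = f := by rw [hr, hs]; rw [div_mul_eq_mul_div, div_mul_eq_mul_div, ← add_div, div_eq_iff hJ']; ring
  refine ⟨C r * X 0 + C s * X 1, ?_, ?_⟩
  · refine Ideal.add_mem _ (Ideal.mul_mem_left _ _ ?_) (Ideal.mul_mem_left _ _ ?_) <;>
    exact Ideal.subset_span ⟨_, rfl⟩
  · have := (mp p ^ 2).sub_mem ((mp p ^ 2).sub_mem th ((mp p ^ 2).mul_mem_left (C r) tu))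
      ((mp p ^ 2).mul_mem_left (C s) tv)
    convert this using 1
    rw [← e1, ← e2]
    simp; ring

theorem theta_pow (p : Fin 2 → ℝ) (u v : A2) (hu : eval p u = 0) (hv : eval p v = 0)
    (hJ : Jac p u v ≠ 0) (k : ℕ) (h : A2) (hh : h ∈ mp p ^ k) :
    ∃ F : A2, F ∈ m0 ^ k ∧ h - aeval ![u, v] F ∈ mp p ^ (k + 1) := by
  induction k generalizing h with
  | zero =>
    refine ⟨C (eval p h), by simp, ?_⟩
    simpa using sub_eval_mp p h
  | succ k ih =>
    rw [pow_succ] at hh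
    induction hh using Submodule.mul_induction_on' with
    | mem_mul_mem a ha b hb =>
      obtain ⟨F, hF, hF'⟩ := ih a ha
      obtain ⟨G, hG, hG'⟩ := theta_base p u v hu hv hJ b hb
      refine ⟨F * G, by rw [pow_succ]; exact Ideal.mul_mem_mul hF hG, ?_⟩
      have h1 : (a - aeval ![u, v] F) * b ∈ mp p ^ (k + 1 + 1) := by
        rw [pow_succ]; exact Ideal.mul_mem_mul hF' hb
      have h2 : aeval ![u, v] F * (b - aeval ![u, v] G) ∈ mp p ^ (k + 1 + 1) := by
        rw [add_assoc, pow_add]; exact Ideal.mul_mem_mul (theta_m0 p u v hu hv k hF) hG'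
      have := Ideal.add_mem _ h1 h2
      convert this using 1
      rw [map_mul]; ring
    | add a ha b hb iha ihb =>
      obtain ⟨F, hF, hF'⟩ := iha
      obtain ⟨G, hG, hG'⟩ := ihb
      refine ⟨F + G, Ideal.add_mem _ hF hG, ?_⟩
      convert Ideal.add_mem _ hF' hG' using 1
      rw [map_add]; ring

theorem theta_approx (p : Fin 2 → ℝ) (u v : A2) (hu : eval p u = 0) (hv : eval p v = 0)
    (hJ : Jac p u v ≠ 0) (k : ℕ) (h : A2) :
    ∃ F : A2, h - aeval ![u, v] F ∈ mp p ^ k := by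
  induction k with
  | zero => exact ⟨0, by simp⟩
  | succ k ih =>
    obtain ⟨F, hF⟩ := ih
    obtain ⟨G, -, hG⟩ := theta_pow p u v hu hv hJ k _ hF
    refine ⟨F + G, ?_⟩
    convert hG using 1
    rw [map_add]; ring

theorem loc_surj (p : Fin 2 → ℝ) (u v : A2) (hu : eval p u = 0) (hv : eval p v = 0)
    (hJ : Jac p u v ≠ 0) (δ : ℝ) (hδ : 0 < δ) :
    ∃ δ' > 0, ∀ y : Fin 2 → ℝ, |y 0| ≤ δ' → |y 1| ≤ δ' →
      ∃ x : Fin 2 → ℝ, ‖x - p‖ < δ ∧ y = ![eval x u, eval x v] := by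
  have hs : HasStrictFDerivAt (fun x : Fin 2 → ℝ => ![eval x u, eval x v])
      (ContinuousLinearMap.pi ![eval p (pderiv 0 u) • ContinuousLinearMap.proj (R := ℝ) (φ := fun _ : Fin 2 => ℝ) 0
        + eval p (pderiv 1 u) • ContinuousLinearMap.proj (R := ℝ) (φ := fun _ : Fin 2 => ℝ) 1,
        eval p (pderiv 0 v) • ContinuousLinearMap.proj (R := ℝ) (φ := fun _ : Fin 2 => ℝ) 0
        + eval p (pderiv 1 v) • ContinuousLinearMap.proj (R := ℝ) (φ := fun _ : Fin 2 => ℝ) 1]) p := by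
    rw [hasStrictFDerivAt_pi']
    intro i
    fin_cases i
    · exact pderiv_strict p u
    · exact pderiv_strict p v
  have hmap := hs.map_nhds_eq_of_surj (by
    rw [LinearMap.range_eq_top]
    intro y
    have hJ' : eval p (pderiv 0 u) * eval p (pderiv 1 v) - eval p (pderiv 1 u) * eval p (pderiv 0 v) ≠ 0 := hJ
    set a := eval p (pderiv 0 u); set b := eval p (pderiv 1 u)
    set c := eval p (pderiv 0 v); set d := eval p (pderiv 1 v)
    refine ⟨![(d * y 0 - b * y 1) / (a * d - b * c), (a * y 1 - c * y 0) / (a * d - b * c)], ?_⟩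
    ext i
    fin_cases i
    · simp; rw [mul_div_assoc', mul_div_assoc', ← add_div, div_eq_iff hJ']; ring
    · simp; rw [mul_div_assoc', mul_div_assoc', ← add_div, div_eq_iff hJ']; ring)
  have hball : Metric.ball p δ ∈ nhds p := Metric.ball_mem_nhds p hδ
  have him := Filter.image_mem_map (m := fun x : Fin 2 → ℝ => ![eval x u, eval x v]) hball
  rw [hmap] at him
  obtain ⟨ε, hε, hsub⟩ := Metric.mem_nhds_iff.1 him
  refine ⟨ε / 2, by positivity, fun y h0 h1 => ?_⟩
  have hy : y ∈ Metric.ball ![eval p u, eval p v] ε := by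
    rw [Metric.mem_ball, dist_eq_norm, pi_norm_lt_iff hε]
    intro i
    fin_cases i
    · simp [hu]; linarith
    · simp [hv]; linarith
  obtain ⟨x, hx, hxy⟩ := hsub hy
  exact ⟨x, by rwa [Metric.mem_ball, dist_eq_norm] at hx, hxy.symm⟩

theorem local_coord (p : Fin 2 → ℝ) (u v : A2) (hu : eval p u = 0) (hv : eval p v = 0)
    (hJ : Jac p u v ≠ 0) (P : (Fin 2 → ℝ) → Prop) (f : A2) (δ c : ℝ) (m : ℕ) (hδ : 0 < δ) (hc : 0 < c)
    (hf : ∀ x : Fin 2 → ℝ, ‖x - p‖ < δ → P ![eval x u, eval x v] → c * ‖x - p‖ ^ m ≤ eval x f) (N : ℕ) :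
    ∃ F : A2, f - aeval ![u, v] F ∈ mp p ^ N ∧ ∃ δ' c' : ℝ, 0 < δ' ∧ 0 < c' ∧
      ∀ y : Fin 2 → ℝ, P y → |y 0| ≤ δ' → |y 1| ≤ δ' → c' * |y 0| ^ m ≤ eval y F := by
  obtain ⟨F, hF⟩ := theta_approx p u v hu hv hJ (N + (m + 1)) f
  obtain ⟨M, hM0, hM⟩ := mp_bound p (m + 1) _ (Ideal.pow_le_pow_right (by omega) hF)
  obtain ⟨L, hL0, hL⟩ := mp_bound p 1 u (by rw [pow_one, mem_mp]; exact hu)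
  refine ⟨F, Ideal.pow_le_pow_right (by omega) hF, ?_⟩
  obtain ⟨δ', hδ', hs⟩ := loc_surj p u v hu hv hJ (min (min δ 1) (c / (2 * (M + 1)))) (by positivity)
  refine ⟨δ', c / 2 / (L + 1) ^ m, hδ', by positivity, fun y hP h0 h1 => ?_⟩
  obtain ⟨x, hx, rfl⟩ := hs y h0 h1
  have hx1 : ‖x - p‖ < δ := hx.trans_le ((min_le_left _ _).trans (min_le_left _ _))
  have hx2 : ‖x - p‖ < 1 := hx.trans_le ((min_le_left _ _).trans (min_le_right _ _))
  have hx3 : ‖x - p‖ < c / (2 * (M + 1)) := hx.trans_le (min_le_right _ _)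
  have h1 := hf x hx1 hP
  have h2 := hM x hx2.le
  have h3 := hL x hx2.le
  have e1 : eval x (aeval ![u, v] F) = eval ![eval x u, eval x v] F := by
    rw [← MvPolynomial.coe_aeval_eq_eval, ← MvPolynomial.coe_aeval_eq_eval]
    simp only [RingHom.coe_coe]
    rw [← AlgHom.comp_apply]
    congr 1
    ext j; fin_cases j <;> simp
  rw [map_sub, e1] at h2
  have hr : 0 ≤ ‖x - p‖ := norm_nonneg _
  have h4 : M * ‖x - p‖ ^ (m + 1) ≤ c / 2 * ‖x - p‖ ^ m := by
    rw [pow_succ]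
    have : M * ‖x - p‖ ≤ c / 2 := by
      rw [lt_div_iff₀ (by positivity)] at hx3
      nlinarith
    calc M * (‖x - p‖ ^ m * ‖x - p‖) = (M * ‖x - p‖) * ‖x - p‖ ^ m := by ring
      _ ≤ _ := by gcongr
  have h5 := (abs_le.1 h2).2
  have h6 : |eval x u| ^ m ≤ (L + 1) ^ m * ‖x - p‖ ^ m := by
    rw [← mul_pow]
    apply pow_le_pow_left₀ (abs_nonneg _)
    rw [pow_one] at h3
    nlinarith
  have h7 : c / 2 / (L + 1) ^ m * |eval x u| ^ m ≤ c / 2 * ‖x - p‖ ^ m := by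
    rw [div_mul_eq_mul_div, div_le_iff₀ (by positivity)]
    calc c / 2 * |eval x u| ^ m ≤ c / 2 * ((L + 1) ^ m * ‖x - p‖ ^ m) := by gcongr
      _ = _ := by ring
  simp only [Matrix.cons_val_zero]
  linarith

theorem rep_push (p : Fin 2 → ℝ) (u v : A2) (hu : eval p u = 0) (hv : eval p v = 0) {T : Set A2} (hT : IsPre T)
    (W : Set A2) (hW : ∀ w ∈ W, aeval ![u, v] w ∈ T) (f F : A2) (N : ℕ)
    (h1 : f - aeval ![u, v] F ∈ mp p ^ N) (h2 : Rep W F N) : ∃ t ∈ T, f - t ∈ mp p ^ N := by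
  obtain ⟨ι, _, w, h, hw, hh⟩ := h2
  refine ⟨aeval ![u, v] (∑ k, w k * h k ^ 2), ?_, ?_⟩
  · rw [map_sum]
    refine hT.sum _ _ fun k _ => ?_
    rw [map_mul, map_pow]
    exact hT.mul (hW _ (hw k)) (hT.sq _)
  · have := Ideal.add_mem _ h1 (theta_m0 p u v hu hv N hh)
    convert this using 1
    rw [map_sub]; ring

theorem local_rep {J : Type} [Fintype J] (g : J → A2) {T : Set A2} (hT : IsPre T) (hg : ∀ j, g j ∈ T)
    (hnonsing : ∀ i, ∀ p : Fin 2 → ℝ, eval p (g i) = 0 →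
      (eval p (pderiv 0 (g i)) ≠ 0 ∨ eval p (pderiv 1 (g i)) ≠ 0))
    (htrans : ∀ i j, i ≠ j → ∀ p : Fin 2 → ℝ, eval p (g i) = 0 → eval p (g j) = 0 → Jac p (g i) (g j) ≠ 0)
    (hthree : ∀ i j k, i ≠ j → j ≠ k → i ≠ k → ∀ p : Fin 2 → ℝ,
      ¬ (eval p (g i) = 0 ∧ eval p (g j) = 0 ∧ eval p (g k) = 0))
    (p : Fin 2 → ℝ) (hp : p ∈ KS g) (f : A2) (δ c : ℝ) (m : ℕ) (hδ : 0 < δ) (hc : 0 < c)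
    (hf : ∀ x ∈ KS g, ‖x - p‖ < δ → c * ‖x - p‖ ^ m ≤ eval x f) (N : ℕ) :
    ∃ t ∈ T, f - t ∈ mp p ^ N := by
  classical
  -- near `p` only the vanishing constraints matter
  have hnear : ∃ δ1 > 0, δ1 ≤ δ ∧ ∀ x : Fin 2 → ℝ, ‖x - p‖ < δ1 → (∀ j, eval p (g j) = 0 → 0 ≤ eval x (g j)) →
      x ∈ KS g := by
    have hev : ∀ᶠ x in nhds p, ∀ j, eval p (g j) ≠ 0 → 0 < eval x (g j) := by
      rw [Filter.eventually_all]
      intro j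
      by_cases h0 : eval p (g j) = 0
      · simp [h0]
      · have : 0 < eval p (g j) := lt_of_le_of_ne (hp j) (Ne.symm h0)
        filter_upwards [(MvPolynomial.continuous_eval (g j)).continuousAt.eventually (lt_mem_nhds this)] with x hx _
        exact hx
    obtain ⟨ε, hε, h⟩ := Metric.eventually_nhds_iff.1 hev
    refine ⟨min ε δ, by positivity, min_le_right _ _, fun x hx hj j => ?_⟩
    by_cases h0 : eval p (g j) = 0
    · exact hj j h0
    · exact (h (by rw [dist_eq_norm]; exact hx.trans_le (min_le_left _ _)) j h0).le
  obtain ⟨δ1, hδ1, hδδ, hnear⟩ := hnear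
  have h1T : (1 : A2) ∈ T := hT.one
  by_cases hA : ∃ i, eval p (g i) = 0
  · obtain ⟨i, hi⟩ := hA
    by_cases hB : ∃ j, j ≠ i ∧ eval p (g j) = 0
    · obtain ⟨j, hji, hj⟩ := hB
      have hJ := htrans i j hji.symm p hi hj
      obtain ⟨F, hF, δ', c', hδ', hc', hF'⟩ := local_coord p (g i) (g j) hi hj hJ (fun y => 0 ≤ y 0 ∧ 0 ≤ y 1)
        f δ1 c m hδ1 hc (by
          rintro x hx ⟨hx0, hx1⟩
          refine hf x (hnear x hx ?_) (hx.trans_le hδδ)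
          intro k hk
          by_cases hki : k = i
          · subst hki; exact hx0
          by_cases hkj : k = j
          · subst hkj; exact hx1
          exact (hthree i j k hji.symm (Ne.symm hkj) (Ne.symm hki) p ⟨hi, hj, hk⟩).elim) N
      refine rep_push p _ _ hi hj hT _ ?_ f F N hF
        (quad2 F δ' c' m hδ' hc' (fun y h0 h1 h2 h3 => hF' y ⟨h0, h1⟩ h2 h3) N)
      rintro w ((rfl | rfl) | ⟨w, (rfl | rfl), rfl⟩)
      · simpa using h1T
      · simpa using hg i
      · simpa using hg j
      · simpa using hT.mul (hg i) (hg j)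
    · push Not at hB
      obtain ⟨v, hv, hJ⟩ : ∃ v : A2, eval p v = 0 ∧ Jac p (g i) v ≠ 0 := by
        rcases hnonsing i p hi with h | h
        · exact ⟨X 1 - C (p 1), by simp, by simpa [Jac, pderiv_X] using h⟩
        · exact ⟨X 0 - C (p 0), by simp, by simpa [Jac, pderiv_X] using h⟩
      obtain ⟨F, hF, δ', c', hδ', hc', hF'⟩ := local_coord p (g i) v hi hv hJ (fun y => 0 ≤ y 0)
        f δ1 c m hδ1 hc (by
          rintro x hx hx0
          refine hf x (hnear x hx ?_) (hx.trans_le hδδ)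
          intro k hk
          by_cases hki : k = i
          · subst hki; exact hx0
          exact (hB k hki hk).elim) N
      refine rep_push p _ _ hi hv hT _ ?_ f F N hF
        (quad1 F δ' c' m hδ' hc' (fun y h0 h2 h3 => hF' y h0 h2 h3) N)
      rintro w (rfl | rfl)
      · simpa using h1T
      · simpa using hg i
  · push Not at hA
    have hu : eval p (X 0 - C (p 0) : A2) = 0 := by simp
    have hv : eval p (X 1 - C (p 1) : A2) = 0 := by simp
    obtain ⟨F, hF, δ', c', hδ', hc', hF'⟩ := local_coord p _ _ hu hv (by simp [Jac, pderiv_X])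
        (fun y => True) f δ1 c m hδ1 hc (by
          rintro x hx -
          exact hf x (hnear x hx fun k hk => (hA k hk).elim) (hx.trans_le hδδ)) N
    refine rep_push p _ _ hu hv hT _ ?_ f F N hF
        (quad0 F δ' c' m hδ' hc' (fun y h2 h3 => hF' y trivial h2 h3) N)
    rintro w rfl
    simpa using h1T

end Sch

namespace Sch

theorem mp_coprime {p q : Fin 2 → ℝ} (h : p ≠ q) : IsCoprime (mp p) (mp q) := by
  rw [Ideal.isCoprime_iff_exists]
  obtain ⟨i, hi⟩ := Function.ne_iff.1 h
  have hne : q i - p i ≠ 0 := sub_ne_zero.2 (Ne.symm hi)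
  refine ⟨C (1 / (q i - p i)) * (X i - C (p i)), Ideal.mul_mem_left _ _ (X_mp p i),
    C (1 / (q i - p i)) * -(X i - C (q i)), Ideal.mul_mem_left _ _ (neg_mem (X_mp q i)), ?_⟩
  have : (C (1 / (q i - p i)) * (X i - C (p i)) + C (1 / (q i - p i)) * -(X i - C (q i)) : A2)
      = C (1 / (q i - p i) * (q i - p i)) := by
    rw [C_mul, C_sub]; ring
  rw [this, one_div, inv_mul_cancel₀ hne, C_1]

/-- support of a preordering -/
def suppI {T : Set A2} (hT : IsPre T) : Ideal A2 where
  carrier := {a | a ∈ T ∧ -a ∈ T}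
  add_mem' := by
    rintro a b ⟨h1, h2⟩ ⟨h3, h4⟩
    exact ⟨hT.add h1 h3, by rw [neg_add]; exact hT.add h2 h4⟩
  zero_mem' := ⟨hT.zero, by rw [neg_zero]; exact hT.zero⟩
  smul_mem' := by
    rintro r a ⟨h1, h2⟩
    have e : r = (C (1/2) * (r + 1)) ^ 2 - (C (1/2) * (r - 1)) ^ 2 := by
      have : (C (1/2) * (r + 1)) ^ 2 - (C (1/2) * (r - 1)) ^ 2 = r * (C (1/2) * 2) * (C (1/2) * 2) := by ring
      rw [this, Chalf]; ring
    rw [smul_eq_mul]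
    constructor
    · rw [e]
      have := hT.add (hT.mul (hT.sq (C (1/2) * (r + 1))) h1) (hT.mul (hT.sq (C (1/2) * (r - 1))) h2)
      convert this using 1; ring
    · rw [e]
      have := hT.add (hT.mul (hT.sq (C (1/2) * (r + 1))) h2) (hT.mul (hT.sq (C (1/2) * (r - 1))) h1)
      convert this using 1; ring

theorem fin_r1 {M H w I Q η ε : ℝ} (hM : 0 ≤ M) (h0 : 0 ≤ H) (h1 : H ≤ M) (w0 : 0 ≤ w) (w1 : w ≤ M)
    (hI : I * (1 + w) = 1) (hQ : -η ≤ Q - I) (hη : 2 * (M + 1) ^ 2 * η = ε) (η0 : 0 < η) (ε0 : 0 < ε) :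
    0 < (H * Q + ε) * (1 + w) - H := by
  have e1 : (H * Q + ε) * (1 + w) - H = H * ((Q - I) * (1 + w)) + ε + ε * w := by
    linear_combination H * hI
  have e2 : -η * (M + 1) ≤ (Q - I) * (1 + w) := by
    have : -η * (1 + w) ≤ (Q - I) * (1 + w) := mul_le_mul_of_nonneg_right hQ (by linarith)
    have : η * w ≤ η * M := mul_le_mul_of_nonneg_left w1 η0.le
    linarith
  have e3 : H * (-η * (M + 1)) ≤ H * ((Q - I) * (1 + w)) := mul_le_mul_of_nonneg_left e2 h0
  have e4 : H * (η * (M + 1)) ≤ M * (η * (M + 1)) := mul_le_mul_of_nonneg_right h1 (by positivity)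
  have e5 : 0 < η * (M + 1) * (M + 2) := by positivity
  have e6 : 0 ≤ ε * w := by positivity
  rw [e1]
  nlinarith

theorem fin_r2 {M F H w I Q η ε : ℝ} (hM : 0 ≤ M) (h0 : 0 ≤ F) (h1 : F ≤ M) (hw : F * H = w)
    (w0 : 0 ≤ w) (w1 : w ≤ M)
    (hI : I * (1 + w) = 1) (hQ : Q - I ≤ η) (hη : 2 * (M + 1) ^ 2 * η = ε) (hε : 4 * (M + 1) ^ 2 * ε = 1)
    (η0 : 0 < η) (ε0 : 0 < ε) :
    0 < 1 - F * (H * Q + ε) := by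
  have e1 : 1 - F * (H * Q + ε) = I - w * (Q - I) - ε * F := by
    linear_combination (-1 : ℝ) * hI - Q * hw
  have e2 : w * (Q - I) ≤ M * η :=
    (mul_le_mul_of_nonneg_left hQ w0).trans (mul_le_mul_of_nonneg_right w1 η0.le)
  have e3 : ε * F ≤ ε * M := mul_le_mul_of_nonneg_left h1 ε0.le
  have e4 : M * η ≤ ε := by
    rw [← hη]
    have : 0 ≤ η * (2 * (M + 1) ^ 2 - M) := mul_nonneg η0.le (by nlinarith)
    linarith
  have e5 : 4 * (M + 1) * ε ≤ I := by
    have h2 : I = 1 / (1 + w) := by field_simp; linarith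
    have h3 : 4 * (M + 1) * ε = 1 / (1 + M) := by field_simp; linarith
    rw [h2, h3]
    exact one_div_le_one_div_of_le (by linarith) (by linarith)
  have e6 : 0 ≤ ε * M := by positivity
  rw [e1]
  linarith

section
variable {J : Type} [Fintype J] (g : J → A2)
variable (hirr : ∀ j, Irreducible (g j)) (hcop : ∀ i j, i ≠ j → IsRelPrime (g i) (g j))
    (hb : Bornology.IsBounded (KS g)) {T : Set A2} (hT : IsPre T) (hg : ∀ j, g j ∈ T)
include hirr hcop hb hT hg

theorem finish (hTK : ∀ t ∈ T, ∀ p ∈ KS g, 0 ≤ eval p t) (f h : A2) (hf : ∀ p ∈ KS g, 0 ≤ eval p f)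
    (hh : h ∈ T) (hfh : f * (1 + f * h) ∈ T) : f ∈ T := by
  obtain ⟨M1, hM1⟩ := eval_T_nonneg_bdd g hirr hcop hb hT hg f
  obtain ⟨M2, hM2⟩ := eval_T_nonneg_bdd g hirr hcop hb hT hg h
  obtain ⟨M3, hM3⟩ := eval_T_nonneg_bdd g hirr hcop hb hT hg (f * h)
  set M : ℝ := |M1| + |M2| + |M3| with hM
  have hM0 : 0 ≤ M := by positivity
  set ε : ℝ := 1 / (4 * (M + 1) ^ 2) with hε
  have hε0 : 0 < ε := by positivity
  set η : ℝ := ε / (2 * (M + 1) ^ 2) with hη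
  have hη0 : 0 < η := by positivity
  obtain ⟨q, hq⟩ := exists_polynomial_near_of_continuousOn 0 M (fun w => 1 / (1 + w)) (by
    apply ContinuousOn.div continuousOn_const (by fun_prop)
    intro x hx; have := hx.1; positivity) η hη0
  set ρ : A2 := h * (Polynomial.aeval (f * h) q) + C ε with hρ
  have key : ∀ p ∈ KS g, 0 < eval p (ρ * (1 + f * h) - h) ∧ 0 < eval p (1 - f * ρ) := by
    intro p hp
    have a1 := (le_abs_self _).trans ((hM1 p hp).trans (le_abs_self M1))
    have a2 := (le_abs_self _).trans ((hM2 p hp).trans (le_abs_self M2))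
    have a3 := (le_abs_self _).trans ((hM3 p hp).trans (le_abs_self M3))
    have b1 := hf p hp
    have b2 := hTK h hh p hp
    have n1 := abs_nonneg M1
    have n2 := abs_nonneg M2
    have n3 := abs_nonneg M3
    have e1 : eval p (Polynomial.aeval (f * h) q) = q.eval (eval p f * eval p h) := by
      have := Polynomial.hom_eval₂ q (algebraMap ℝ A2) (eval p) (f * h)
      rw [← Polynomial.aeval_def] at this
      rw [this, map_mul]
      have : (eval p).comp (algebraMap ℝ A2) = RingHom.id ℝ := by ext x; simp
      rw [this]; rfl
    rw [map_mul] at a3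
    have hw0 : 0 ≤ eval p f * eval p h := mul_nonneg b1 b2
    have hqw := hq (eval p f * eval p h) ⟨hw0, by linarith⟩
    simp only [map_sub, map_mul, map_add, map_one, hρ, e1, eval_C]
    generalize eval p f = F at *
    generalize eval p h = H at *
    generalize q.eval (F * H) = Q at *
    have hFM : F ≤ M := by linarith
    have hHM : H ≤ M := by linarith
    have hwM : F * H ≤ M := by linarith
    obtain ⟨c1, c2⟩ := abs_lt.1 hqw
    have hpos : 0 < 1 + F * H := by linarith
    have hinv : 1 / (1 + F * H) * (1 + F * H) = 1 := by field_simp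
    generalize 1 / (1 + F * H) = I at *
    have hηM : 2 * (M + 1) ^ 2 * η = ε := by rw [hη]; field_simp
    have hεM : 4 * (M + 1) ^ 2 * ε = 1 := by rw [hε]; field_simp
    generalize hw : F * H = w at *
    exact ⟨fin_r1 hM0 b2 hHM hw0 hwM hinv (by linarith) hηM hη0 hε0,
      fin_r2 hM0 b1 hFM hw hw0 hwM hinv (by linarith) hηM hεM hη0 hε0⟩
  have hσ := KD g hirr hcop hb hT hg _ (fun p hp => (key p hp).1)
  have hτ := KD g hirr hcop hb hT hg _ (fun p hp => (key p hp).2)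
  have := hT.add (hT.mul hσ (hT.sq f)) (hT.mul hτ hfh)
  convert this using 1
  ring

theorem globalize (hTK : ∀ t ∈ T, ∀ p ∈ KS g, 0 ≤ eval p t)
    (hnonsing : ∀ i, ∀ p : Fin 2 → ℝ, eval p (g i) = 0 →
      (eval p (pderiv 0 (g i)) ≠ 0 ∨ eval p (pderiv 1 (g i)) ≠ 0))
    (htrans : ∀ i j, i ≠ j → ∀ p : Fin 2 → ℝ, eval p (g i) = 0 → eval p (g j) = 0 → Jac p (g i) (g j) ≠ 0)
    (hthree : ∀ i j k, i ≠ j → j ≠ k → i ≠ k → ∀ p : Fin 2 → ℝ,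
      ¬ (eval p (g i) = 0 ∧ eval p (g j) = 0 ∧ eval p (g k) = 0))
    (f : A2) (hf : ∀ p ∈ KS g, 0 ≤ eval p f) (hsq : Squarefree f)
    (hfg : ∀ j, IsRelPrime f (g j)) (hZ : {p | p ∈ KS g ∧ eval p f = 0}.Finite) : f ∈ T := by
  classical
  set Z := hZ.toFinset with hZdef
  have memZ : ∀ p, p ∈ Z ↔ p ∈ KS g ∧ eval p f = 0 := fun p => by rw [hZdef, Set.Finite.mem_toFinset]; rfl
  have hcrt : ∀ N : ℕ, Pairwise (Function.onFun IsCoprime (fun p : Z => mp p.1 ^ N)) := by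
    intro N p q hpq
    exact (mp_coprime (fun h => hpq (Subtype.ext h))).pow
  -- the idempotents
  have hE : ∀ N : ℕ, ∀ p : Z, ∃ E : A2, E - 1 ∈ mp p.1 ^ N ∧ ∀ q : Z, q ≠ p → E ∈ mp q.1 ^ N := by
    intro N p
    obtain ⟨E, hE⟩ := Ideal.exists_forall_sub_mem_ideal (hcrt N) (fun q => if q = p then 1 else 0)
    refine ⟨E, by simpa using hE p, fun q hq => by simpa [hq] using hE q⟩
  -- the radical argument
  have hQ := hT.ext (-(f ^ 2))
  have hrad : (⨅ p : Z, mp p.1) ≤ (suppI hQ).radical := by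
    intro D hD
    obtain ⟨k, s, hs, t, ht, he⟩ := loj0 g hirr hcop hb hT hg f hf hsq hfg hZ D (by
      intro p hp hfp
      rw [← mem_mp]
      exact (Ideal.mem_iInf.1 hD) ⟨p, (memZ p).2 ⟨hp, hfp⟩⟩)
    refine ⟨4 * k, ⟨D ^ (4 * k), ?_, 0, hT.zero, by ring⟩, ⟨2 * D ^ (2 * k) * s + s ^ 2, ?_, t ^ 2, hT.sq t, ?_⟩⟩
    · have := hT.sq (D ^ (2 * k))
      rwa [← pow_mul, show 2 * k * 2 = 4 * k by ring] at this
    · have h1 : D ^ (2 * k) * s ∈ T := by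
        have := hT.sq (D ^ k)
        rw [← pow_mul, mul_comm k 2] at this
        exact hT.mul this hs
      have := hT.add (hT.add h1 h1) (hT.sq s)
      convert this using 1; ring
    · have e2 : (f * t) ^ 2 = (D ^ (2 * k) + s) ^ 2 := by rw [he]
      have e3 : D ^ (4 * k) = (D ^ (2 * k)) ^ 2 := by rw [← pow_mul]; congr 1; ring
      rw [e3]
      linear_combination e2
  obtain ⟨N, hN⟩ := Ideal.exists_pow_le_of_le_radical_of_fg_radical hrad (IsNoetherian.noetherian _)
  -- local representations
  have hloc : ∀ p : Z, ∃ t ∈ T, f - t ∈ mp p.1 ^ N := by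
    rintro ⟨p, hp⟩
    obtain ⟨E, hE1, hE2⟩ := hE 1 ⟨p, hp⟩
    obtain ⟨k, c, hc, hk⟩ := loj g hirr hcop hb hT hg hTK f hf hsq hfg hZ
      (E * ((X 0 - C (p 0)) ^ 2 + (X 1 - C (p 1)) ^ 2)) (by
        intro q hq hfq
        by_cases hqp : q = p
        · subst hqp; simp
        · have := hE2 ⟨q, (memZ q).2 ⟨hq, hfq⟩⟩ (fun h => hqp (congrArg Subtype.val h))
          rw [pow_one, mem_mp] at this
          rw [map_mul, this, zero_mul])
    rw [pow_one, mem_mp, map_sub, map_one, sub_eq_zero] at hE1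
    have hev : ∀ᶠ x in nhds p, 1 / 2 < eval x E := by
      apply (MvPolynomial.continuous_eval E).continuousAt.eventually
      apply lt_mem_nhds
      show 1 / 2 < eval p E
      rw [hE1]; norm_num
    obtain ⟨δ, hδ, h⟩ := Metric.eventually_nhds_iff.1 hev
    refine local_rep g hT hg hnonsing htrans hthree p ((memZ p).1 hp).1 f δ (c * (1 / 2) ^ (2 * k)) (4 * k) hδ
      (by positivity) ?_ N
    intro x hx hxδ
    refine le_trans ?_ (hk x hx)
    rw [mul_assoc]
    apply mul_le_mul_of_nonneg_left _ hc.le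
    have h1 : 1 / 2 < eval x E := h (by rwa [dist_eq_norm])
    have e1 : ‖x - p‖ ^ (4 * k) = (‖x - p‖ ^ 2) ^ (2 * k) := by rw [← pow_mul]; congr 1; ring
    rw [e1, ← mul_pow]
    apply pow_le_pow_left₀ (by positivity)
    rw [map_mul]
    apply mul_le_mul h1.le _ (by positivity) (by linarith)
    simp only [map_add, map_pow, map_sub, eval_X, eval_C]
    have : ‖x - p‖ ≤ Real.sqrt ((x 0 - p 0) ^ 2 + (x 1 - p 1) ^ 2) := by
      rw [pi_norm_le_iff_of_nonneg (Real.sqrt_nonneg _)]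
      intro i
      apply Real.le_sqrt_of_sq_le
      rw [Real.norm_eq_abs, sq_abs]
      fin_cases i
      · simp; positivity
      · simp; positivity
    calc ‖x - p‖ ^ 2 ≤ Real.sqrt ((x 0 - p 0) ^ 2 + (x 1 - p 1) ^ 2) ^ 2 :=
          pow_le_pow_left₀ (norm_nonneg _) this 2
      _ = _ := Real.sq_sqrt (by positivity)
  choose t ht htN using hloc
  choose E hE1 hE2 using hE N
  set t' : A2 := ∑ p : Z, E p ^ 2 * t p with ht'
  have ht'T : t' ∈ T := hT.sum _ _ fun p _ => hT.mul (hT.sq _) (ht p)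
  have hft : ∀ q : Z, f - t' ∈ mp q.1 ^ N := by
    intro q
    rw [ht', ← Finset.add_sum_erase _ _ (Finset.mem_univ q)]
    have h1 : ∑ p ∈ Finset.univ.erase q, E p ^ 2 * t p ∈ mp q.1 ^ N := by
      refine Ideal.sum_mem _ fun p hp => ?_
      rw [pow_two, mul_assoc]
      exact Ideal.mul_mem_right _ _ (hE2 p q (Ne.symm (Finset.ne_of_mem_erase hp)))
    have h2 : (E q - 1) * ((E q + 1) * t q) ∈ mp q.1 ^ N := Ideal.mul_mem_right _ _ (hE1 q)
    convert Ideal.sub_mem _ (Ideal.sub_mem _ (htN q) h2) h1 using 1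
    ring
  have hmem : f - t' ∈ (⨅ p : Z, mp p.1) ^ N := by
    have e1 := Ideal.prod_eq_iInf_of_pairwise_isCoprime (s := (Finset.univ : Finset Z))
      (J := fun p : Z => mp p.1 ^ N) (fun p _ q _ hpq => hcrt N hpq)
    have e2 := Ideal.prod_eq_iInf_of_pairwise_isCoprime (s := (Finset.univ : Finset Z))
      (J := fun p : Z => mp p.1) (fun p _ q _ hpq => by simpa using hcrt 1 hpq)
    simp only [Finset.mem_univ, iInf_pos] at e1 e2
    rw [← e2, ← Finset.prod_pow, e1, Ideal.mem_iInf]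
    exact hft
  obtain ⟨x, hx, y, hy, hxy⟩ := (hN hmem).1
  refine finish g hirr hcop hb hT hg hTK f y hf hy ?_
  have := hT.add ht'T hx
  convert this using 1
  linear_combination hxy
end

end Sch

namespace Sch

theorem eval_D (D : Polynomial ℝ) (p : Fin 2 → ℝ) :
    eval p (D.eval₂ MvPolynomial.C (X 0) : A2) = D.eval (p 0) := by
  rw [Polynomial.hom_eval₂, eval_X]
  have : (eval p).comp (C : ℝ →+* A2) = RingHom.id ℝ := by ext x; simp
  rw [this]; rfl

theorem D_finite (a b p q : A2) (D : Polynomial ℝ) (hD : D ≠ 0)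
    (h : a * p + b * q = D.eval₂ MvPolynomial.C (X 0)) :
    ∃ S : Finset ℝ, ∀ x : Fin 2 → ℝ, eval x p = 0 → eval x q = 0 → x 0 ∈ S := by
  classical
  refine ⟨D.roots.toFinset, fun x h1 h2 => ?_⟩
  have h3 := congrArg (eval x) h
  rw [eval_D, map_add, map_mul, map_mul, h1, h2] at h3
  rw [Multiset.mem_toFinset, Polynomial.mem_roots hD, Polynomial.IsRoot]
  linarith

theorem box_finite (P : (Fin 2 → ℝ) → Prop) (S1 S2 : Finset ℝ) (h1 : ∀ x, P x → x 0 ∈ S1)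
    (h2 : ∀ x, P x → x 1 ∈ S2) : {x | P x}.Finite := by
  refine ((Fintype.piFinset (![S1, S2] : Fin 2 → Finset ℝ)).finite_toSet).subset ?_
  intro x hx
  rw [Finset.mem_coe, Fintype.mem_piFinset]
  intro i
  fin_cases i
  · exact h1 x hx
  · exact h2 x hx

theorem eval_sw' (f : A2) (x : Fin 2 → ℝ) : eval ![x 1, x 0] (sw f) = eval x f := by
  rw [eval_sw]
  have : (![![x 1, x 0] 1, ![x 1, x 0] 0] : Fin 2 → ℝ) = x := by
    funext i; fin_cases i <;> rfl
  rw [this]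

theorem common_finite (p q : A2) (hp : p ≠ 0) (h : IsRelPrime p q) :
    {x : Fin 2 → ℝ | eval x p = 0 ∧ eval x q = 0}.Finite := by
  obtain ⟨a, b, D, hD, he⟩ := BZ1 p q hp h
  obtain ⟨S1, hS1⟩ := D_finite a b p q D hD he
  obtain ⟨a, b, D, hD, he⟩ := BZ1 (sw p) (sw q) (by simpa using hp) (relprime_sw h)
  obtain ⟨S2, hS2⟩ := D_finite a b _ _ D hD he
  refine box_finite _ S1 S2 (fun x hx => hS1 x hx.1 hx.2) (fun x hx => ?_)
  have := hS2 ![x 1, x 0] (by rw [eval_sw']; exact hx.1)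
    (by rw [eval_sw']; exact hx.2)
  simpa using this

theorem pderiv_sw (f : A2) : pderiv 1 (sw f) = sw (pderiv 0 f) := by
  induction f using MvPolynomial.induction_on with
  | C a => simp [sw_C]
  | add f g hf hg => simp [hf, hg]
  | mul_X f j hf =>
    fin_cases j
    · simp [hf, pderiv_X, sw_X0]
    · simp [hf, pderiv_X, sw_X1]

theorem crit_finite (f : A2) (h : Squarefree f) :
    {x : Fin 2 → ℝ | eval x f = 0 ∧ eval x (pderiv 0 f) = 0 ∧ eval x (pderiv 1 f) = 0}.Finite := by
  obtain ⟨a, b, D, hD, he⟩ := BZ2 f h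
  obtain ⟨S1, hS1⟩ := D_finite a b _ _ D hD he
  obtain ⟨a, b, D, hD, he⟩ := BZ2 (sw f) (squarefree_sw h)
  rw [pderiv_sw] at he
  obtain ⟨S2, hS2⟩ := D_finite a b _ _ D hD he
  refine box_finite _ S1 S2 (fun x hx => hS1 x hx.1 hx.2.2) (fun x hx => ?_)
  have := hS2 ![x 1, x 0] (by rw [eval_sw']; exact hx.1)
    (by rw [eval_sw']; exact hx.2.1)
  simpa using this

theorem open_nonzero (h : A2) (hh : h ≠ 0) (U : Set (Fin 2 → ℝ)) (hU : IsOpen U) (hne : U.Nonempty) :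
    ∃ x ∈ U, eval x h ≠ 0 := by
  by_contra hc
  push Not at hc
  obtain ⟨p, hp⟩ := hne
  obtain ⟨ε, hε, hs⟩ := Metric.isOpen_iff.1 hU p hp
  apply hh
  refine MvPolynomial.funext_set (fun i => Set.Ioo (p i - ε) (p i + ε))
    (fun i => Set.Ioo_infinite (by linarith)) (fun x hx => ?_)
  rw [map_zero]
  apply hc x (hs _)
  rw [Metric.mem_ball, dist_pi_lt_iff hε]
  intro i
  have := hx i trivial
  rw [Real.dist_eq, abs_lt]
  constructor <;> linarith [this.1, this.2]

section
variable {J : Type} [Fintype J] (g : J → A2)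
  (hnonsing : ∀ i, ∀ p : Fin 2 → ℝ, eval p (g i) = 0 →
      (eval p (pderiv 0 (g i)) ≠ 0 ∨ eval p (pderiv 1 (g i)) ≠ 0))
  (htrans : ∀ i j, i ≠ j → ∀ p : Fin 2 → ℝ, eval p (g i) = 0 → eval p (g j) = 0 → Jac p (g i) (g j) ≠ 0)
  (hthree : ∀ i j k, i ≠ j → j ≠ k → i ≠ k → ∀ p : Fin 2 → ℝ,
      ¬ (eval p (g i) = 0 ∧ eval p (g j) = 0 ∧ eval p (g k) = 0))

theorem near_KS (p : Fin 2 → ℝ) (hp : p ∈ KS g) :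
    ∃ δ1 > 0, ∀ x : Fin 2 → ℝ, ‖x - p‖ < δ1 → (∀ j, eval p (g j) = 0 → 0 ≤ eval x (g j)) →
      x ∈ KS g := by
  have hev : ∀ᶠ x in nhds p, ∀ j, eval p (g j) ≠ 0 → 0 < eval x (g j) := by
    rw [Filter.eventually_all]
    intro j
    by_cases h0 : eval p (g j) = 0
    · simp [h0]
    · have : 0 < eval p (g j) := lt_of_le_of_ne (hp j) (Ne.symm h0)
      filter_upwards [(MvPolynomial.continuous_eval (g j)).continuousAt.eventually (lt_mem_nhds this)] with x hx _
      exact hx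
  obtain ⟨ε, hε, h⟩ := Metric.eventually_nhds_iff.1 hev
  refine ⟨ε, hε, fun x hx hj j => ?_⟩
  by_cases h0 : eval p (g j) = 0
  · exact hj j h0
  · exact (h (by rwa [dist_eq_norm]) j h0).le

theorem zeros_finite (f : A2) (hf : ∀ p ∈ KS g, 0 ≤ eval p f) (hsq : Squarefree f)
    (hfg : ∀ j, IsRelPrime f (g j)) : {p | p ∈ KS g ∧ eval p f = 0}.Finite := by
  refine ((Set.finite_iUnion fun j => common_finite f (g j) hsq.ne_zero (hfg j)).union (crit_finite f hsq)).subset ?_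
  rintro p ⟨hp, hfp⟩
  by_cases hA : ∃ j, eval p (g j) = 0
  · obtain ⟨j, hj⟩ := hA
    exact Or.inl (Set.mem_iUnion.2 ⟨j, hfp, hj⟩)
  · right
    push Not at hA
    obtain ⟨δ, hδ, hn⟩ := near_KS g p hp
    have hmin : IsLocalMin (fun x => eval x f) p := by
      refine Metric.eventually_nhds_iff.2 ⟨δ, hδ, fun x hx => ?_⟩
      simp only [hfp]
      exact hf x (hn x (by rwa [← dist_eq_norm]) fun j hj => (hA j hj).elim)
    have := hmin.hasFDerivAt_eq_zero (pderiv_strict p f).hasFDerivAt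
    have h0 := congrArg (fun L => L ![1, 0]) this
    have h1 := congrArg (fun L => L ![0, 1]) this
    simp at h0 h1
    exact ⟨hfp, h0, h1⟩

include hnonsing htrans hthree
theorem coords (p : Fin 2 → ℝ) :
    ∃ u v : A2, eval p u = 0 ∧ eval p v = 0 ∧ Jac p u v ≠ 0 ∧
      ∀ j, eval p (g j) = 0 → g j = u ∨ g j = v := by
  classical
  by_cases hA : ∃ i, eval p (g i) = 0
  · obtain ⟨i, hi⟩ := hA
    by_cases hB : ∃ j, j ≠ i ∧ eval p (g j) = 0
    · obtain ⟨j, hji, hj⟩ := hB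
      refine ⟨g i, g j, hi, hj, htrans i j hji.symm p hi hj, fun k hk => ?_⟩
      by_cases hki : k = i
      · subst hki; exact Or.inl rfl
      by_cases hkj : k = j
      · subst hkj; exact Or.inr rfl
      exact (hthree i j k hji.symm (Ne.symm hkj) (Ne.symm hki) p ⟨hi, hj, hk⟩).elim
    · push Not at hB
      have hk : ∀ k, eval p (g k) = 0 → g k = g i := by
        intro k hk
        by_cases hki : k = i
        · rw [hki]
        · exact (hB k hki hk).elim
      rcases hnonsing i p hi with h | h
      · exact ⟨g i, X 1 - C (p 1), hi, by simp, by simpa [Jac, pderiv_X] using h, fun k h => Or.inl (hk k h)⟩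
      · exact ⟨g i, X 0 - C (p 0), hi, by simp, by simpa [Jac, pderiv_X] using h, fun k h => Or.inl (hk k h)⟩
  · push Not at hA
    exact ⟨X 0 - C (p 0), X 1 - C (p 1), by simp, by simp, by simp [Jac, pderiv_X], fun k h => (hA k h).elim⟩

theorem dense (p : Fin 2 → ℝ) (hp : p ∈ KS g) (h : A2) (hh : h ≠ 0) (U : Set (Fin 2 → ℝ)) (hU : IsOpen U)
    (hpU : p ∈ U) : ∃ x ∈ KS g, x ∈ U ∧ eval x h ≠ 0 := by
  obtain ⟨δ1, hδ1, hnear⟩ := near_KS g p hp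
  obtain ⟨δ2, hδ2, hs⟩ := Metric.isOpen_iff.1 hU p hpU
  obtain ⟨u, v, hu, hv, hJ, hj⟩ := coords g hnonsing htrans hthree p
  obtain ⟨δ', hδ', hsurj⟩ := loc_surj p u v hu hv hJ (min δ1 δ2) (by positivity)
  obtain ⟨x0, hx0, hx0'⟩ := hsurj ![δ', δ'] (by simp [abs_of_pos hδ']) (by simp [abs_of_pos hδ'])
  have hu0 : eval x0 u = δ' := by have := congrFun hx0' 0; simpa using this.symm
  have hv0 : eval x0 v = δ' := by have := congrFun hx0' 1; simpa using this.symm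
  obtain ⟨x, ⟨hx1, hx2, hx3⟩, hx⟩ := open_nonzero h hh
    {x | ‖x - p‖ < min δ1 δ2 ∧ 0 < eval x u ∧ 0 < eval x v}
    (by
      have o1 : IsOpen {x : Fin 2 → ℝ | ‖x - p‖ < min δ1 δ2} :=
        isOpen_lt (by fun_prop) continuous_const
      have o2 : IsOpen {x : Fin 2 → ℝ | 0 < eval x u} :=
        isOpen_lt continuous_const (MvPolynomial.continuous_eval u)
      have o3 : IsOpen {x : Fin 2 → ℝ | 0 < eval x v} :=
        isOpen_lt continuous_const (MvPolynomial.continuous_eval v)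
      exact o1.inter (o2.inter o3))
    ⟨x0, hx0, by rw [hu0]; exact hδ', by rw [hv0]; exact hδ'⟩
  refine ⟨x, hnear x (hx1.trans_le (min_le_left _ _)) ?_, hs ?_, hx⟩
  · intro j hjp
    rcases hj j hjp with e | e
    · rw [e]; exact hx2.le
    · rw [e]; exact hx3.le
  · rw [Metric.mem_ball, dist_eq_norm]; exact hx1.trans_le (min_le_right _ _)

theorem cancel (h f : A2) (hh : h ≠ 0) (hK : ∀ p ∈ KS g, 0 ≤ eval p h)
    (hf : ∀ p ∈ KS g, 0 ≤ eval p (h * f)) : ∀ p ∈ KS g, 0 ≤ eval p f := by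
  intro p hp
  by_contra hc
  push Not at hc
  obtain ⟨x, hx, hxU, hx0⟩ := dense g hnonsing htrans hthree p hp h hh {x | eval x f < 0}
    (isOpen_lt (MvPolynomial.continuous_eval f) continuous_const) hc
  have h1 := hf x hx
  rw [map_mul] at h1
  have h2 : 0 < eval x h := lt_of_le_of_ne (hK x hx) (Ne.symm hx0)
  have h3 : eval x f < 0 := hxU
  nlinarith

theorem main' (hirr : ∀ j, Irreducible (g j)) (hcop : ∀ i j, i ≠ j → IsRelPrime (g i) (g j))
    (hb : Bornology.IsBounded (KS g)) {T : Set A2} (hT : IsPre T) (hg : ∀ j, g j ∈ T)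
    (hTK : ∀ t ∈ T, ∀ p ∈ KS g, 0 ≤ eval p t) (f : A2) (hf : ∀ p ∈ KS g, 0 ≤ eval p f) : f ∈ T := by
  induction hn : f.totalDegree using Nat.strong_induction_on generalizing f with
  | _ n ih =>
  subst hn
  by_cases hf0 : f = 0
  · rw [hf0]; exact hT.zero
  have hpos : ∀ h : A2, h ≠ 0 → ¬ IsUnit h → 0 < h.totalDegree := by
    intro h h0 hu
    by_contra hc
    have : h.totalDegree = 0 := by omega
    rw [totalDegree_eq_zero_iff_eq_C] at this
    apply hu
    rw [this]
    have h1 : coeff 0 h ≠ 0 := by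
      intro h1; rw [h1, C_0] at this; exact h0 this
    exact (IsUnit.mk0 _ h1).map C
  by_cases hsq : Squarefree f
  · by_cases hfg : ∀ j, IsRelPrime f (g j)
    · exact globalize g hirr hcop hb hT hg hTK hnonsing htrans hthree f hf hsq hfg
        (zeros_finite g f hf hsq hfg)
    · push Not at hfg
      obtain ⟨j, hj⟩ := hfg
      have hdvd : g j ∣ f := by
        rcases (hirr j).dvd_or_isRelPrime (n := f) with h | h
        · exact h
        · exact (hj h.symm).elim
      obtain ⟨f1, rfl⟩ := hdvd
      have h0 := mul_ne_zero_iff.1 hf0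
      refine hT.mul (hg j) (ih f1.totalDegree ?_ f1 ?_ rfl)
      · rw [totalDegree_mul_of_isDomain h0.1 h0.2]
        have := hpos _ h0.1 (hirr j).not_isUnit
        omega
      · exact cancel g hnonsing htrans hthree (g j) f1 h0.1 (fun p hp => hp j) hf
  · rw [Squarefree] at hsq
    push Not at hsq
    obtain ⟨h, ⟨f1, rfl⟩, hu⟩ := hsq
    have h0 := mul_ne_zero_iff.1 hf0
    have hh0 := (mul_ne_zero_iff.1 h0.1).1
    refine hT.mul (by rw [← pow_two]; exact hT.sq h) (ih f1.totalDegree ?_ f1 ?_ rfl)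
    · rw [totalDegree_mul_of_isDomain h0.1 h0.2, totalDegree_mul_of_isDomain hh0 hh0]
      have := hpos _ hh0 hu
      omega
    · exact cancel g hnonsing htrans hthree (h * h) f1 h0.1
        (fun p hp => by rw [map_mul]; exact mul_self_nonneg _) hf
end

end Sch

namespace Sch

theorem pre_isPre (S : Set A2) : IsPre (preorderingGen S) where
  add := fun h1 h2 => Subsemiring.add_mem _ h1 h2
  mul := fun h1 h2 => Subsemiring.mul_mem _ h1 h2
  sq := fun a => Subsemiring.subset_closure (Or.inr ⟨a, rfl⟩)

theorem pre_nonneg (S : Set A2) (p : Fin 2 → ℝ) (hS : ∀ a ∈ S, 0 ≤ eval p a) (t : A2)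
    (ht : t ∈ preorderingGen S) : 0 ≤ eval p t := by
  have ht' : t ∈ Subsemiring.closure (S ∪ {a | ∃ b, a = b ^ 2}) := ht
  induction ht' using Subsemiring.closure_induction with
  | mem x hx =>
    rcases hx with hx | ⟨b, rfl⟩
    · exact hS x hx
    · rw [map_pow]; exact sq_nonneg _
  | zero => simp
  | one => simp
  | add x y hx hy h1 h2 => rw [map_add]; exact add_nonneg (h1 hx) (h2 hy)
  | mul x y hx hy h1 h2 => rw [map_mul]; exact mul_nonneg (h1 hx) (h2 hy)

theorem pos_of_no_zero (f : A2) (h : ∀ p : Fin 2 → ℝ, eval p f ≠ 0) (q : Fin 2 → ℝ) (hq : 0 ≤ eval q f)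
    (p : Fin 2 → ℝ) : 0 < eval p f := by
  by_contra hc
  push Not at hc
  obtain ⟨x, hx⟩ := mem_range_of_exists_le_of_exists_ge (MvPolynomial.continuous_eval f) ⟨p, hc⟩ ⟨q, hq⟩
  exact h x hx

theorem relprime_of_trans (a b : A2) (ha : Irreducible a) (p : Fin 2 → ℝ) (hp : eval p a = 0)
    (h : eval p b = 0 → Jac p a b ≠ 0) : IsRelPrime a b := by
  rcases ha.dvd_or_isRelPrime (n := b) with ⟨c, rfl⟩ | h1
  · exfalso
    refine h (by rw [map_mul, hp, zero_mul]) ?_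
    simp [Jac, hp]
    ring
  · exact h1

theorem final (s : ℕ) (g : Fin s → A2)
    (hirr : ∀ i, Irreducible (g i)) (hb : Bornology.IsBounded (KS g))
    (hnonsing : ∀ i, ∀ p : Fin 2 → ℝ, eval p (g i) = 0 →
      (eval p (pderiv 0 (g i)) ≠ 0 ∨ eval p (pderiv 1 (g i)) ≠ 0))
    (htrans : ∀ i j, i ≠ j → ∀ p : Fin 2 → ℝ, eval p (g i) = 0 → eval p (g j) = 0 → Jac p (g i) (g j) ≠ 0)
    (hthree : ∀ i j k, i ≠ j → j ≠ k → i ≠ k → ∀ p : Fin 2 → ℝ,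
      ¬ (eval p (g i) = 0 ∧ eval p (g j) = 0 ∧ eval p (g k) = 0))
    (f : A2) (hf : ∀ p ∈ KS g, 0 ≤ eval p f) : f ∈ preorderingGen (Set.range g) := by
  classical
  have hT := pre_isPre (Set.range g)
  have hg : ∀ i, g i ∈ preorderingGen (Set.range g) := fun i => Subsemiring.subset_closure (Or.inl ⟨i, rfl⟩)
  by_cases hA : ∃ i, ∀ p : Fin 2 → ℝ, eval p (g i) < 0
  · obtain ⟨i, hi⟩ := hA
    have hempty : ∀ p, p ∉ KS (fun _ : Unit => g i) := fun p hp => absurd (hp ()) (not_le.2 (hi p))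
    refine KD (fun _ : Unit => g i) (fun _ => hirr i) (fun a b hab => (hab (Subsingleton.elim _ _)).elim) ?_ hT
      (fun _ => hg i) f (fun p hp => (hempty p hp).elim)
    rw [Set.eq_empty_of_forall_notMem hempty]
    exact Bornology.isBounded_empty
  · push Not at hA
    set g' : {i // ∃ p : Fin 2 → ℝ, eval p (g i) = 0} → A2 := fun i => g i.1 with hg'
    have hKS : KS g' = KS g := by
      ext p
      constructor
      · intro hp i
        by_cases hi : ∃ p : Fin 2 → ℝ, eval p (g i) = 0
        · exact hp ⟨i, hi⟩
        · push Not at hi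
          obtain ⟨q, hq⟩ := hA i
          exact (pos_of_no_zero (g i) hi q hq p).le
      · intro hp i
        exact hp i.1
    have hne : ∀ {i j : {i // ∃ p : Fin 2 → ℝ, eval p (g i) = 0}}, i ≠ j → i.1 ≠ j.1 :=
      fun hij h => hij (Subtype.ext h)
    refine main' g' (fun i => hnonsing i.1) (fun i j hij => htrans i.1 j.1 (hne hij))
      (fun i j k h1 h2 h3 => hthree i.1 j.1 k.1 (hne h1) (hne h2) (hne h3)) (fun i => hirr i.1) ?_
      (by rw [hKS]; exact hb) hT (fun i => hg i.1) ?_ f (by rw [hKS]; exact hf)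
    · rintro ⟨i, p, hp⟩ j hij
      exact relprime_of_trans (g i) (g j.1) (hirr i) p hp (fun h => htrans i j.1 (hne hij) p hp h)
    · intro t ht p hp
      rw [hKS] at hp
      refine pre_nonneg _ p ?_ t ht
      rintro _ ⟨i, rfl⟩
      exact hp i

end Sch

/-- Scheiderer. Let `g 1, ..., g s` be irreducible polynomials in
`ℝ[x,y]` such that the basic closed semialgebraic set `K` they define is compact, each
curve `g i = 0` has no real singular points, any two of the curves meet transversally at
their real intersection points, and no three of the curves pass through a common real
point. Then the preordering generated by the `g i` is saturated, i.e. it equals the set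
of polynomials nonnegative on `K`. -/
theorem preordering_saturated_of_transversal (s : ℕ) (g : Fin s → MvPolynomial (Fin 2) ℝ)
    (hirr : ∀ i, Irreducible (g i))
    (K : Set (Fin 2 → ℝ)) (hK : K = {p | ∀ i, 0 ≤ eval p (g i)})
    (hcompact : IsCompact K)
    (hnonsing : ∀ i, ∀ p : Fin 2 → ℝ, eval p (g i) = 0 →
      (eval p (pderiv 0 (g i)) ≠ 0 ∨ eval p (pderiv 1 (g i)) ≠ 0))
    (htrans : ∀ i j, i ≠ j → ∀ p : Fin 2 → ℝ, eval p (g i) = 0 → eval p (g j) = 0 →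
      eval p (pderiv 0 (g i)) * eval p (pderiv 1 (g j)) -
        eval p (pderiv 1 (g i)) * eval p (pderiv 0 (g j)) ≠ 0)
    (hthree : ∀ i j k, i ≠ j → j ≠ k → i ≠ k → ∀ p : Fin 2 → ℝ,
      ¬ (eval p (g i) = 0 ∧ eval p (g j) = 0 ∧ eval p (g k) = 0)) :
    preorderingGen (Set.range g) = {f | ∀ p ∈ K, 0 ≤ eval p f} := by
  subst hK
  ext f
  constructor
  · intro hf p hp
    refine Sch.pre_nonneg _ p ?_ f hf
    rintro _ ⟨i, rfl⟩
    exact hp i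
  · intro hf
    exact Sch.final s g hirr hcompact.isBounded hnonsing htrans hthree f hf
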